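/- For any cuspidal module M over V = W(m,n) or V = W(m,n) ⋉ A d_0, there exists N ∈ ℕ such that for all p,q ∈ ℤ^m, r ∈ {0,1}^n, i,j = 1,…,m, α = 1,…,n, the following elements of U(V) annihilate M: Σ_{a=0}^N (−1)^a C(N,a) (t^p t_i^a ξ^r d_j)(t_i^{q−a} d_i), Σ_{a=0}^N (−1)^a C(N,a) (t^p t_i^a ξ^r ∂_α)(t_i^{q−a} d_i), and Σ_{a=0}^N (−1)^a C(N,a) (t^p t_i^a ξ^r d_0)(t_i^{q−a} d_i). -/

import Mathlib

open scoped BigOperators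

namespace WSuper

noncomputable section

/-- Exponents of the Laurent (even) variables `t_1, …, t_m`. -/
abbrev LExp (m : ℕ) := Fin m → ℤ
/-- Exponents of the Grassmann (odd) variables `ξ_1, …, ξ_n`. -/
abbrev GExp (n : ℕ) := Fin n → Bool

variable {m n : ℕ}

/-- Degree of a Grassmann monomial `ξ^s`. -/
def gdeg (s : GExp n) : ℕ := (Finset.univ.filter fun a => s a = true).card

/-- Number of inversions between `ξ^s` and `ξ^q`. -/
def invCount (s q : GExp n) : ℕ :=
  ((Finset.univ ×ˢ Finset.univ).filter
    fun p : Fin n × Fin n => s p.1 = true ∧ q p.2 = true ∧ p.2 < p.1).card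

/-- The scalar `c` with `ξ^s · ξ^q = c · ξ^(s xor q)` in the exterior algebra. -/
def mulSgn (s q : GExp n) : ℂ :=
  if ∃ a, s a = true ∧ q a = true then 0 else (-1 : ℂ) ^ invCount s q

/-- Exponent of the product of two (disjoint) Grassmann monomials. -/
def xorE (s q : GExp n) : GExp n := fun a => Bool.xor (s a) (q a)

/-- The scalar `c` with `∂_a (ξ^s) = c ξ^(s \ a)`. -/
def derC (a : Fin n) (s : GExp n) : ℂ :=
  if s a = true then (-1 : ℂ) ^ (Finset.univ.filter fun x => s x = true ∧ x < a).card else 0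

/-- The exponent of `∂_a (ξ^s)`. -/
def derE (a : Fin n) (s : GExp n) : GExp n := Function.update s a false

/-- Directions: `d_i = t_i ∂/∂t_i`, `∂_α = ∂/∂ξ_α`, and (when `b = true`) the extra
even direction `d_0` of `W(m,n) ⋉ A d_0`. -/
inductive Dir (m n : ℕ) : Bool → Type where
  | di {b : Bool} (i : Fin m) : Dir m n b
  | pa {b : Bool} (a : Fin n) : Dir m n b
  | d0 : Dir m n true

/-- The basis `t^r ξ^s D` of `W(m,n)` (for `b = false`) resp. of `W(m,n) ⋉ A d_0`
(for `b = true`). -/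
abbrev WBasis (m n : ℕ) (b : Bool) := LExp m × GExp n × Dir m n b

/-- The Lie superalgebra `W(m,n)` (`b = false`) resp. `W(m,n) ⋉ A d_0` (`b = true`),
as the free complex vector space on its standard basis. -/
abbrev W (m n : ℕ) (b : Bool) := WBasis m n b →₀ ℂ

def sng {b : Bool} (x : WBasis m n b) : W m n b := Finsupp.single x 1

/-- Parity (0 = even, 1 = odd) of a basis element. -/
def par {b : Bool} : WBasis m n b → ℕ
  | ⟨_, s, .di _⟩ => gdeg s % 2
  | ⟨_, s, .pa _⟩ => (gdeg s + 1) % 2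
  | ⟨_, s, .d0⟩ => gdeg s % 2

/-- The super Lie bracket of `W(m,n)` (resp. `W(m,n) ⋉ A d_0`) on basis elements. -/
def brB {b : Bool} : WBasis m n b → WBasis m n b → W m n b
  | ⟨r, s, .di i⟩, ⟨p, q, .di j⟩ =>
      ((p i : ℂ) * mulSgn s q) • sng ⟨r + p, xorE s q, .di j⟩
        - ((r j : ℂ) * mulSgn s q) • sng ⟨r + p, xorE s q, .di i⟩
  | ⟨r, s, .di i⟩, ⟨p, q, .pa β⟩ =>
      ((p i : ℂ) * mulSgn s q) • sng ⟨r + p, xorE s q, .pa β⟩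
        - ((-1 : ℂ) ^ (gdeg s * (gdeg q + 1)) * derC β s * mulSgn q (derE β s)) •
            sng ⟨r + p, xorE q (derE β s), .di i⟩
  | ⟨r, s, .pa α⟩, ⟨p, q, .di j⟩ =>
      (derC α q * mulSgn s (derE α q)) • sng ⟨r + p, xorE s (derE α q), .di j⟩
        - ((-1 : ℂ) ^ ((gdeg s + 1) * gdeg q) * (r j : ℂ) * mulSgn q s) •
            sng ⟨r + p, xorE q s, .pa α⟩
  | ⟨r, s, .pa α⟩, ⟨p, q, .pa β⟩ =>
      (derC α q * mulSgn s (derE α q)) • sng ⟨r + p, xorE s (derE α q), .pa β⟩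
        - ((-1 : ℂ) ^ ((gdeg s + 1) * (gdeg q + 1)) * derC β s * mulSgn q (derE β s)) •
            sng ⟨r + p, xorE q (derE β s), .pa α⟩
  | ⟨r, s, .di i⟩, ⟨p, q, .d0⟩ =>
      ((p i : ℂ) * mulSgn s q) • sng ⟨r + p, xorE s q, .d0⟩
  | ⟨r, s, .pa α⟩, ⟨p, q, .d0⟩ =>
      (derC α q * mulSgn s (derE α q)) • sng ⟨r + p, xorE s (derE α q), .d0⟩
  | ⟨r, s, .d0⟩, ⟨p, q, .di j⟩ =>
      (-(r j : ℂ) * mulSgn s q) • sng ⟨r + p, xorE s q, .d0⟩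
  | ⟨r, s, .d0⟩, ⟨p, q, .pa β⟩ =>
      (-(-1 : ℂ) ^ (gdeg s * (gdeg q + 1)) * derC β s * mulSgn q (derE β s)) •
          sng ⟨r + p, xorE q (derE β s), .d0⟩
  | ⟨_, _, .d0⟩, ⟨_, _, .d0⟩ => 0

/-- A module over the Lie superalgebra `W(m,n)` (resp. `W(m,n) ⋉ A d_0`):
a complex vector space with a linear action satisfying the super commutator rule. -/
structure WRep (m n : ℕ) (b : Bool) where
  M : Type
  [addgrp : AddCommGroup M]
  [mods : Module ℂ M]
  act : W m n b →ₗ[ℂ] M →ₗ[ℂ] M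
  super : ∀ x y : WBasis m n b,
    act (brB x y)
      = act (sng x) ∘ₗ act (sng y)
        - ((-1 : ℂ) ^ (par x * par y)) • (act (sng y) ∘ₗ act (sng x))

attribute [instance] WRep.addgrp WRep.mods

/-- A raw action of (the basis of) `W(m,n)` resp. `W(m,n) ⋉ A d_0` on a vector space. -/
abbrev GAct (m n : ℕ) (b : Bool) (M : Type) [AddCommGroup M] [Module ℂ M] :=
  WBasis m n b → M →ₗ[ℂ] M

/-- Index set for the Cartan subalgebra `h'`: the elements `d_1, …, d_m`,
together with `d_0` when `b = true`. -/
abbrev HIdx (m : ℕ) (b : Bool) := Fin m ⊕ Fin (cond b 1 0)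

def hB (m n : ℕ) (b : Bool) : HIdx m b → WBasis m n b :=
  fun h => match b, h with
    | _, .inl i => ⟨0, fun _ => false, .di i⟩
    | true, .inr _ => ⟨0, fun _ => false, .d0⟩
    | false, .inr j => j.elim0

/-- The basis element `ξ_a ∂_a` of the odd Cartan subalgebra `h''`. -/
def hppB (m n : ℕ) (b : Bool) (a : Fin n) : WBasis m n b :=
  ⟨0, fun x => decide (x = a), .pa a⟩

section Predicates

variable {M : Type} [AddCommGroup M] [Module ℂ M] {b : Bool}

/-- Weight space with respect to the even Cartan subalgebra `h'`. -/
def wtG (F : GAct m n b M) (lam : HIdx m b → ℂ) : Submodule ℂ M :=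
  ⨅ h, LinearMap.ker (F (hB m n b h) - lam h • (LinearMap.id : M →ₗ[ℂ] M))

/-- Weight space with respect to the full Cartan subalgebra `h = h' ⊕ h''`. -/
def wtFullG (F : GAct m n b M) (lam : HIdx m b → ℂ) (mu : Fin n → ℂ) : Submodule ℂ M :=
  wtG F lam ⊓
    ⨅ a, LinearMap.ker (F (hppB m n b a) - mu a • (LinearMap.id : M →ₗ[ℂ] M))

/-- Strong Harish-Chandra module: weight decomposition with respect to `h'`
with finite-dimensional weight spaces. -/
def IsStrongHCG (F : GAct m n b M) : Prop :=
  (⨆ lam, wtG F lam) = ⊤ ∧ ∀ lam, FiniteDimensional ℂ (wtG F lam)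

/-- Harish-Chandra module: weight decomposition with respect to `h`
with finite-dimensional weight spaces. -/
def IsHCG (F : GAct m n b M) : Prop :=
  (⨆ lam, ⨆ mu, wtFullG F lam mu) = ⊤ ∧
    ∀ lam mu, FiniteDimensional ℂ (wtFullG F lam mu)

/-- Strongly cuspidal: strong Harish-Chandra with uniformly bounded multiplicities. -/
def IsStronglyCuspidalG (F : GAct m n b M) : Prop :=
  IsStrongHCG F ∧ ∃ C : ℕ, ∀ lam, Module.finrank ℂ (wtG F lam) ≤ C

/-- Cuspidal: Harish-Chandra with uniformly bounded weight multiplicities. -/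
def IsCuspidalG (F : GAct m n b M) : Prop :=
  IsHCG F ∧ ∃ C : ℕ, ∀ lam mu, Module.finrank ℂ (wtFullG F lam mu) ≤ C

/-- The action of the odd Cartan subalgebra `h''` is diagonalizable. -/
def DiagHppG (F : GAct m n b M) : Prop :=
  (⨆ mu : Fin n → ℂ,
    ⨅ a, LinearMap.ker (F (hppB m n b a) - mu a • (LinearMap.id : M →ₗ[ℂ] M))) = ⊤

def InvariantG (F : GAct m n b M) (N : Submodule ℂ M) : Prop :=
  ∀ x : WBasis m n b, ∀ v ∈ N, F x v ∈ N

/-- Simplicity of a module, phrased via invariant subspaces. -/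
def IsSimpleG (F : GAct m n b M) : Prop :=
  (∃ v : M, v ≠ 0) ∧ ∀ N : Submodule ℂ M, InvariantG F N → N = ⊥ ∨ N = ⊤

end Predicates

/-- The action of basis elements attached to a representation. -/
def WRep.g {b : Bool} (ρ : WRep m n b) : GAct m n b ρ.M := fun x => ρ.act (sng x)

end

end WSuper

namespace WSuper

noncomputable section

/-- `t_i^a • ε_i` added to an exponent `p`. -/
def addI {m : ℕ} (p : LExp m) (i : Fin m) (a : ℤ) : LExp m :=
  fun x => p x + if x = i then a else 0

/-- The exponent `(q - a) ε_i`. -/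
def onlyI {m : ℕ} (i : Fin m) (a : ℤ) : LExp m :=
  fun x => if x = i then a else 0

end

noncomputable section

section ShiftAction

open MvPolynomial

variable {σ τ : Type} {E E' : Type*} [AddCommGroup E] [Module ℂ E] [AddCommGroup E'] [Module ℂ E']

/-- Polynomials act on functions on the lattice `ℤ^σ`, the variable `X i` being the
translation by the `i`-th basis vector. -/
def shiftAct : MvPolynomial σ ℂ →ₐ[ℂ] Module.End ℂ ((σ → ℤ) → E) :=
  AddMonoidAlgebra.lift ℂ (Module.End ℂ ((σ → ℤ) → E)) (σ →₀ ℕ)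
    { toFun := fun s => LinearMap.funLeft ℂ E
        (fun a i => a i + ((Multiplicative.toAdd s i : ℕ) : ℤ))
      map_one' := by
        ext G a
        simp [LinearMap.funLeft_apply]
      map_mul' := by
        intro s t
        ext G a
        simp only [LinearMap.funLeft_apply, Module.End.mul_apply]
        congr 1
        ext i
        simp only [toAdd_mul, Finsupp.add_apply, Nat.cast_add]
        ring }

theorem shiftAct_monomial (s : σ →₀ ℕ) (c : ℂ) (G : (σ → ℤ) → E) (a : σ → ℤ) :
    shiftAct (monomial s c) G a = c • G (fun i => a i + (s i : ℤ)) := by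
  have h : (monomial s c : MvPolynomial σ ℂ) = AddMonoidAlgebra.single s c := rfl
  rw [h, shiftAct, AddMonoidAlgebra.lift_single]
  rfl

theorem shiftAct_X [DecidableEq σ] (i : σ) (G : (σ → ℤ) → E) (a : σ → ℤ) :
    shiftAct (X i) G a = G (a + Pi.single i 1) := by
  rw [X, shiftAct_monomial, one_smul]
  congr 1
  ext j
  by_cases h : j = i
  · subst h; simp
  · simp [h]

theorem shiftAct_C (c : ℂ) (G : (σ → ℤ) → E) : shiftAct (C c) G = c • G := by
  ext a
  rw [C_apply, shiftAct_monomial]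
  simp

theorem shiftAct_mul (p q : MvPolynomial σ ℂ) (G : (σ → ℤ) → E) :
    shiftAct (p * q) G = shiftAct p (shiftAct q G) := by
  rw [map_mul]; rfl

theorem shiftAct_add (p q : MvPolynomial σ ℂ) (G : (σ → ℤ) → E) :
    shiftAct (p + q) G = shiftAct p G + shiftAct q G := by
  rw [map_add]; rfl

theorem shiftAct_sub (p q : MvPolynomial σ ℂ) (G : (σ → ℤ) → E) :
    shiftAct (p - q) G = shiftAct p G - shiftAct q G := by
  rw [map_sub]; rfl

theorem shiftAct_comp [DecidableEq σ] [DecidableEq τ] (f : σ → τ) (ψ : (σ → ℤ) → (τ → ℤ))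
    (hψ : ∀ b i, ψ (b + Pi.single i 1) = ψ b + Pi.single (f i) 1)
    (p : MvPolynomial σ ℂ) (G : (τ → ℤ) → E) :
    shiftAct p (fun b => G (ψ b)) = fun b => shiftAct (rename f p) G (ψ b) := by
  induction p using MvPolynomial.induction_on generalizing G with
  | C c => simp only [rename_C, shiftAct_C]; rfl
  | add p q hp hq => rw [shiftAct_add, hp, hq, map_add, shiftAct_add]; rfl
  | mul_X p i hp =>
    rw [shiftAct_mul]
    have h : shiftAct (X i) (fun b => G (ψ b)) = fun b => shiftAct (X (f i)) G (ψ b) := by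
      ext b
      rw [shiftAct_X, shiftAct_X, hψ]
    rw [h, hp, map_mul, rename_X, shiftAct_mul]

theorem shiftAct_translate (p : MvPolynomial σ ℂ) (G : (σ → ℤ) → E) (c a : σ → ℤ) :
    shiftAct p (fun b => G (b + c)) a = shiftAct p G (a + c) := by
  classical
  have h := shiftAct_comp id (fun b : σ → ℤ => b + c)
    (by intro b i; simp only [id]; abel) p G
  rw [h, rename_id]
  rfl

theorem shiftAct_linear (L : E →ₗ[ℂ] E') (p : MvPolynomial σ ℂ) (G : (σ → ℤ) → E)
    (a : σ → ℤ) :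
    shiftAct p (fun b => L (G b)) a = L (shiftAct p G a) := by
  induction p using MvPolynomial.induction_on' with
  | monomial s c => simp only [shiftAct_monomial, map_smul]
  | add p q hp hq =>
    rw [shiftAct_add, Pi.add_apply, hp, hq, shiftAct_add, Pi.add_apply, map_add]

theorem shiftAct_coeff (i : σ) (p : MvPolynomial σ ℂ) (G : (σ → ℤ) → E) (a : σ → ℤ) :
    shiftAct p (fun b => (b i : ℂ) • G b) a =
      (a i : ℂ) • shiftAct p G a + shiftAct (X i * pderiv i p) G a := by
  induction p using MvPolynomial.induction_on' with
  | monomial s c =>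
    rw [X_mul_pderiv_monomial, map_nsmul]
    simp only [shiftAct_monomial, LinearMap.smul_apply, Pi.smul_apply]
    push_cast
    rw [add_smul, smul_add, smul_comm]
    congr 1
    rw [Nat.cast_smul_eq_nsmul, smul_comm]
  | add p q hp hq =>
    rw [map_add (pderiv i), mul_add]
    simp only [shiftAct_add, Pi.add_apply, hp, hq, smul_add]
    abel

/-- The ideal of polynomials whose shift action kills `G`. -/
def shiftAnn (G : (σ → ℤ) → E) : Ideal (MvPolynomial σ ℂ) where
  carrier := {p | shiftAct p G = 0}
  add_mem' := by
    intro p q hp hq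
    rw [Set.mem_ofPred_eq] at *
    rw [shiftAct_add, hp, hq, add_zero]
  zero_mem' := by simp
  smul_mem' := by
    intro p q hq
    rw [Set.mem_ofPred_eq] at *
    rw [smul_eq_mul]
    rw [shiftAct_mul, hq, map_zero]

theorem mem_shiftAnn {G : (σ → ℤ) → E} {p : MvPolynomial σ ℂ} :
    p ∈ shiftAnn G ↔ shiftAct p G = 0 := Iff.rfl

theorem mem_shiftAnn_of_dvd {G : (σ → ℤ) → E} {p q : MvPolynomial σ ℂ} (h : p ∣ q)
    (hp : p ∈ shiftAnn G) : q ∈ shiftAnn G :=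
  Ideal.mem_of_dvd _ h hp

theorem totalDegree_pderiv_succ_le {n : ℕ} {p : MvPolynomial σ ℂ} (hp : p.totalDegree ≤ n + 1)
    (i : σ) : (pderiv i p).totalDegree ≤ n := by
  rw [MvPolynomial.totalDegree, Finset.sup_le_iff]
  intro s hs
  rw [mem_support_iff, coeff_pderiv] at hs
  have h1 : s + Finsupp.single i 1 ∈ p.support := by
    rw [mem_support_iff]
    exact left_ne_zero_of_mul hs
  have h2 := (le_totalDegree h1).trans hp
  rw [Finsupp.sum_add_index' (by simp) (by simp), Finsupp.sum_single_index (by simp)] at h2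
  omega

/-- The functions transforming like a product of Witt generators under commutators. -/
def IsCov {M : Type*} [AddCommGroup M] [Module ℂ M] [Fintype σ] [DecidableEq σ]
    (e : ℤ → Module.End ℂ M) (F : (σ → ℤ) → Module.End ℂ M) : Prop :=
  ∀ (k : ℤ) (a : σ → ℤ), e k * F a - F a * e k =
    ∑ i, ((a i : ℂ) - k) • F (a + Pi.single i k)

section Cov

variable {M : Type*} [AddCommGroup M] [Module ℂ M] [Fintype σ] [DecidableEq σ]
  {e : ℤ → Module.End ℂ M} {F : (σ → ℤ) → Module.End ℂ M}

theorem IsCov.shiftAct (hF : IsCov e F) (p : MvPolynomial σ ℂ) (k : ℤ) (a : σ → ℤ) :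
    e k * shiftAct p F a - shiftAct p F a * e k =
      ∑ i, (((a i : ℂ) - k) • shiftAct p F (a + Pi.single i k) +
        WSuper.shiftAct (X i * pderiv i p) F (a + Pi.single i k)) := by
  have h1 := shiftAct_linear (LinearMap.mulLeft ℂ (e k) - LinearMap.mulRight ℂ (e k)) p F a
  simp only [LinearMap.sub_apply, LinearMap.mulLeft_apply, LinearMap.mulRight_apply] at h1
  rw [← h1]
  have h2 : (fun b => e k * F b - F b * e k) =
      ∑ i, ((fun b : σ → ℤ => (b i : ℂ) • F (b + Pi.single i k)) -
        (k : ℂ) • fun b : σ → ℤ => F (b + Pi.single i k)) := by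
    ext1 b
    rw [hF k b]
    simp [sub_smul]
  rw [h2, map_sum, Finset.sum_apply]
  refine Finset.sum_congr rfl fun i _ => ?_
  rw [map_sub, map_smul, Pi.sub_apply, Pi.smul_apply, shiftAct_coeff, shiftAct_translate,
    shiftAct_translate, sub_smul]
  abel

theorem IsCov.sum_shift_eq_zero (hF : IsCov e F) {p : MvPolynomial σ ℂ} (hp : p ∈ shiftAnn F)
    (k : ℤ) (a : σ → ℤ) :
    ∑ i, WSuper.shiftAct (X i * pderiv i p) F (a + Pi.single i k) = 0 := by
  have h := hF.shiftAct p k a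
  rw [mem_shiftAnn.1 hp] at h
  simpa using h.symm

theorem IsCov.sum_pow_pderiv_mem (hF : IsCov e F) {p : MvPolynomial σ ℂ} (hp : p ∈ shiftAnn F)
    {l : ℕ} (hl : l ≤ 2) : ∑ i, X i ^ l * pderiv i p ∈ shiftAnn F := by
  rw [mem_shiftAnn, map_sum]
  ext1 a
  rw [LinearMap.sum_apply, Finset.sum_apply]
  interval_cases l
  · rw [Pi.zero_apply, ← hF.sum_shift_eq_zero hp (-1) a]
    refine Finset.sum_congr rfl fun i _ => ?_
    rw [pow_zero, one_mul, shiftAct_mul, shiftAct_X, add_assoc, ← Pi.single_add]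
    simp
  · rw [Pi.zero_apply, ← hF.sum_shift_eq_zero hp 0 a]
    simp
  · rw [Pi.zero_apply, ← hF.sum_shift_eq_zero hp 1 a]
    refine Finset.sum_congr rfl fun i _ => ?_
    rw [pow_two, mul_assoc, shiftAct_mul, shiftAct_X]

end Cov

section Three

variable {M : Type*} [AddCommGroup M] [Module ℂ M]
  {e : ℤ → Module.End ℂ M} {F : (Fin 3 → ℤ) → Module.End ℂ M}

/-- The Vandermonde polynomial in three variables. -/
def vdm : MvPolynomial (Fin 3) ℂ := (X 0 - X 1) * (X 0 - X 2) * (X 1 - X 2)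

theorem IsCov.vdm_mul_pderiv_mem (hF : IsCov e F) {p : MvPolynomial (Fin 3) ℂ}
    (hp : p ∈ shiftAnn F) (i : Fin 3) : vdm * pderiv i p ∈ shiftAnn F := by
  have h0 := hF.sum_pow_pderiv_mem hp (l := 0) (by norm_num)
  have h1 := hF.sum_pow_pderiv_mem hp (l := 1) (by norm_num)
  have h2 := hF.sum_pow_pderiv_mem hp (l := 2) (by norm_num)
  simp only [Fin.sum_univ_three] at h0 h1 h2
  fin_cases i
  · convert Ideal.mul_mem_left _ (X 1 - X 2) (add_mem (sub_mem h2
      (Ideal.mul_mem_left _ (X 1 + X 2) h1)) (Ideal.mul_mem_left _ (X 1 * X 2) h0)) using 1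
    simp only [vdm, Fin.zero_eta]
    ring
  · convert Ideal.mul_mem_left _ (X 2 - X 0) (add_mem (sub_mem h2
      (Ideal.mul_mem_left _ (X 0 + X 2) h1)) (Ideal.mul_mem_left _ (X 0 * X 2) h0)) using 1
    simp only [vdm, Fin.mk_one]
    ring
  · convert Ideal.mul_mem_left _ (X 0 - X 1) (add_mem (sub_mem h2
      (Ideal.mul_mem_left _ (X 0 + X 1) h1)) (Ideal.mul_mem_left _ (X 0 * X 1) h0)) using 1
    simp only [vdm, Fin.reduceFinMk]
    ring

theorem IsCov.vdm_pow_mul_pderiv_mem (hF : IsCov e F) {p : MvPolynomial (Fin 3) ℂ} {k : ℕ}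
    (hp : vdm ^ k * p ∈ shiftAnn F) (i : Fin 3) : vdm ^ (k + 1) * pderiv i p ∈ shiftAnn F := by
  have h := hF.vdm_mul_pderiv_mem hp i
  rw [pderiv_mul, pderiv_pow] at h
  convert sub_mem h (Ideal.mul_mem_left _ ((k : MvPolynomial (Fin 3) ℂ) * pderiv i vdm) hp) using 1
  rcases k with _ | k
  · simp
  · simp only [Nat.add_sub_cancel]
    ring

/-- Repeated differentiation of a relation leads to a power of the Vandermonde polynomial. -/
theorem IsCov.vdm_pow_mem (hF : IsCov e F) {n k : ℕ} {p : MvPolynomial (Fin 3) ℂ} (h0 : p ≠ 0)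
    (hn : p.totalDegree ≤ n) (hp : vdm ^ k * p ∈ shiftAnn F) : vdm ^ (k + n) ∈ shiftAnn F := by
  have hconst : ∀ {n k : ℕ} {p : MvPolynomial (Fin 3) ℂ}, p ≠ 0 → vdm ^ k * p ∈ shiftAnn F →
      p.totalDegree = 0 → vdm ^ (k + n) ∈ shiftAnn F := by
    intro n k p h0 hp hd
    rw [totalDegree_eq_zero_iff_eq_C] at hd
    have hc : coeff 0 p ≠ 0 := by
      rintro h
      rw [h, C_0] at hd
      exact h0 hd
    rw [hd] at hp
    convert Ideal.mul_mem_left _ (C (coeff 0 p)⁻¹ * vdm ^ n) hp using 1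
    have : (C (coeff 0 p)⁻¹ * C (coeff 0 p) : MvPolynomial (Fin 3) ℂ) = 1 := by
      rw [← C_mul, inv_mul_cancel₀ hc, C_1]
    linear_combination (-vdm ^ (k + n)) * this
  induction n generalizing k p with
  | zero => exact hconst (n := 0) h0 hp (by omega)
  | succ n ih =>
    by_cases hd : p.totalDegree = 0
    · exact hconst h0 hp hd
    · have : ∃ i, pderiv i p ≠ 0 := by
        by_contra! hall
        refine hd ?_
        rw [MvPolynomial.totalDegree_eq_zero_iff]
        intro s hs i
        by_contra hsi
        have h1 := coeff_pderiv (m := s - Finsupp.single i 1) (p := p) (i := i)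
        rw [hall i, tsub_add_cancel_of_le (by
          rw [Finsupp.single_le_iff]; omega), coeff_zero] at h1
        have h2 := mul_ne_zero (mem_support_iff.1 hs)
          (Nat.cast_add_one_ne_zero (R := ℂ) ((s - Finsupp.single i 1 : Fin 3 →₀ ℕ) i))
        exact h2 h1.symm
      obtain ⟨i, hi⟩ := this
      have := ih hi (totalDegree_pderiv_succ_le hn i) (hF.vdm_pow_mul_pderiv_mem hp i)
      rwa [add_assoc, add_comm 1 n] at this

end Three

end ShiftAction

section Words

open MvPolynomial

theorem shiftAct_swap_mem {σ : Type} [DecidableEq σ] {E : Type*} [AddCommGroup E] [Module ℂ E]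
    {G : (σ → ℤ) → E} (s t : σ)
    (hG : (X s - X t) ^ 2 ∈ shiftAnn fun a => G (a ∘ Equiv.swap s t) - G a)
    (p : MvPolynomial σ ℂ) (a : σ → ℤ) :
    shiftAct ((X s - X t) ^ 2 * p) G a =
      shiftAct ((X s - X t) ^ 2 * rename (Equiv.swap s t) p) G (a ∘ Equiv.swap s t) := by
  have h1 : shiftAct ((X s - X t) ^ 2 : MvPolynomial σ ℂ) (fun a => G (a ∘ Equiv.swap s t)) =
      shiftAct ((X s - X t) ^ 2) G := by
    have : (fun a => G (a ∘ Equiv.swap s t) - G a) = (fun a => G (a ∘ Equiv.swap s t)) - G := rfl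
    rw [mem_shiftAnn, this, map_sub, sub_eq_zero] at hG
    exact hG
  have h2 := shiftAct_comp (Equiv.swap s t) (fun b : σ → ℤ => b ∘ Equiv.swap s t) (by
    intro b i
    ext j
    simp only [Function.comp_apply, Pi.add_apply, Pi.single_apply]
    congr 1
    simp only [Equiv.swap_apply_eq_iff]) (p * (X s - X t) ^ 2) G
  rw [shiftAct_mul, h1, ← shiftAct_mul] at h2
  have h3 : rename (Equiv.swap s t) (p * (X s - X t) ^ 2) =
      (X s - X t) ^ 2 * rename (Equiv.swap s t) p := by
    simp only [map_mul, map_pow, map_sub, rename_X, Equiv.swap_apply_left, Equiv.swap_apply_right]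
    ring
  rw [h3] at h2
  rw [mul_comm, h2]

theorem swap_rename_mem {σ : Type} [DecidableEq σ] {E : Type*} [AddCommGroup E] [Module ℂ E]
    {G : (σ → ℤ) → E} (s t : σ)
    (hG : (X s - X t) ^ 2 ∈ shiftAnn fun a => G (a ∘ Equiv.swap s t) - G a)
    {p : MvPolynomial σ ℂ} (hp : p ∈ shiftAnn G) :
    (X s - X t) ^ 2 * rename (Equiv.swap s t) p ∈ shiftAnn G := by
  rw [mem_shiftAnn]
  ext1 a
  have h := shiftAct_swap_mem s t hG p (a ∘ Equiv.swap s t)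
  have h2 : (a ∘ Equiv.swap s t) ∘ Equiv.swap s t = a := by
    ext; simp
  rw [h2] at h
  rw [← h, mem_shiftAnn.1 (Ideal.mul_mem_left _ _ hp)]
  rfl

variable {M : Type*} [AddCommGroup M] [Module ℂ M]

/-- The product `e (a 0) * e (a 1)`. -/
def word2 (e : ℤ → Module.End ℂ M) : (Fin 2 → ℤ) → Module.End ℂ M := fun a => e (a 0) * e (a 1)

/-- The product `e (a 0) * e (a 1) * e (a 2)`. -/
def word3 (e : ℤ → Module.End ℂ M) : (Fin 3 → ℤ) → Module.End ℂ M :=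
  fun a => e (a 0) * e (a 1) * e (a 2)

/-- The product `e (a 0) * e (a 1) * (e (a 2) * e (a 3))`. -/
def word4 (e : ℤ → Module.End ℂ M) : (Fin 4 → ℤ) → Module.End ℂ M :=
  fun a => e (a 0) * e (a 1) * (e (a 2) * e (a 3))

/-- The commutation relations of the Witt algebra. -/
def IsWitt (e : ℤ → Module.End ℂ M) : Prop :=
  ∀ k l : ℤ, e k * e l - e l * e k = ((l : ℂ) - k) • e (k + l)

variable {e : ℤ → Module.End ℂ M}

theorem IsWitt.word2_cov (he : IsWitt e) : IsCov e (word2 e) := by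
  intro k a
  simp only [word2, Fin.sum_univ_two, Pi.add_apply, Pi.single_apply]
  have h0 := he k (a 0)
  have h1 := he k (a 1)
  rw [add_comm k] at h0 h1
  simp only [if_true, if_false, Fin.isValue, zero_ne_one, one_ne_zero, add_zero]
  rw [← smul_mul_assoc, ← mul_smul_comm, ← h0, ← h1]
  noncomm_ring

theorem IsWitt.word3_cov (he : IsWitt e) : IsCov e (word3 e) := by
  intro k a
  simp only [word3, Fin.sum_univ_three, Pi.add_apply, Pi.single_apply]
  have h0 := he k (a 0)
  have h1 := he k (a 1)
  have h2 := he k (a 2)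
  rw [add_comm k] at h0 h1 h2
  simp only [if_true, if_false, Fin.isValue, zero_ne_one, one_ne_zero, add_zero, Fin.reduceEq]
  rw [← smul_mul_assoc, ← smul_mul_assoc, ← smul_mul_assoc, ← mul_smul_comm, ← mul_smul_comm,
    ← h0, ← h1, ← h2]
  noncomm_ring

theorem shiftAct_sub_sq {σ : Type} [DecidableEq σ] {E : Type*} [AddCommGroup E] [Module ℂ E]
    (s t : σ) (G : (σ → ℤ) → E) (a : σ → ℤ) :
    shiftAct ((X s - X t) ^ 2 : MvPolynomial σ ℂ) G a =
      (G (a + Pi.single s 1 + Pi.single s 1) - G (a + Pi.single s 1 + Pi.single t 1)) -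
        (G (a + Pi.single t 1 + Pi.single s 1) - G (a + Pi.single t 1 + Pi.single t 1)) := by
  rw [pow_two, shiftAct_mul, shiftAct_sub, Pi.sub_apply, shiftAct_X, shiftAct_X, shiftAct_sub,
    Pi.sub_apply, Pi.sub_apply]
  simp only [shiftAct_X]

/-- A second difference kills the commutator of two adjacent letters. -/
theorem sub_sq_mem_of_eq {σ : Type} [DecidableEq σ] {E : Type*} [AddCommGroup E] [Module ℂ E]
    {s t : σ} (hst : s ≠ t) {G : (σ → ℤ) → E} (H : (σ → ℤ) → E)
    (hH : ∀ a : σ → ℤ, H (a + Pi.single s 1) = H (a + Pi.single t 1))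
    (hG : ∀ a, G a = ((a s : ℂ) - a t) • H a) :
    (X s - X t) ^ 2 ∈ shiftAnn G := by
  rw [mem_shiftAnn]
  ext1 a
  rw [shiftAct_sub_sq]
  simp only [hG, hH]
  rw [add_right_comm a (Pi.single s 1) (Pi.single t 1), hH]
  simp only [Pi.add_apply, Pi.single_apply, hst, hst.symm, if_true, if_false, Pi.zero_apply]
  push_cast
  simp only [← sub_smul]
  convert zero_smul ℂ _ using 2
  ring

theorem IsWitt.word4_swap (he : IsWitt e) :
    (X 2 - X 3) ^ 2 ∈ shiftAnn fun a => word4 e (a ∘ Equiv.swap 2 3) - word4 e a := by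
  refine sub_sq_mem_of_eq (by decide)
    (fun a => e (a 0) * e (a 1) * e (a 2 + a 3)) ?_ ?_
  · intro a
    simp [add_right_comm, ← add_assoc]
  · intro a
    have h := he (a 3) (a 2)
    have h0 : Equiv.swap (2 : Fin 4) 3 0 = 0 := by decide
    have h1 : Equiv.swap (2 : Fin 4) 3 1 = 1 := by decide
    simp only [word4, Function.comp_apply, Equiv.swap_apply_left, Equiv.swap_apply_right, h0, h1]
    rw [← mul_smul_comm, add_comm (a 2), ← h, mul_sub]

theorem IsWitt.word3_swap12 (he : IsWitt e) :
    (X 1 - X 2) ^ 2 ∈ shiftAnn fun a => word3 e (a ∘ Equiv.swap 1 2) - word3 e a := by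
  refine sub_sq_mem_of_eq (by decide)
    (fun a => e (a 0) * e (a 1 + a 2)) ?_ ?_
  · intro a
    simp [add_right_comm, ← add_assoc]
  · intro a
    have h := he (a 2) (a 1)
    have h0 : Equiv.swap (1 : Fin 3) 2 0 = 0 := by decide
    simp only [word3, Function.comp_apply, Equiv.swap_apply_left, Equiv.swap_apply_right, h0]
    rw [← mul_smul_comm, add_comm (a 1), ← h, mul_sub, mul_assoc, mul_assoc]

theorem IsWitt.word3_swap01 (he : IsWitt e) :
    (X 0 - X 1) ^ 2 ∈ shiftAnn fun a => word3 e (a ∘ Equiv.swap 0 1) - word3 e a := by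
  refine sub_sq_mem_of_eq (by decide)
    (fun a => e (a 0 + a 1) * e (a 2)) ?_ ?_
  · intro a
    simp [add_right_comm, ← add_assoc]
  · intro a
    have h := he (a 1) (a 0)
    have h0 : Equiv.swap (0 : Fin 3) 1 2 = 2 := by decide
    simp only [word3, Function.comp_apply, Equiv.swap_apply_left, Equiv.swap_apply_right, h0]
    rw [← smul_mul_assoc, add_comm (a 0), ← h, sub_mul]

/-- The embedding of the first three letters. -/
abbrev fst3 : Fin 3 → Fin 4 := Fin.castSucc

theorem shiftAct_word4_of_word3 (p : MvPolynomial (Fin 3) ℂ) (a : Fin 4 → ℤ) :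
    shiftAct (rename fst3 p) (word4 e) a = shiftAct p (word3 e) (a ∘ fst3) * e (a 3) := by
  have h := shiftAct_comp fst3 (fun b : Fin 3 → ℤ => (Fin.snoc b (a 3) : Fin 4 → ℤ)) (by
    intro b i
    ext j
    refine Fin.lastCases ?_ (fun j => ?_) j
    · rw [Pi.add_apply, Fin.snoc_last, Fin.snoc_last,
        Pi.single_eq_of_ne (Fin.castSucc_lt_last i).ne', add_zero]
    · simp [Pi.single_apply]) p (word4 e)
  have h2 := congrFun h (a ∘ fst3)
  have h3 : (Fin.snoc (a ∘ fst3) (a 3) : Fin 4 → ℤ) = a := Fin.snoc_init_self a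
  rw [h3] at h2
  rw [← h2]
  have h4 := shiftAct_linear (LinearMap.mulRight ℂ (e (a 3))) p (word3 e) (a ∘ fst3)
  simp only [LinearMap.mulRight_apply] at h4
  rw [← h4]
  rfl

theorem shiftAct_word4_of_word2 (p q : MvPolynomial (Fin 2) ℂ) (a : Fin 4 → ℤ) :
    shiftAct (rename ![0, 1] p * rename ![2, 3] q) (word4 e) a =
      shiftAct p (word2 e) ![a 0, a 1] * shiftAct q (word2 e) ![a 2, a 3] := by
  have ha : a = ![a 0, a 1, a 2, a 3] := by
    ext i; fin_cases i <;> rfl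
  have hq : ∀ a : Fin 4 → ℤ, shiftAct (rename ![2, 3] q) (word4 e) a =
      e (a 0) * e (a 1) * shiftAct q (word2 e) ![a 2, a 3] := by
    intro a
    have ha : a = ![a 0, a 1, a 2, a 3] := by
      ext i; fin_cases i <;> rfl
    have h := congrFun (shiftAct_comp ![2, 3]
      (fun b : Fin 2 → ℤ => (![a 0, a 1, b 0, b 1] : Fin 4 → ℤ)) (by
        intro b i
        ext j
        fin_cases i <;> fin_cases j <;> simp) q (word4 e)) ![a 2, a 3]
    simp only [Matrix.cons_val_zero, Matrix.cons_val_one] at h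
    rw [← ha] at h
    rw [← h]
    exact shiftAct_linear (LinearMap.mulLeft ℂ (e (a 0) * e (a 1))) q (word2 e) ![a 2, a 3]
  have h := congrFun (shiftAct_comp ![0, 1]
    (fun b : Fin 2 → ℤ => (![b 0, b 1, a 2, a 3] : Fin 4 → ℤ)) (by
      intro b i
      ext j
      fin_cases i <;> fin_cases j <;> simp) p
      (shiftAct (rename ![2, 3] q) (word4 e))) ![a 0, a 1]
  simp only [Matrix.cons_val_zero, Matrix.cons_val_one] at h
  rw [← ha] at h
  rw [shiftAct_mul, ← h]
  have h2 := shiftAct_linear (LinearMap.mulRight ℂ (shiftAct q (word2 e) ![a 2, a 3])) p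
    (word2 e) ![a 0, a 1]
  simp only [LinearMap.mulRight_apply] at h2
  rw [← h2]
  refine congrFun (congrArg _ (funext fun b => ?_)) _
  rw [hq]
  rfl

/-- From three to four letters: a relation between a pair of letters and a second pair. -/
theorem IsWitt.quad_mem (he : IsWitt e) {N : ℕ} (hN : vdm ^ N ∈ shiftAnn (word3 e)) :
    (X 0 - X 1) ^ (2 * N + 2) * (X 2 - X 3) ^ (2 * N + 2) *
      ((X 0 * X 3 - X 1 * X 2) * (X 0 * X 2 - X 1 * X 3)) ^ (2 * N) ∈ shiftAnn (word4 e) := by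
  have h1 : ((X 0 - X 1) * ((X 2 - X 0) * (X 2 - X 1))) ^ N ∈ shiftAnn (word4 e) := by
    have : rename fst3 (vdm ^ N) ∈ shiftAnn (word4 e) := by
      rw [mem_shiftAnn]
      ext1 a
      rw [shiftAct_word4_of_word3, mem_shiftAnn.1 hN]
      simp
    convert this using 1
    simp only [vdm, map_pow, map_mul, map_sub, rename_X]
    congr 1
    simp only [fst3, Fin.castSucc_zero, Fin.castSucc_one, Fin.reduceCastSucc]
    ring
  have h2 := swap_rename_mem 2 3 he.word4_swap h1
  have h0 : Equiv.swap (2 : Fin 4) 3 0 = 0 := by decide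
  have h0' : Equiv.swap (2 : Fin 4) 3 1 = 1 := by decide
  simp only [map_pow, map_mul, map_sub, rename_X, Equiv.swap_apply_left, h0, h0'] at h2
  obtain ⟨P2, hP2⟩ : ∃ P : MvPolynomial (Fin 4) ℂ, P = (X 2 - X 0) * (X 2 - X 1) := ⟨_, rfl⟩
  obtain ⟨P3, hP3⟩ : ∃ P : MvPolynomial (Fin 4) ℂ, P = (X 3 - X 0) * (X 3 - X 1) := ⟨_, rfl⟩
  rw [← hP2] at h1
  rw [← hP3] at h2
  have h3 : ((X 2 - X 3) * ((X 0 * X 3 - X 1 * X 2) * (X 0 * X 2 - X 1 * X 3))) ^ (2 * N) ∈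
      Ideal.span {P2 ^ N, P3 ^ N} := by
    have hid : (X 2 - X 3) * ((X 0 * X 3 - X 1 * X 2) * (X 0 * X 2 - X 1 * X 3)) =
        (-(X 2 * X 3) * (X 0 + X 1 + (X 2 + X 3)) + (X 2 + X 3) ^ 2 * X 3) * P2 +
        ((X 2 * X 3) * (X 0 + X 1 + (X 2 + X 3)) - (X 2 + X 3) ^ 2 * X 2) * P3 := by
      rw [hP2, hP3]
      ring
    rw [hid]
    refine Ideal.add_pow_mem_of_pow_mem_of_le (m := N) (n := N) _ ?_ ?_ (by omega)
    · rw [mul_pow _ P2]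
      exact Ideal.mul_mem_left _ _ (Ideal.subset_span (Set.mem_insert _ _))
    · rw [mul_pow _ P3]
      exact Ideal.mul_mem_left _ _ (Ideal.subset_span (Set.mem_insert_of_mem _ rfl))
  generalize ((X 0 * X 3 - X 1 * X 2) * (X 0 * X 2 - X 1 * X 3) : MvPolynomial (Fin 4) ℂ) = I at h3 ⊢
  generalize (X 2 - X 3 : MvPolynomial (Fin 4) ℂ) = D at h2 h3 ⊢
  generalize (X 0 - X 1 : MvPolynomial (Fin 4) ℂ) = D' at h1 h2 h3 ⊢
  obtain ⟨u, v, huv⟩ := Ideal.mem_span_pair.1 h3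
  have h4 := add_mem (Ideal.mul_mem_left _ (u * D' ^ (N + 2) * D ^ 2) h1)
    (Ideal.mul_mem_left _ (v * D' ^ (N + 2)) h2)
  convert h4 using 1
  rw [mul_pow D] at huv
  rw [mul_pow _ P2, mul_pow _ P3]
  linear_combination (-D' ^ (2 * N + 2) * D ^ 2) * huv

end Words

section Recurrence

open Polynomial

theorem coe_aeval_restrict {V : Type*} [AddCommGroup V] [Module ℂ V] (T : Module.End ℂ V)
    {U : Submodule ℂ V} (hU : ∀ x ∈ U, T x ∈ U) (q : ℂ[X]) (x : U) :
    ((aeval (T.restrict hU) q x : U) : V) = aeval T q x := by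
  induction q using Polynomial.induction_on generalizing x with
  | C a => simp [Module.algebraMap_end_apply]
  | add p q hp hq => simp [hp, hq]
  | monomial n a ih =>
    rw [pow_succ, ← mul_assoc, map_mul, map_mul (aeval T), Module.End.mul_apply,
      Module.End.mul_apply, ih]
    simp

/-- The translation operators on functions on `ℤ`. -/
def transl (A : Type*) [AddCommGroup A] [Module ℂ A] (k : ℤ) : Module.End ℂ (ℤ → A) :=
  LinearMap.funLeft ℂ A (fun a => a + k)

@[simp] theorem transl_apply {A : Type*} [AddCommGroup A] [Module ℂ A] (k : ℤ) (f : ℤ → A)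
    (a : ℤ) : transl A k f a = f (a + k) := rfl

theorem transl_mul_transl {A : Type*} [AddCommGroup A] [Module ℂ A] (k l : ℤ) :
    transl A k * transl A l = transl A (k + l) := by
  ext f a
  simp only [Module.End.mul_apply, transl_apply]
  congr 1
  ring

variable {V : Type*} [AddCommGroup V] [Module ℂ V]

/-- The operator `f ↦ f (· + 1) + f (· - 1)`. -/
def symTransl (A : Type*) [AddCommGroup A] [Module ℂ A] : Module.End ℂ (ℤ → A) :=
  transl A 1 + transl A (-1)

/-- An operator applied pointwise to functions on `ℤ`. -/
def pointwise (T : Module.End ℂ V) : Module.End ℂ (ℤ → V) := LinearMap.compLeft T ℤ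

@[simp] theorem pointwise_apply (T : Module.End ℂ V) (f : ℤ → V) (a : ℤ) :
    pointwise T f a = T (f a) := rfl

theorem pointwise_pow_apply (T : Module.End ℂ V) (n : ℕ) (f : ℤ → V) (a : ℤ) :
    (pointwise T ^ n) f a = (T ^ n) (f a) := by
  induction n generalizing f with
  | zero => rfl
  | succ n ih =>
    rw [pow_succ, pow_succ, Module.End.mul_apply, Module.End.mul_apply, ih]
    rfl

theorem symTransl_pow_mem {Φ : Submodule ℂ V} {f : ℤ → V} (hf : ∀ a, f a ∈ Φ) (n : ℕ) (a : ℤ) :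
    (symTransl V ^ n) f a ∈ Φ := by
  induction n generalizing f with
  | zero => exact hf a
  | succ n ih =>
    rw [pow_succ, Module.End.mul_apply]
    exact ih (f := symTransl V f) (fun a => add_mem (hf _) (hf _))

theorem exists_monic_aeval_eq_zero {Φ : Submodule ℂ V} [FiniteDimensional ℂ Φ] {D n : ℕ}
    (hD : Module.finrank ℂ Φ ≤ D) (T : Module.End ℂ V) {β : ℤ → V}
    (hΦ : Submodule.span ℂ (Set.range β) = Φ)
    (hβ : ((symTransl V - pointwise T) ^ n) β = 0) :
    ∃ q : ℂ[X], q.Monic ∧ q.natDegree ≤ n * D ∧ ∀ a, aeval T q (β a) = 0 := by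
  have hmem : ∀ a, β a ∈ Φ := fun a => hΦ ▸ Submodule.subset_span ⟨a, rfl⟩
  let U : Submodule ℂ V := (Finset.range n).sup fun t => Φ.map (T ^ t)
  have hUle : ∀ t < n, Φ.map (T ^ t) ≤ U := fun t ht =>
    Finset.le_sup (f := fun t => Φ.map (T ^ t)) (Finset.mem_range.2 ht)
  have hrank : ∀ n : ℕ, FiniteDimensional ℂ
      ((Finset.range n).sup fun t => Φ.map (T ^ t) : Submodule ℂ V) ∧
      Module.finrank ℂ ((Finset.range n).sup fun t => Φ.map (T ^ t) : Submodule ℂ V) ≤ n * D := by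
    intro n
    induction n with
    | zero =>
      rw [Finset.range_zero, Finset.sup_empty]
      exact ⟨inferInstance, by simp⟩
    | succ n ih =>
      have := ih.1
      rw [Finset.range_add_one, Finset.sup_insert]
      refine ⟨inferInstance, (Submodule.finrank_add_le_finrank_add_finrank _ _).trans ?_⟩
      have := Submodule.finrank_map_le (T ^ n) Φ
      linarith [ih.2]
  have hn : Φ.map (T ^ n) ≤ U := by
    rw [← hΦ, Submodule.map_span, Submodule.span_le]
    rintro _ ⟨_, ⟨a, rfl⟩, rfl⟩
    have hc : Commute (-pointwise T) (symTransl V) := by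
      refine LinearMap.ext fun f => ?_
      ext a
      simp [symTransl]
      abel
    rw [sub_eq_neg_add, hc.add_pow, Finset.sum_range_succ, LinearMap.add_apply,
      LinearMap.sum_apply] at hβ
    have h := congrFun hβ a
    simp only [Pi.add_apply, Finset.sum_apply, Nat.choose_self, Nat.sub_self, pow_zero, mul_one,
      Nat.cast_one, Pi.zero_apply] at h
    have hgen : ∀ m k (g : ℤ → V), ((-pointwise T) ^ m *
        symTransl V ^ k) g a = (-1 : ℂ) ^ m • (T ^ m) ((symTransl V ^ k) g a) := by
      intro m k g
      rw [Module.End.mul_apply, ← pointwise_pow_apply, ← neg_one_smul ℂ (pointwise T),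
        _root_.smul_pow]
      rfl
    have hlast := hgen n 0 β
    simp only [pow_zero, mul_one, Module.End.one_apply] at hlast
    rw [hlast] at h
    have h1 : (-1 : ℂ) ^ n • (T ^ n) (β a) ∈ U := by
      rw [eq_neg_of_add_eq_zero_right h]
      refine neg_mem (sum_mem fun m hm => ?_)
      have hm' := Finset.mem_range.1 hm
      rw [← nsmul_eq_mul', LinearMap.smul_apply, Pi.smul_apply, hgen]
      refine U.smul_of_tower_mem _ (U.smul_mem _ (hUle m hm' ?_))
      exact Submodule.mem_map_of_mem (symTransl_pow_mem hmem _ _)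
    have h2 := U.smul_mem ((-1 : ℂ) ^ n) h1
    rwa [smul_smul, ← mul_pow, neg_one_mul, neg_neg, one_pow, one_smul] at h2
  have hstab : ∀ x ∈ U, T x ∈ U := by
    have : U ≤ U.comap T := by
      refine Finset.sup_le fun t ht => ?_
      rw [← Submodule.map_le_iff_le_comap, ← Submodule.map_comp]
      have h3 : (T ∘ₗ T ^ t : Module.End ℂ V) = T ^ (t + 1) := (pow_succ' T t).symm
      rw [h3]
      rcases (Nat.succ_le_of_lt (Finset.mem_range.1 ht)).lt_or_eq with h | h
      · exact hUle _ h
      · rw [← Nat.succ_eq_add_one, h]; exact hn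
    exact this
  have := (hrank n).1
  have hfU : FiniteDimensional ℂ U := this
  rcases Nat.eq_zero_or_pos n with rfl | hpos
  · refine ⟨1, monic_one, by simp, fun a => ?_⟩
    simpa using congrFun hβ a
  refine ⟨(T.restrict hstab).charpoly, LinearMap.charpoly_monic _, ?_, fun a => ?_⟩
  · rw [LinearMap.charpoly_natDegree]
    exact (hrank n).2
  · have h := coe_aeval_restrict T hstab (T.restrict hstab).charpoly
      ⟨β a, hUle 0 hpos (by simpa using hmem a)⟩
    rw [LinearMap.aeval_self_charpoly] at h
    exact h.symm

/-- The polynomial `X ^ deg q * q (X + X⁻¹)`. -/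
def unfoldPoly (q : ℂ[X]) : ℂ[X] :=
  ∑ i ∈ Finset.range (q.natDegree + 1), C (q.coeff i) * ((X ^ 2 + 1) ^ i * X ^ (q.natDegree - i))

theorem natDegree_X_sq_add_one_pow (i : ℕ) : ((X ^ 2 + 1 : ℂ[X]) ^ i).natDegree = 2 * i := by
  rw [natDegree_pow, ← C_1, natDegree_X_pow_add_C, mul_comm]

theorem unfoldPoly_natDegree_le (q : ℂ[X]) : (unfoldPoly q).natDegree ≤ 2 * q.natDegree := by
  refine natDegree_sum_le_of_forall_le _ _ fun i hi => ?_
  have hi' := Finset.mem_range.1 hi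
  refine (natDegree_C_mul_le _ _).trans (natDegree_mul_le.trans ?_)
  rw [natDegree_X_sq_add_one_pow, natDegree_X_pow]
  omega

theorem unfoldPoly_ne_zero {q : ℂ[X]} (hq : q.Monic) : unfoldPoly q ≠ 0 := by
  intro h
  have h1 := congrArg (fun p : ℂ[X] => p.coeff (2 * q.natDegree)) h
  simp only [unfoldPoly, finsetSum_coeff, coeff_C_mul, coeff_zero] at h1
  rw [Finset.sum_range_succ, Finset.sum_eq_zero, zero_add, Nat.sub_self, pow_zero, mul_one,
    hq.coeff_natDegree, one_mul] at h1
  · have h2 : ((X ^ 2 + 1 : ℂ[X]) ^ q.natDegree).Monic := by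
      refine Monic.pow ?_ _
      rw [← C_1]
      exact monic_X_pow_add_C _ (by norm_num)
    have h3 := h2.coeff_natDegree
    rw [natDegree_X_sq_add_one_pow, h1] at h3
    exact zero_ne_one h3
  · intro i hi
    refine mul_eq_zero_of_right _ (coeff_eq_zero_of_natDegree_lt ?_)
    refine natDegree_mul_le.trans_lt ?_
    rw [natDegree_X_sq_add_one_pow, natDegree_X_pow]
    have := Finset.mem_range.1 hi
    omega

theorem aeval_unfoldPoly {R : Type*} [Ring R] [Algebra ℂ R] {s s' : R} (h : s * s' = 1)
    (h' : s' * s = 1) (q : ℂ[X]) :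
    aeval s (unfoldPoly q) = s ^ q.natDegree * aeval (s + s') q := by
  have hc : Commute s (s + s') := by
    rw [Commute, SemiconjBy, mul_add, add_mul, h, h']
  have hs : s * (s + s') = s ^ 2 + 1 := by rw [mul_add, h, pow_two]
  rw [unfoldPoly, map_sum, aeval_eq_sum_range, Finset.mul_sum]
  refine Finset.sum_congr rfl fun i hi => ?_
  have hi' := Finset.mem_range.1 hi
  rw [map_mul, aeval_C, map_mul, map_pow, map_pow, map_add, map_pow, aeval_X, map_one, ← hs,
    hc.mul_pow, ← Algebra.smul_def, mul_smul_comm]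
  congr 1
  rw [mul_assoc, ← ((hc.pow_pow _ _).eq), ← mul_assoc, ← pow_add]
  congr 2
  omega

theorem exists_recurrence {E₀ E₁ E₂ : Type*} [AddCommGroup E₀] [Module ℂ E₀] [AddCommGroup E₁]
    [Module ℂ E₁] [AddCommGroup E₂] [Module ℂ E₂] [FiniteDimensional ℂ E₁] [FiniteDimensional ℂ E₂]
    {C n : ℕ} (h₁ : Module.finrank ℂ E₁ ≤ C) (h₂ : Module.finrank ℂ E₂ ≤ C)
    (B : ℤ → E₀ →ₗ[ℂ] E₁) (B' : ℤ → E₁ →ₗ[ℂ] E₂)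
    (h : ((symTransl (ℤ → E₀ →ₗ[ℂ] E₂) - pointwise (symTransl (E₀ →ₗ[ℂ] E₂))) ^ n)
      (fun a' a => B' a' ∘ₗ B a) = 0) :
    ∃ Q : ℂ[X], Q ≠ 0 ∧ Q.natDegree ≤ 2 * (n * C ^ 2) ∧
      ∀ a', aeval (transl (E₀ →ₗ[ℂ] E₂) 1) Q (fun a => B' a' ∘ₗ B a) = 0 := by
  let L : (E₁ →ₗ[ℂ] E₂) →ₗ[ℂ] (ℤ → E₀ →ₗ[ℂ] E₂) :=
    LinearMap.pi fun a => LinearMap.lcomp ℂ E₂ (B a)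
  have hle : Submodule.span ℂ (Set.range fun a' => L (B' a')) ≤ LinearMap.range L := by
    rw [Submodule.span_le]
    rintro _ ⟨a', rfl⟩
    exact ⟨_, rfl⟩
  have hfd : FiniteDimensional ℂ (Submodule.span ℂ (Set.range fun a' => L (B' a'))) :=
    Submodule.finiteDimensional_of_le hle
  have hrk : Module.finrank ℂ (Submodule.span ℂ (Set.range fun a' => L (B' a'))) ≤ C ^ 2 := by
    refine (Submodule.finrank_mono hle).trans ((LinearMap.finrank_range_le L).trans ?_)
    rw [Module.finrank_linearMap, pow_two]
    exact Nat.mul_le_mul h₁ h₂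
  obtain ⟨q, hq, hdeg, hqβ⟩ := exists_monic_aeval_eq_zero (n := n) hrk (symTransl (E₀ →ₗ[ℂ] E₂))
    rfl h
  refine ⟨unfoldPoly q, unfoldPoly_ne_zero hq, (unfoldPoly_natDegree_le q).trans (by omega), ?_⟩
  intro a'
  have hone : transl (E₀ →ₗ[ℂ] E₂) 0 = 1 := by
    ext f a; simp
  rw [aeval_unfoldPoly (s' := transl (E₀ →ₗ[ℂ] E₂) (-1))
    (by rw [transl_mul_transl]; simpa using hone) (by rw [transl_mul_transl]; simpa using hone),
    Module.End.mul_apply]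
  have := hqβ a'
  rw [symTransl] at this
  have h5 : (fun a => B' a' ∘ₗ B a) = L (B' a') := rfl
  rw [h5, this, map_zero]

end Recurrence

section MaxOrder

open Polynomial

/-- The polynomials `Q` for which `Q (T)` kills all sequences in `S`, where `T` is the shift. -/
def seqAnn {A : Type*} [AddCommGroup A] [Module ℂ A] (S : Set (ℤ → A)) : Ideal ℂ[X] where
  carrier := {Q | ∀ f ∈ S, aeval (transl A 1) Q f = 0}
  add_mem' := by
    intro p q hp hq f hf
    rw [map_add, LinearMap.add_apply, hp f hf, hq f hf, add_zero]
  zero_mem' := by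
    intro f _
    simp
  smul_mem' := by
    intro p q hq f hf
    rw [smul_eq_mul, map_mul, Module.End.mul_apply, hq f hf, map_zero]

theorem seqAnn_of_X_mul {A : Type*} [AddCommGroup A] [Module ℂ A] {S : Set (ℤ → A)} {Q : ℂ[X]}
    (h : X * Q ∈ seqAnn S) : Q ∈ seqAnn S := by
  intro f hf
  have h1 := h f hf
  rw [map_mul, aeval_X, Module.End.mul_apply] at h1
  ext a
  have h2 := congrFun h1 (a - 1)
  rw [transl_apply, sub_add_cancel] at h2
  exact h2

theorem aeval_transl_linear {A A' : Type*} [AddCommGroup A] [Module ℂ A] [AddCommGroup A']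
    [Module ℂ A'] (L : A →ₗ[ℂ] A') (Q : ℂ[X]) (f : ℤ → A) :
    aeval (transl A' 1) Q (fun a => L (f a)) = fun a => L (aeval (transl A 1) Q f a) := by
  induction Q using Polynomial.induction_on generalizing f with
  | C c => ext a; simp [Module.algebraMap_end_apply]
  | add p q hp hq => ext a; simp [hp, hq]
  | monomial n c ih =>
    rw [pow_succ, ← mul_assoc, map_mul, map_mul _ (C c * X ^ n), aeval_X, aeval_X,
      Module.End.mul_apply, Module.End.mul_apply, ← ih]
    rfl

theorem aeval_transl_comp_add {A : Type*} [AddCommGroup A] [Module ℂ A] (Q : ℂ[X]) (c : ℤ)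
    (f : ℤ → A) (a : ℤ) :
    aeval (transl A 1) Q (fun a => f (a + c)) a = aeval (transl A 1) Q f (a + c) := by
  induction Q using Polynomial.induction_on generalizing f a with
  | C c => simp [Module.algebraMap_end_apply]
  | add p q hp hq => simp [hp, hq]
  | monomial n d ih =>
    rw [pow_succ, ← mul_assoc, map_mul, aeval_X, Module.End.mul_apply, Module.End.mul_apply, ← ih]
    refine congrFun (congrArg _ (funext fun x => ?_)) a
    simp only [transl_apply]
    congr 1
    ring

theorem aeval_transl_coeff {A : Type*} [AddCommGroup A] [Module ℂ A] (Q : ℂ[X]) (f : ℤ → A)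
    (a : ℤ) :
    aeval (transl A 1) Q (fun a => (a : ℂ) • f a) a =
      (a : ℂ) • aeval (transl A 1) Q f a + aeval (transl A 1) (X * derivative Q) f a := by
  induction Q using Polynomial.induction_on' generalizing f a with
  | add p q hp hq =>
    simp only [map_add, LinearMap.add_apply, Pi.add_apply, hp, hq, mul_add, smul_add]
    abel
  | monomial n d =>
    have hX : ∀ (n : ℕ) (f : ℤ → A) (a : ℤ), (transl A 1 ^ n) f a = f (a + n) := by
      intro n
      induction n with
      | zero => intro f a; simp
      | succ n ih =>
        intro f a
        rw [pow_succ, Module.End.mul_apply, ih, transl_apply]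
        push_cast
        congr 1
        ring
    have hm : ∀ (n : ℕ) (d : ℂ) (f : ℤ → A) (a : ℤ),
        aeval (transl A 1) (monomial n d) f a = d • f (a + n) := by
      intro n d f a
      rw [aeval_monomial, Module.End.mul_apply, Module.algebraMap_end_apply, Pi.smul_apply, hX]
    rw [derivative_monomial, X_mul_monomial, hm, hm, hm]
    rcases n with _ | n
    · simp only [Nat.cast_zero, mul_zero, zero_smul, add_zero]
      exact smul_comm _ _ _
    · rw [Nat.add_sub_cancel]
      push_cast
      simp only [smul_smul, ← add_smul]
      congr 1
      ring

theorem X_sub_one_pow_mem_of_derivation {ι : Type*} (I : ι → Ideal ℂ[X]) (B : ℕ)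
    (hX : ∀ c Q, X * Q ∈ I c → Q ∈ I c) (hB : ∀ c, ∃ Q ∈ I c, Q ≠ 0 ∧ Q.natDegree ≤ B)
    (c₁ c₂ c₃ : ι → ι)
    (hder : ∀ c Q, Q ∈ I c → Q ∈ I (c₁ c) → Q ∈ I (c₂ c) → Q ∈ I (c₃ c) →
      X * (X - 1) * derivative Q ∈ I c) (c : ι) : (X - 1) ^ B ∈ I c := by
  let P : ι → ℂ[X] := fun c => Submodule.IsPrincipal.generator (I c)
  have hP : ∀ c Q, Q ∈ I c ↔ P c ∣ Q := fun c Q => Submodule.IsPrincipal.mem_iff_generator_dvd _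
  have hP0 : ∀ c, P c ≠ 0 ∧ (P c).natDegree ≤ B := by
    intro c
    obtain ⟨Q, h1, h2, h3⟩ := hB c
    have h4 := (hP c Q).1 h1
    exact ⟨ne_zero_of_dvd_ne_zero h2 h4, (natDegree_le_of_dvd h4 h2).trans h3⟩
  have hroot : ∀ x₀ c, (P c).IsRoot x₀ → x₀ = 1 := by
    intro x₀ c hc
    by_contra h1
    by_cases h0 : x₀ = 0
    · subst h0
      obtain ⟨R, hR⟩ := X_dvd_iff.2 (by rwa [IsRoot, ← coeff_zero_eq_eval_zero] at hc)
      have h2 := (hP c R).1 (hX c R ((hP c _).2 hR.dvd))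
      have hR0 : R ≠ 0 := by
        rintro rfl
        exact (hP0 c).1 (by rw [hR, mul_zero])
      have h3 := natDegree_le_of_dvd h2 hR0
      rw [hR, natDegree_X_mul hR0] at h3
      omega
    · have hbdd : ∀ c, (P c).rootMultiplicity x₀ ≤ B := fun c => by
        have := natDegree_le_of_dvd (pow_rootMultiplicity_dvd (P c) x₀) (hP0 c).1
        rw [natDegree_pow, natDegree_X_sub_C, mul_one] at this
        exact this.trans (hP0 c).2
      have hne : (Set.range fun c => (P c).rootMultiplicity x₀).Nonempty := ⟨_, c, rfl⟩
      have hbd : BddAbove (Set.range fun c => (P c).rootMultiplicity x₀) :=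
        ⟨B, by rintro _ ⟨c, rfl⟩; exact hbdd c⟩
      obtain ⟨s, hs⟩ := Nat.sSup_mem hne hbd
      have hmax : ∀ t, (P t).rootMultiplicity x₀ ≤ (P s).rootMultiplicity x₀ := fun t => by
        have : (P t).rootMultiplicity x₀ ≤ sSup (Set.range fun c => (P c).rootMultiplicity x₀) :=
          le_csSup hbd ⟨t, rfl⟩
        rw [← hs] at this
        exact this
      have hpos : 0 < (P s).rootMultiplicity x₀ :=
        ((rootMultiplicity_pos (hP0 c).1).2 hc).trans_le (hmax c)
      have hdec := fun t => exists_eq_pow_rootMultiplicity_mul_and_not_dvd (P t) (hP0 t).1 x₀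
      choose H hH hHx using hdec
      obtain ⟨m, hm⟩ : ∃ m, (P s).rootMultiplicity x₀ = m + 1 := ⟨_, (Nat.succ_pred_eq_of_pos hpos).symm⟩
      rw [hm] at hmax
      have hdvd : ∀ t K, H t ∣ K → (X - C x₀) ^ (m + 1) * K ∈ I t := by
        intro t K hK
        rw [hP]
        nth_rewrite 1 [hH t]
        exact mul_dvd_mul (pow_dvd_pow _ (hmax t)) hK
      have hQ := hder s ((X - C x₀) ^ (m + 1) * (H s * H (c₁ s) * H (c₂ s) * H (c₃ s)))
        (hdvd _ _ ⟨H (c₁ s) * H (c₂ s) * H (c₃ s), by ring⟩)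
        (hdvd _ _ ⟨H s * H (c₂ s) * H (c₃ s), by ring⟩)
        (hdvd _ _ ⟨H s * H (c₁ s) * H (c₃ s), by ring⟩)
        (hdvd _ _ ⟨H s * H (c₁ s) * H (c₂ s), by ring⟩)
      set K := H s * H (c₁ s) * H (c₂ s) * H (c₃ s) with hK
      have hKx : K.eval x₀ ≠ 0 := by
        have : ∀ t, (H t).eval x₀ ≠ 0 := fun t ht => hHx t (dvd_iff_isRoot.2 ht)
        simp only [hK, eval_mul]
        exact mul_ne_zero (mul_ne_zero (mul_ne_zero (this _) (this _)) (this _)) (this _)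
      have h2 : (X - C x₀) ^ (m + 1) ∣ P s := by
        rw [← hm]; exact pow_rootMultiplicity_dvd _ _
      have h3 := h2.trans ((hP _ _).1 hQ)
      have h4 : X * (X - 1) * derivative ((X - C x₀) ^ (m + 1) * K) =
          (X - C x₀) ^ m * (X * (X - 1) * (((m + 1 : ℕ) : ℂ[X]) * K + (X - C x₀) * derivative K)) := by
        rw [derivative_mul, derivative_X_sub_C_pow, Nat.add_sub_cancel]
        simp only [Nat.cast_add, Nat.cast_one, map_add, map_natCast, map_one]
        ring
      rw [h4, pow_succ] at h3
      have h5 := (mul_dvd_mul_iff_left (pow_ne_zero m (X_sub_C_ne_zero x₀))).1 h3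
      rw [dvd_iff_isRoot, IsRoot] at h5
      simp only [eval_mul, eval_sub, eval_add, eval_X, eval_C, eval_natCast, eval_one, sub_self,
        zero_mul, add_zero, mul_eq_zero] at h5
      rcases h5 with (h5 | h5) | h5 | h5
      · exact h0 h5
      · exact h1 (sub_eq_zero.1 h5)
      · exact Nat.cast_ne_zero.2 (Nat.succ_ne_zero m) h5
      · exact hKx h5
  rw [hP]
  have hsp := (IsAlgClosed.splits (P c)).eq_prod_roots
  have hrep : (P c).roots = Multiset.replicate (P c).roots.card 1 :=
    Multiset.eq_replicate_card.2 fun x hx => hroot x c (isRoot_of_mem_roots hx)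
  rw [hrep, Multiset.map_replicate, Multiset.prod_replicate, C_1] at hsp
  rw [hsp]
  have hu : IsUnit (C (P c).leadingCoeff) := isUnit_C.2 (leadingCoeff_ne_zero.2 (hP0 c).1).isUnit
  rw [hu.mul_left_dvd]
  exact pow_dvd_pow _ ((card_roots' _).trans (hP0 c).2)

end MaxOrder

section Cells

variable {M : Type*} [AddCommGroup M] [Module ℂ M]

/-- A `ℤ`-graded module over the Witt algebra with weight spaces of dimension at most `C`. -/
structure IsWittBdd (C : ℕ) (lam : ℂ) (e : ℤ → Module.End ℂ M) (wt : ℤ → Submodule ℂ M) :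
    Prop where
  witt : IsWitt e
  map_wt : ∀ k j, ∀ v ∈ wt j, e k v ∈ wt (j + k)
  zero_wt : ∀ j, ∀ v ∈ wt j, e 0 v = (lam + j) • v
  fin : ∀ j, FiniteDimensional ℂ (wt j)
  rank : ∀ j, Module.finrank ℂ (wt j) ≤ C
  iSup_wt : ⨆ j, wt j = ⊤

theorem end_eq_zero_of_wt {wt : ℤ → Submodule ℂ M} (htop : ⨆ j, wt j = ⊤) {f : Module.End ℂ M}
    (hf : ∀ j, ∀ v ∈ wt j, f v = 0) : f = 0 := by
  rw [← LinearMap.ker_eq_top, eq_top_iff, ← htop]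
  exact iSup_le fun j v hv => hf j v hv

open MvPolynomial

/-- Operator-valued functions of degree `k`. -/
def IsGraded {σ : Type} [Fintype σ] (wt : ℤ → Submodule ℂ M) (k : ℤ)
    (F : (σ → ℤ) → Module.End ℂ M) : Prop :=
  ∀ a j, ∀ v ∈ wt j, F a v ∈ wt (j + ∑ i, a i + k)

theorem isGraded_shiftAct {σ : Type} [Fintype σ] {wt : ℤ → Submodule ℂ M} {k : ℤ}
    {F : (σ → ℤ) → Module.End ℂ M} (hF : IsGraded wt k F) {p : MvPolynomial σ ℂ} {d : ℕ}
    (hp : p.IsHomogeneous d) : IsGraded wt (k + d) (shiftAct p F) := by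
  intro a j v hv
  rw [p.as_sum, map_sum, LinearMap.sum_apply, Finset.sum_apply, LinearMap.sum_apply]
  refine sum_mem fun s hs => ?_
  rw [shiftAct_monomial, LinearMap.smul_apply]
  refine Submodule.smul_mem _ _ ?_
  have h := hF (fun i => a i + (s i : ℤ)) j v hv
  have hd : s.degree = d := by
    by_contra hne
    exact mem_support_iff.1 hs (hp.coeff_eq_zero hne)
  rw [Finsupp.degree_eq_sum] at hd
  convert h using 2
  rw [Finset.sum_add_distrib, ← hd]
  push_cast
  ring

theorem IsWittBdd.word2_graded {C : ℕ} {lam : ℂ} {e : ℤ → Module.End ℂ M}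
    {wt : ℤ → Submodule ℂ M} (h : IsWittBdd C lam e wt) : IsGraded wt 0 (word2 e) := by
  intro a j v hv
  have h1 := h.map_wt (a 0) _ _ (h.map_wt (a 1) _ _ hv)
  have h2 : j + ∑ i, a i + 0 = j + a 1 + a 0 := by
    rw [Fin.sum_univ_two]; ring
  rw [h2]
  exact h1

theorem IsWittBdd.word3_graded {C : ℕ} {lam : ℂ} {e : ℤ → Module.End ℂ M}
    {wt : ℤ → Submodule ℂ M} (h : IsWittBdd C lam e wt) : IsGraded wt 0 (word3 e) := by
  intro a j v hv
  have h1 := h.map_wt (a 0) _ _ (h.map_wt (a 1) _ _ (h.map_wt (a 2) _ _ hv))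
  have h2 : j + ∑ i, a i + 0 = j + a 2 + a 1 + a 0 := by
    rw [Fin.sum_univ_three]; ring
  rw [h2]
  exact h1

/-- The `k`-th difference of `e a * e (d - a)` in the variable `a`. -/
def diffPair (e : ℤ → Module.End ℂ M) (k : ℕ) (d a : ℤ) : Module.End ℂ M :=
  shiftAct ((X 0 - X 1) ^ k) (word2 e) ![a, d - a]

theorem IsWittBdd.diffPair_mem {C : ℕ} {lam : ℂ} {e : ℤ → Module.End ℂ M}
    {wt : ℤ → Submodule ℂ M} (h : IsWittBdd C lam e wt) (k : ℕ) (d a j : ℤ) :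
    ∀ v ∈ wt j, diffPair e k d a v ∈ wt (j + d + k) := by
  intro v hv
  have h1 := (isGraded_shiftAct h.word2_graded (((isHomogeneous_X ℂ 0).sub (isHomogeneous_X ℂ 1)).pow k))
    ![a, d - a] j v hv
  rw [Fin.sum_univ_two] at h1
  simp only [Matrix.cons_val_zero, Matrix.cons_val_one] at h1
  have h2 : j + d + k = j + (a + (d - a)) + (0 + ((1 * k : ℕ) : ℤ)) := by
    push_cast; ring
  rw [h2]
  exact h1

theorem vec4_add_single (a b c d : ℤ) :
    ((![a, b, c, d] : Fin 4 → ℤ) + Pi.single 0 1 = ![a + 1, b, c, d] ∧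
    (![a, b, c, d] : Fin 4 → ℤ) + Pi.single 1 1 = ![a, b + 1, c, d]) ∧
    (![a, b, c, d] : Fin 4 → ℤ) + Pi.single 2 1 = ![a, b, c + 1, d] ∧
    (![a, b, c, d] : Fin 4 → ℤ) + Pi.single 3 1 = ![a, b, c, d + 1] := by
  refine ⟨⟨?_, ?_⟩, ?_, ?_⟩ <;> ext i <;> fin_cases i <;> simp [-Matrix.add_cons,
    -Matrix.cons_add]

theorem IsWitt.diffPair_comm {e : ℤ → Module.End ℂ M} (he : IsWitt e) (k : ℕ) (d a : ℤ) :
    e 1 * diffPair e k d a - diffPair e k d a * e 1 =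
      ((a : ℂ) + k - 1) • diffPair e k (d + 1) (a + 1) +
        ((d : ℂ) - a + k - 1) • diffPair e k (d + 1) a := by
  have h := he.word2_cov.shiftAct ((X 0 - X 1) ^ k) 1 ![a, d - a]
  rw [diffPair, h, Fin.sum_univ_two]
  have h0 : (![a, d - a] + Pi.single 0 1 : Fin 2 → ℤ) = ![a + 1, d + 1 - (a + 1)] := by
    ext i; fin_cases i <;> simp
  have h1 : (![a, d - a] + Pi.single 1 1 : Fin 2 → ℤ) = ![a, d + 1 - a] := by
    ext i; fin_cases i <;> simp; ring
  have hX : ∀ i (p : MvPolynomial (Fin 2) ℂ), shiftAct p (word2 e) (![a, d - a] + Pi.single i 1) =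
      shiftAct (X i * p) (word2 e) ![a, d - a] := by
    intro i p
    rw [shiftAct_mul, shiftAct_X]
  have hk : (X 0 * (X 0 * pderiv 0 ((X 0 - X 1) ^ k)) + X 1 * (X 1 * pderiv 1 ((X 0 - X 1) ^ k)) :
      MvPolynomial (Fin 2) ℂ) =
      C (k : ℂ) * (X 0 * (X 0 - X 1) ^ k) + C (k : ℂ) * (X 1 * (X 0 - X 1) ^ k) := by
    rw [pderiv_pow, pderiv_pow, map_natCast]
    rcases k with _ | k
    · simp
    · simp [pderiv_X]
      ring
  have hk2 := congrArg (fun p => shiftAct p (word2 e) ![a, d - a]) hk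
  simp only [shiftAct_add, Pi.add_apply, shiftAct_mul (C _), shiftAct_C, Pi.smul_apply, ← hX]
    at hk2
  have hd : ∀ a d, diffPair e k d a = shiftAct ((X 0 - X 1) ^ k) (word2 e) ![a, d - a] :=
    fun _ _ => rfl
  rw [h0, h1, ← hd, ← hd] at hk2
  rw [add_add_add_comm, h0, h1, hk2, ← hd, ← hd]
  simp only [Matrix.cons_val_zero, Matrix.cons_val_one]
  push_cast
  module

theorem iterate_difference (G : (Fin 4 → ℤ) → Module.End ℂ M) (n : ℕ) (d' d a' a : ℤ) :
    ((symTransl (ℤ → Module.End ℂ M) - pointwise (symTransl (Module.End ℂ M))) ^ n)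
      (fun a' a => G ![a', d' - a', a, d - a]) a' a =
    shiftAct (((X 0 * X 3 - X 1 * X 2) * (X 0 * X 2 - X 1 * X 3)) ^ n) G
      ![a' - n, d' - a' - n, a - n, d - a - n] := by
  induction n generalizing a' a with
  | zero => simp
  | succ n ih =>
    rw [pow_succ', Module.End.mul_apply]
    have hD : ∀ (f : ℤ → ℤ → Module.End ℂ M) (a' a : ℤ),
        (symTransl (ℤ → Module.End ℂ M) - pointwise (symTransl (Module.End ℂ M))) f a' a =
          f (a' + 1) a + f (a' + (-1)) a - (f a' (a + 1) + f a' (a + (-1))) := fun _ _ _ => rfl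
    rw [hD, ih, ih, ih, ih]
    rw [pow_succ', shiftAct_mul]
    have hI : ((X 0 * X 3 - X 1 * X 2) * (X 0 * X 2 - X 1 * X 3) : MvPolynomial (Fin 4) ℂ) =
        (X 0 * (X 0 * (X 2 * X 3)) - X 0 * (X 1 * (X 3 * X 3))) -
          (X 0 * (X 1 * (X 2 * X 2)) - X 1 * (X 1 * (X 2 * X 3))) := by ring
    generalize shiftAct (((X 0 * X 3 - X 1 * X 2) * (X 0 * X 2 - X 1 * X 3)) ^ n) G = G'
    rw [hI]
    simp only [shiftAct_sub, Pi.sub_apply, shiftAct_mul, shiftAct_X]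
    have e0 : (![a' - ((n + 1 : ℕ) : ℤ), d' - a' - ((n + 1 : ℕ) : ℤ), a - ((n + 1 : ℕ) : ℤ),
      d - a - ((n + 1 : ℕ) : ℤ)] : Fin 4 → ℤ) + Pi.single 0 1 + Pi.single 0 1 + Pi.single 2 1 +
        Pi.single 3 1 = ![a' + 1 - n, d' - (a' + 1) - n, a - n, d - a - n] := by
      simp only [vec4_add_single]
      ext i; fin_cases i <;> simp <;> ring
    have e1 : (![a' - ((n + 1 : ℕ) : ℤ), d' - a' - ((n + 1 : ℕ) : ℤ), a - ((n + 1 : ℕ) : ℤ),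
      d - a - ((n + 1 : ℕ) : ℤ)] : Fin 4 → ℤ) + Pi.single 0 1 + Pi.single 1 1 + Pi.single 3 1 +
        Pi.single 3 1 = ![a' - n, d' - a' - n, a + (-1) - n, d - (a + (-1)) - n] := by
      simp only [vec4_add_single]
      ext i; fin_cases i <;> simp <;> ring
    have e2 : (![a' - ((n + 1 : ℕ) : ℤ), d' - a' - ((n + 1 : ℕ) : ℤ), a - ((n + 1 : ℕ) : ℤ),
      d - a - ((n + 1 : ℕ) : ℤ)] : Fin 4 → ℤ) + Pi.single 0 1 + Pi.single 1 1 + Pi.single 2 1 +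
        Pi.single 2 1 = ![a' - n, d' - a' - n, a + 1 - n, d - (a + 1) - n] := by
      simp only [vec4_add_single]
      ext i; fin_cases i <;> simp <;> ring
    have e3 : (![a' - ((n + 1 : ℕ) : ℤ), d' - a' - ((n + 1 : ℕ) : ℤ), a - ((n + 1 : ℕ) : ℤ),
      d - a - ((n + 1 : ℕ) : ℤ)] : Fin 4 → ℤ) + Pi.single 1 1 + Pi.single 1 1 + Pi.single 2 1 +
        Pi.single 3 1 = ![a' + (-1) - n, d' - (a' + (-1)) - n, a - n, d - a - n] := by
      simp only [vec4_add_single]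
      ext i; fin_cases i <;> simp <;> ring
    rw [e0, e1, e2, e3]
    abel

end Cells

section CellIdeals

open MvPolynomial

variable {M : Type*} [AddCommGroup M] [Module ℂ M]

/-- The sequences `a ↦ B' (a') (B (a) v)`, where `v` runs through a fixed weight space. -/
def cellSeqs (e : ℤ → Module.End ℂ M) (wt : ℤ → Submodule ℂ M) (k : ℕ) (c : ℤ × ℤ × ℤ) :
    Set (ℤ → M) :=
  {f | ∃ a', ∃ v ∈ wt c.1, f = fun a => diffPair e k c.2.2 a' (diffPair e k c.2.1 a v)}

theorem pow_symTransl_linear {V W : Type*} [AddCommGroup V] [Module ℂ V] [AddCommGroup W]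
    [Module ℂ W] (L : V →ₗ[ℂ] W) (n : ℕ) (f : ℤ → ℤ → V) :
    ((symTransl (ℤ → W) - pointwise (symTransl W)) ^ n) (fun a' a => L (f a' a)) =
      fun a' a => L (((symTransl (ℤ → V) - pointwise (symTransl V)) ^ n) f a' a) := by
  induction n generalizing f with
  | zero => rfl
  | succ n ih =>
    rw [pow_succ, pow_succ, Module.End.mul_apply, Module.End.mul_apply, ← ih]
    congr 1
    ext a' a
    have hD : ∀ (A : Type _) [AddCommGroup A] [Module ℂ A] (f : ℤ → ℤ → A) (a' a : ℤ),
        (symTransl (ℤ → A) - pointwise (symTransl A)) f a' a =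
          f (a' + 1) a + f (a' + (-1)) a - (f a' (a + 1) + f a' (a + (-1))) :=
      fun _ _ _ _ _ _ => rfl
    rw [hD W]
    change _ = L (f (a' + 1) a + f (a' + (-1)) a - (f a' (a + 1) + f a' (a + (-1))))
    simp only [map_sub, map_add]

theorem IsWittBdd.exists_mem_cell {C N : ℕ} {lam : ℂ} {e : ℤ → Module.End ℂ M}
    {wt : ℤ → Submodule ℂ M} (h : IsWittBdd C lam e wt) (hN : vdm ^ N ∈ shiftAnn (word3 e))
    (c : ℤ × ℤ × ℤ) :
    ∃ Q ∈ seqAnn (cellSeqs e wt (2 * N + 2) c), Q ≠ 0 ∧ Q.natDegree ≤ 2 * (2 * N * C ^ 2) := by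
  obtain ⟨j, d, d'⟩ := c
  have hf1 := h.fin (j + d + (2 * N + 2 : ℕ))
  have hf2 := h.fin (j + d + (2 * N + 2 : ℕ) + d' + (2 * N + 2 : ℕ))
  obtain ⟨Q, h0, hdeg, hQ⟩ := exists_recurrence (n := 2 * N) (h.rank (j + d + (2 * N + 2 : ℕ)))
    (h.rank (j + d + (2 * N + 2 : ℕ) + d' + (2 * N + 2 : ℕ)))
    (fun a => (diffPair e (2 * N + 2) d a).restrict (h.diffPair_mem _ d a j))
    (fun a' => (diffPair e (2 * N + 2) d' a').restrict (h.diffPair_mem _ d' a' _)) (by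
      have h1 := pow_symTransl_linear
        (LinearMap.compRight ℂ (M := wt j)
          (wt (j + d + (2 * N + 2 : ℕ) + d' + (2 * N + 2 : ℕ))).subtype) (2 * N)
        (fun a' a => (diffPair e (2 * N + 2) d' a').restrict (h.diffPair_mem _ d' a' _) ∘ₗ
          (diffPair e (2 * N + 2) d a).restrict (h.diffPair_mem _ d a j))
      have h2 := pow_symTransl_linear (LinearMap.lcomp ℂ M (wt j).subtype) (2 * N)
        (fun a' a => diffPair e (2 * N + 2) d' a' * diffPair e (2 * N + 2) d a)
      have h3 : ((symTransl (ℤ → Module.End ℂ M) - pointwise (symTransl (Module.End ℂ M))) ^ (2 * N))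
          (fun a' a => diffPair e (2 * N + 2) d' a' * diffPair e (2 * N + 2) d a) = 0 := by
        ext1 a'
        ext1 a
        have h4 := iterate_difference (shiftAct (rename ![0, 1] ((X 0 - X 1) ^ (2 * N + 2)) *
          rename ![2, 3] ((X 0 - X 1) ^ (2 * N + 2))) (word4 e)) (2 * N) d' d a' a
        simp only [shiftAct_word4_of_word2, Matrix.cons_val] at h4
        refine Eq.trans h4 ?_
        rw [← shiftAct_mul]
        have h5 := h.witt.quad_mem hN
        rw [mul_comm] at h5
        simp only [map_pow, map_sub, rename_X, Matrix.cons_val]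
        rw [mem_shiftAnn.1 h5]
        rfl
      ext a' a v
      have h6 := congrFun (congrFun (h1.symm.trans (Eq.trans ?_ h2)) a') a
      · rw [h3] at h6
        exact LinearMap.congr_fun h6 v
      · rfl)
  refine ⟨Q, ?_, h0, hdeg.trans (by ring_nf; rfl)⟩
  rintro _ ⟨a', v, hv, rfl⟩
  have h7 := aeval_transl_linear ((wt (j + d + (2 * N + 2 : ℕ) + d' + (2 * N + 2 : ℕ))).subtype ∘ₗ LinearMap.applyₗ (R := ℂ)
    (M₂ := wt (j + d + (2 * N + 2 : ℕ) + d' + (2 * N + 2 : ℕ))) (⟨v, hv⟩ : wt j)) Q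
    (fun a => (diffPair e (2 * N + 2) d' a').restrict (h.diffPair_mem _ d' a' _) ∘ₗ
          (diffPair e (2 * N + 2) d a).restrict (h.diffPair_mem _ d a j))
  rw [hQ a'] at h7
  exact h7.trans (by ext a; simp)

end CellIdeals

section PairAnn

variable {M : Type*} [AddCommGroup M] [Module ℂ M]

open Polynomial in
theorem IsWittBdd.cell_derivation {C : ℕ} {lam : ℂ} {e : ℤ → Module.End ℂ M}
    {wt : ℤ → Submodule ℂ M} (h : IsWittBdd C lam e wt) (k : ℕ) (j d d' : ℤ) {Q : ℂ[X]}
    (h0 : Q ∈ seqAnn (cellSeqs e wt k (j, d, d')))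
    (h1 : Q ∈ seqAnn (cellSeqs e wt k (j, d - 1, d' + 1)))
    (h2 : Q ∈ seqAnn (cellSeqs e wt k (j, d - 1, d')))
    (h3 : Q ∈ seqAnn (cellSeqs e wt k (j + 1, d - 1, d'))) :
    X * (X - 1) * derivative Q ∈ seqAnn (cellSeqs e wt k (j, d, d')) := by
  rintro _ ⟨a', v, hv, rfl⟩
  dsimp only at hv ⊢
  set f : ℤ → M := fun a => diffPair e k d' a' (diffPair e k d a v) with hf
  have hf0 : aeval (transl M 1) Q f = 0 := h0 _ ⟨a', v, hv, rfl⟩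
  have g1 : ∀ a'', aeval (transl M 1) Q
      (fun a => diffPair e k (d' + 1) a'' (diffPair e k (d - 1) a v)) = 0 :=
    fun a'' => h1 _ ⟨a'', v, hv, rfl⟩
  have g2 : aeval (transl M 1) Q
      (fun a => diffPair e k d' a' (diffPair e k (d - 1) a v)) = 0 := h2 _ ⟨a', v, hv, rfl⟩
  have g3 : aeval (transl M 1) Q
      (fun a => diffPair e k d' a' (diffPair e k (d - 1) a (e 1 v))) = 0 :=
    h3 _ ⟨a', e 1 v, h.map_wt 1 j v hv, rfl⟩
  have g2' := aeval_transl_linear (e 1) Q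
    (fun a => diffPair e k d' a' (diffPair e k (d - 1) a v))
  rw [g2] at g2'
  have key : (fun a => e 1 (diffPair e k d' a' (diffPair e k (d - 1) a v))) =
      (((a' : ℂ) + k - 1) • (fun a => diffPair e k (d' + 1) (a' + 1) (diffPair e k (d - 1) a v)) +
        ((d' : ℂ) - a' + k - 1) • (fun a => diffPair e k (d' + 1) a' (diffPair e k (d - 1) a v))) +
      ((transl M 1 (fun a : ℤ => (a : ℂ) • f a) + ((k : ℂ) - 2) • transl M 1 f) +
        (((d : ℂ) + k - 2) • f - fun a : ℤ => (a : ℂ) • f a)) +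
      fun a => diffPair e k d' a' (diffPair e k (d - 1) a (e 1 v)) := by
    ext a
    have c1 := LinearMap.congr_fun (h.witt.diffPair_comm k d' a') (diffPair e k (d - 1) a v)
    have c2 := congrArg (diffPair e k d' a')
      (LinearMap.congr_fun (h.witt.diffPair_comm k (d - 1) a) v)
    simp only [LinearMap.sub_apply, LinearMap.add_apply, LinearMap.smul_apply,
      Module.End.mul_apply, map_sub, map_add, map_smul, sub_add_cancel] at c1 c2
    rw [sub_eq_iff_eq_add] at c1 c2
    rw [c1, c2]
    simp only [hf, Pi.add_apply, Pi.sub_apply, Pi.smul_apply, transl_apply]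
    push_cast
    module
  rw [key] at g2'
  simp only [map_add, map_sub, map_smul, g1, g3, hf0, smul_zero, zero_add, add_zero] at g2'
  have hc : ∀ g, aeval (transl M 1) Q (transl M 1 g) = transl M 1 (aeval (transl M 1) Q g) := by
    intro g
    have := congrArg (fun p => aeval (transl M 1) p g) (mul_comm Q X)
    simpa only [map_mul, aeval_X, Module.End.mul_apply] using this
  simp only [hc, hf0, map_zero, smul_zero, add_zero, zero_sub] at g2'
  ext a
  have g4 := congrFun g2' a
  simp only [Pi.add_apply, Pi.neg_apply, transl_apply] at g4
  rw [aeval_transl_coeff, aeval_transl_coeff, hf0] at g4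
  rw [mul_comm X, mul_assoc, map_mul, map_sub, aeval_X, map_one, Module.End.mul_apply]
  simp only [LinearMap.sub_apply, Module.End.one_apply, Pi.sub_apply, transl_apply, Pi.zero_apply]
  simp only [Pi.zero_apply, smul_zero, zero_add, map_zero] at g4
  rw [sub_eq_add_neg]
  exact g4

open Polynomial in
theorem IsWittBdd.X_sub_one_pow_mem_cell {C N : ℕ} {lam : ℂ} {e : ℤ → Module.End ℂ M}
    {wt : ℤ → Submodule ℂ M} (h : IsWittBdd C lam e wt) (hN : vdm ^ N ∈ shiftAnn (word3 e))
    (c : ℤ × ℤ × ℤ) :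
    (X - 1) ^ (2 * (2 * N * C ^ 2)) ∈ seqAnn (cellSeqs e wt (2 * N + 2) c) := by
  refine X_sub_one_pow_mem_of_derivation (fun c => seqAnn (cellSeqs e wt (2 * N + 2) c)) _
    (fun c Q => seqAnn_of_X_mul) (fun c => h.exists_mem_cell hN c)
    (fun c => (c.1, c.2.1 - 1, c.2.2 + 1)) (fun c => (c.1, c.2.1 - 1, c.2.2))
    (fun c => (c.1 + 1, c.2.1 - 1, c.2.2)) ?_ c
  rintro ⟨j, d, d'⟩ Q h0 h1 h2 h3
  exact h.cell_derivation _ j d d' h0 h1 h2 h3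

theorem shiftAct_sub_pow {σ : Type} [DecidableEq σ] {E : Type*} [AddCommGroup E] [Module ℂ E]
    (s t : σ) (B : ℕ) (G : (σ → ℤ) → E) (a : σ → ℤ) :
    shiftAct ((MvPolynomial.X s - MvPolynomial.X t) ^ B : MvPolynomial σ ℂ) G a =
      Polynomial.aeval (transl E 1) ((Polynomial.X - 1) ^ B : Polynomial ℂ)
        (fun x => G (a + Pi.single s x + Pi.single t (B - x))) 0 := by
  induction B generalizing G with
  | zero => simp
  | succ B ih =>
    rw [pow_succ, shiftAct_mul, ih, pow_succ, map_mul, Module.End.mul_apply]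
    refine congrFun (congrArg _ (funext fun x => ?_)) 0
    rw [shiftAct_sub, Pi.sub_apply, shiftAct_X, shiftAct_X, map_sub, Polynomial.aeval_X, map_one,
      LinearMap.sub_apply, Pi.sub_apply, transl_apply, Module.End.one_apply]
    congr 2
    · rw [Pi.single_add]
      push_cast
      have : (B : ℤ) + 1 - (x + 1) = B - x := by ring
      rw [this]
      abel
    · have : ((B + 1 : ℕ) : ℤ) - x = (B - x) + 1 := by push_cast; ring
      rw [this, Pi.single_add]
      abel

open MvPolynomial

theorem IsWittBdd.pair_mem {C N : ℕ} {lam : ℂ} {e : ℤ → Module.End ℂ M}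
    {wt : ℤ → Submodule ℂ M} (h : IsWittBdd C lam e wt) (hN : vdm ^ N ∈ shiftAnn (word3 e)) :
    ((X 0 - X 1) * (X 2 - X 3)) ^ (2 * N + 2 + 2 * (2 * N * C ^ 2)) ∈ shiftAnn (word4 e) := by
  set B := 2 * (2 * N * C ^ 2) with hB
  have h1 : (X 2 - X 3) ^ B * (rename ![0, 1] ((X 0 - X 1) ^ (2 * N + 2)) *
      rename ![2, 3] ((X 0 - X 1) ^ (2 * N + 2))) ∈ shiftAnn (word4 e) := by
    rw [mem_shiftAnn, shiftAct_mul]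
    ext1 a
    rw [shiftAct_sub_pow]
    simp only [shiftAct_word4_of_word2]
    refine end_eq_zero_of_wt h.iSup_wt fun j v hv => ?_
    have h2 := aeval_transl_linear (LinearMap.applyₗ (R := ℂ) (M₂ := M) v)
      ((Polynomial.X - 1) ^ B) (fun x =>
        diffPair e (2 * N + 2) (a 0 + a 1) (a 0) *
          diffPair e (2 * N + 2) (a 2 + a 3 + B) (x + a 2))
    have h3 := h.X_sub_one_pow_mem_cell hN (j, a 2 + a 3 + B, a 0 + a 1) _ ⟨a 0, v, hv, rfl⟩
    have h4 := aeval_transl_comp_add ((Polynomial.X - 1) ^ B) (a 2) (fun x =>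
        diffPair e (2 * N + 2) (a 0 + a 1) (a 0)
          (diffPair e (2 * N + 2) (a 2 + a 3 + B) x v)) 0
    dsimp only at h3
    rw [h3] at h4
    refine Eq.trans ?_ ((congrFun h2 0).symm.trans h4)
    refine LinearMap.congr_fun (congrFun (congrArg (Polynomial.aeval (transl (Module.End ℂ M) 1)
      ((Polynomial.X - 1) ^ B : Polynomial ℂ)) (funext fun x => ?_)) 0) v
    refine congrArg₂ (fun b c => shiftAct ((X 0 - X 1) ^ (2 * N + 2)) (word2 e) b *
      shiftAct ((X 0 - X 1) ^ (2 * N + 2)) (word2 e) c) ?_ ?_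
    · ext i; fin_cases i <;> simp
    · ext i; fin_cases i <;> simp <;> ring
  convert Ideal.mul_mem_left _ ((X 0 - X 1) ^ B) h1 using 1
  simp only [map_pow, map_sub, rename_X, Matrix.cons_val]
  rw [mul_pow]
  ring

end PairAnn

section Contraction

open MvPolynomial

theorem mem_shiftAnn_of_X_mul {σ : Type} [DecidableEq σ] {E : Type*} [AddCommGroup E]
    [Module ℂ E] {G : (σ → ℤ) → E} {i : σ} {p : MvPolynomial σ ℂ} (h : X i * p ∈ shiftAnn G) :
    p ∈ shiftAnn G := by
  rw [mem_shiftAnn] at h ⊢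
  ext1 a
  have h1 := congrFun h (a - Pi.single i 1)
  rw [shiftAct_mul, shiftAct_X, sub_add_cancel] at h1
  exact h1

variable {M : Type*} [AddCommGroup M] [Module ℂ M] {e : ℤ → Module.End ℂ M}

theorem IsWitt.word4_swap12 (he : IsWitt e) :
    (X 1 - X 2) ^ 2 ∈ shiftAnn fun a => word4 e (a ∘ Equiv.swap 1 2) - word4 e a := by
  refine sub_sq_mem_of_eq (by decide)
    (fun a => e (a 0) * e (a 1 + a 2) * e (a 3)) ?_ ?_
  · intro a
    simp [add_right_comm, ← add_assoc]
  · intro a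
    have h := he (a 2) (a 1)
    have h0 : Equiv.swap (1 : Fin 4) 2 0 = 0 := by decide
    have h1 : Equiv.swap (1 : Fin 4) 2 3 = 3 := by decide
    simp only [word4, Function.comp_apply, Equiv.swap_apply_left, Equiv.swap_apply_right, h0, h1]
    rw [← smul_mul_assoc, ← mul_smul_comm, add_comm (a 1), ← h]
    noncomm_ring

theorem swap_comp_mem {σ : Type} [DecidableEq σ] {E : Type*} [AddCommGroup E] [Module ℂ E]
    {G : (σ → ℤ) → E} (s t : σ) {p : MvPolynomial σ ℂ} (hp : rename (Equiv.swap s t) p ∈ shiftAnn G) :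
    shiftAct p (fun a => G (a ∘ Equiv.swap s t)) = 0 := by
  have h2 := shiftAct_comp (Equiv.swap s t) (fun b : σ → ℤ => b ∘ Equiv.swap s t) (by
    intro b i
    ext j
    simp only [Function.comp_apply, Pi.add_apply, Pi.single_apply]
    congr 1
    simp only [Equiv.swap_apply_eq_iff]) p G
  rw [h2, mem_shiftAnn.1 hp]
  rfl

theorem IsWitt.word2_mem (he : IsWitt e) {N : ℕ}
    (hN : ((X 0 - X 1) * (X 2 - X 3)) ^ (N + 2) ∈ shiftAnn (word4 e)) :
    (X 0 - X 1) ^ (4 * (N + 2)) ∈ shiftAnn (word2 e) := by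
  obtain ⟨R, hR⟩ : ∃ R : MvPolynomial (Fin 4) ℂ,
    R = ((X 0 - X 1) * (X 2 - X 3) * ((X 1 - X 2) * (X 0 - X 3))) ^ (N + 2) := ⟨_, rfl⟩
  have hT : R * ((X 0 - X 2) * (X 1 - X 3)) ∈ shiftAnn (word4 e) := by
    convert Ideal.mul_mem_left _ (((X 1 - X 2) * (X 0 - X 3)) ^ (N + 2) *
      ((X 0 - X 2) * (X 1 - X 3))) hN using 1
    simp only [hR, mul_pow]
    ring
  let G : (Fin 4 → ℤ) → Module.End ℂ M := fun a => word4 e (a ∘ Equiv.swap 1 2)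
  have hTG : R * ((X 0 - X 2) * (X 1 - X 3)) ∈ shiftAnn G := by
    have h1 : R * ((X 0 - X 2) * (X 1 - X 3)) ∈
        shiftAnn fun a => word4 e (a ∘ Equiv.swap 1 2) - word4 e a := by
      convert Ideal.mul_mem_left _ (((X 0 - X 1) * (X 2 - X 3) * (X 0 - X 3)) ^ (N + 2) *
        (X 1 - X 2) ^ N * ((X 0 - X 2) * (X 1 - X 3))) he.word4_swap12 using 1
      simp only [hR, mul_pow]
      ring
    have h2 : (fun a => word4 e (a ∘ Equiv.swap 1 2) - word4 e a) = G - word4 e := rfl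
    rw [h2, mem_shiftAnn, map_sub, mem_shiftAnn.1 hT, sub_zero] at h1
    exact h1
  have hs02 : rename (Equiv.swap 0 2) (R * ((X 0 - X 2) * (X 1 - X 3))) =
      -(R * ((X 0 - X 2) * (X 1 - X 3))) := by
    have h1 : Equiv.swap (0 : Fin 4) 2 1 = 1 := by decide
    have h3 : Equiv.swap (0 : Fin 4) 2 3 = 3 := by decide
    have hS : rename (Equiv.swap 0 2) R = R := by
      simp only [hR, map_mul, map_pow, map_sub, rename_X, Equiv.swap_apply_left,
        Equiv.swap_apply_right, h1, h3]
      refine congrArg (fun p => p ^ (N + 2)) ?_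
      ring
    rw [map_mul, hS]
    simp only [map_mul, map_sub, rename_X, Equiv.swap_apply_left,
        Equiv.swap_apply_right, h1, h3]
    ring
  have hs13 : rename (Equiv.swap 1 3) (R * ((X 0 - X 2) * (X 1 - X 3))) =
      -(R * ((X 0 - X 2) * (X 1 - X 3))) := by
    have h1 : Equiv.swap (1 : Fin 4) 3 0 = 0 := by decide
    have h3 : Equiv.swap (1 : Fin 4) 3 2 = 2 := by decide
    have hS : rename (Equiv.swap 1 3) R = R := by
      simp only [hR, map_mul, map_pow, map_sub, rename_X, Equiv.swap_apply_left,
        Equiv.swap_apply_right, h1, h3]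
      refine congrArg (fun p => p ^ (N + 2)) ?_
      ring
    rw [map_mul, hS]
    simp only [map_mul, map_sub, rename_X, Equiv.swap_apply_left,
        Equiv.swap_apply_right, h1, h3]
    ring
  have hTG2 : shiftAct (R * ((X 0 - X 2) * (X 1 - X 3))) (fun a => G (a ∘ Equiv.swap 0 2)) = 0 :=
    swap_comp_mem 0 2 (by rw [hs02]; exact neg_mem hTG)
  let K : (Fin 4 → ℤ) → Module.End ℂ M := fun a => word2 e ![a 0 + a 2, a 1 + a 3]
  have hH : shiftAct (R * ((X 0 - X 2) * (X 1 - X 3)))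
      (fun a => (((a 2 : ℂ) - a 0) * ((a 3 : ℂ) - a 1)) • K a) = 0 := by
    let H1 : (Fin 4 → ℤ) → Module.End ℂ M := G - fun a => G (a ∘ Equiv.swap 0 2)
    have h1 : shiftAct (R * ((X 0 - X 2) * (X 1 - X 3))) H1 = 0 := by
      rw [map_sub, mem_shiftAnn.1 hTG, hTG2, sub_zero]
    have h2 : shiftAct (R * ((X 0 - X 2) * (X 1 - X 3))) (fun a => H1 (a ∘ Equiv.swap 1 3)) = 0 :=
      swap_comp_mem 1 3 (by rw [hs13]; exact neg_mem (mem_shiftAnn.2 h1))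
    have h3 : (fun a : Fin 4 → ℤ => (((a 2 : ℂ) - a 0) * ((a 3 : ℂ) - a 1)) • K a) =
        H1 - fun a => H1 (a ∘ Equiv.swap 1 3) := by
      ext1 a
      have h4 := he (a 0) (a 2)
      have h5 := he (a 1) (a 3)
      have s1 : Equiv.swap (1 : Fin 4) 2 0 = 0 := by decide
      have s2 : Equiv.swap (1 : Fin 4) 2 3 = 3 := by decide
      have s3 : Equiv.swap (0 : Fin 4) 2 1 = 1 := by decide
      have s4 : Equiv.swap (0 : Fin 4) 2 3 = 3 := by decide
      have s5 : Equiv.swap (1 : Fin 4) 3 0 = 0 := by decide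
      have s6 : Equiv.swap (1 : Fin 4) 3 2 = 2 := by decide
      simp only [H1, G, K, word4, word2, Pi.sub_apply, Function.comp_apply, Equiv.swap_apply_left,
        Equiv.swap_apply_right, s1, s2, s3, s4, s5, s6, Matrix.cons_val_zero, Matrix.cons_val_one]
      rw [mul_smul, ← mul_smul_comm, ← smul_mul_assoc, ← h4, ← h5]
      noncomm_ring
    rw [h3, map_sub, h1, h2, sub_zero]
  have hK : shiftAct ((X 0 - X 2) * (X 1 - X 3) : MvPolynomial (Fin 4) ℂ)
      (fun a => (((a 2 : ℂ) - a 0) * ((a 3 : ℂ) - a 1)) • K a) =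
        (4 : ℂ) • shiftAct (X 0 * X 1) K := by
    have k1 : ∀ a : Fin 4 → ℤ, K (a + Pi.single 2 1) = K (a + Pi.single 0 1) := by
      intro a
      simp [K, add_right_comm, ← add_assoc]
    have k2 : ∀ a : Fin 4 → ℤ, K (a + Pi.single 3 1) = K (a + Pi.single 1 1) := by
      intro a
      simp [K, add_right_comm, ← add_assoc]
    ext1 a
    simp only [shiftAct_mul, shiftAct_sub, Pi.sub_apply, shiftAct_X, Pi.smul_apply, k2]
    rw [add_right_comm a (Pi.single 2 1) (Pi.single 1 1), k1,
      add_right_comm a (Pi.single 1 1) (Pi.single 0 1)]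
    simp only [Pi.add_apply, Pi.single_apply, Fin.reduceEq, if_true, if_false, add_zero]
    push_cast
    module
  rw [shiftAct_mul, hK, map_smul, smul_eq_zero_iff_right (by norm_num), ← shiftAct_mul] at hH
  have hψ := shiftAct_comp (![0, 1, 0, 1] : Fin 4 → Fin 2)
    (fun a : Fin 4 → ℤ => (![a 0 + a 2, a 1 + a 3] : Fin 2 → ℤ)) (by
      intro b i
      ext j
      fin_cases i <;> fin_cases j <;> simp [add_right_comm, ← add_assoc]) (R * (X 0 * X 1)) (word2 e)
  rw [hH] at hψ
  have hfin : X 0 * (X 1 * (X 0 - X 1) ^ (4 * (N + 2))) ∈ shiftAnn (word2 e) := by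
    have h1 : X 0 * (X 1 * (X 0 - X 1) ^ (4 * (N + 2))) = (-1) ^ (N + 2) *
        rename (![0, 1, 0, 1] : Fin 4 → Fin 2) (R * (X 0 * X 1)) := by
      simp only [hR, map_mul, map_pow, map_sub, rename_X, Matrix.cons_val]
      rw [← mul_assoc ((-1) ^ (N + 2)), ← mul_pow, pow_mul]
      have h2 : (-1 : MvPolynomial (Fin 2) ℂ) * ((X 0 - X 1) * (X 0 - X 1) *
          ((X 1 - X 0) * (X 0 - X 1))) = (X 0 - X 1) ^ 4 := by ring
      rw [h2]
      ring
    rw [h1]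
    refine Ideal.mul_mem_left _ _ ?_
    rw [mem_shiftAnn]
    ext1 a
    have h3 := congrFun hψ ![a 0, a 1, 0, 0]
    simp only [Matrix.cons_val, add_zero] at h3
    have h4 : (![a 0, a 1] : Fin 2 → ℤ) = a := by
      ext i; fin_cases i <;> rfl
    rw [h4] at h3
    exact h3.symm
  exact mem_shiftAnn_of_X_mul (mem_shiftAnn_of_X_mul hfin)

end Contraction

section Counting

variable {M : Type*} [AddCommGroup M] [Module ℂ M]

theorem IsWitt.casimir_comm {e : ℤ → Module.End ℂ M} (he : IsWitt e) :
    Commute (e 1 * e (-1) - e 0 * e 0 + e 0) (e 1) := by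
  have h1 := he (-1) 1
  have h2 := he 0 1
  norm_num at h1 h2
  rw [sub_eq_iff_eq_add] at h1 h2
  rw [Commute, SemiconjBy]
  have h3 : e 1 * e (-1) * e 1 = e 1 * ((2 : ℂ) • e 0 + e 1 * e (-1)) := by rw [← h1, mul_assoc]
  have h4 : e 0 * e 0 * e 1 = e 1 * e 0 + e 1 + (e 1 + e 1 * e 0) * e 0 := by
    rw [mul_assoc, h2, mul_add, ← mul_assoc, h2]
    abel
  rw [add_mul, sub_mul, h3, h4, h2, mul_add, add_mul, two_smul]
  noncomm_ring

theorem IsWitt.lower_pow {e : ℤ → Module.End ℂ M} (he : IsWitt e) {a : ℂ} {w : M}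
    (h0 : e 0 w = a • w) (hw : e (-1) w = 0) (k : ℕ) :
    e 0 ((e 1 ^ k) w) = (a + k) • (e 1 ^ k) w ∧
      e (-1) ((e 1 ^ (k + 1)) w) = ((k + 1) * (2 * a + k)) • (e 1 ^ k) w := by
  have h1 : ∀ v, e (-1) (e 1 v) = e 1 (e (-1) v) + (2 : ℂ) • e 0 v := by
    intro v
    have h1 := LinearMap.congr_fun (he (-1) 1) v
    norm_num at h1
    rw [sub_eq_iff_eq_add] at h1
    rw [h1, add_comm]
  have h2 : ∀ v, e 0 (e 1 v) = e 1 (e 0 v) + e 1 v := by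
    intro v
    have h1 := LinearMap.congr_fun (he 0 1) v
    norm_num at h1
    rw [sub_eq_iff_eq_add] at h1
    rw [h1, add_comm]
  induction k with
  | zero => simp [h1, h0, hw, smul_smul]
  | succ k ih =>
    have h3 : ∀ n : ℕ, (e 1 ^ (n + 1)) w = e 1 ((e 1 ^ n) w) := fun n => by
      rw [pow_succ', Module.End.mul_apply]
    have h4 : e 0 ((e 1 ^ (k + 1)) w) = (a + (k + 1 : ℕ)) • (e 1 ^ (k + 1)) w := by
      rw [h3, h2, ih.1, map_smul]
      push_cast
      module
    refine ⟨h4, ?_⟩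
    rw [h3 (k + 1), h1, ih.2, h4, map_smul, ← h3]
    push_cast
    module

theorem IsWitt.raise_ne_zero {e : ℤ → Module.End ℂ M} (he : IsWitt e) {a : ℂ} {w : M}
    (h0 : e 0 w = a • w) (hw : e (-1) w = 0) (hne : w ≠ 0) (m : ℕ)
    (hm : ∀ t < m, 2 * a + t ≠ 0) : (e 1 ^ m) w ≠ 0 := by
  induction m with
  | zero => simpa using hne
  | succ m ih =>
    intro h
    have h1 := (he.lower_pow h0 hw m).2
    rw [h, map_zero] at h1
    have h2 := smul_eq_zero.1 h1.symm
    rcases h2 with h2 | h2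
    · rcases mul_eq_zero.1 h2 with h3 | h3
      · exact Nat.cast_add_one_ne_zero m h3
      · exact hm m (Nat.lt_succ_self m) h3
    · exact ih (fun t ht => hm t (ht.trans (Nat.lt_succ_self m))) h2

variable {C : ℕ} {lam : ℂ} {e : ℤ → Module.End ℂ M} {wt : ℤ → Submodule ℂ M}

theorem IsWittBdd.raise_mem (h : IsWittBdd C lam e wt) {j : ℤ} {v : M} (hv : v ∈ wt j) (m : ℕ) :
    (e 1 ^ m) v ∈ wt (j + m) := by
  induction m with
  | zero => simpa using hv
  | succ m ih =>
    rw [pow_succ', Module.End.mul_apply]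
    convert h.map_wt 1 _ _ ih using 2
    push_cast
    ring

theorem IsWittBdd.card_le_of_ker (h : IsWittBdd C lam e wt) (S : Finset ℤ)
    (hS : ∀ j ∈ S, ∃ w ∈ wt j, w ≠ 0 ∧ e (-1) w = 0) (p : ℤ) (hp : ∀ j ∈ S, j ≤ p)
    (h1 : ∀ j ∈ S, ∀ t : ℕ, j + t < p → 2 * (lam + j) + t ≠ 0)
    (h2 : ∀ j ∈ S, ∀ j' ∈ S, j ≠ j' → (lam + j) + (lam + j') ≠ 1) : S.card ≤ C := by
  choose! w hw using hS
  let μ : S → ℂ := fun j => (lam + (j : ℤ)) - (lam + (j : ℤ)) * (lam + (j : ℤ))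
  let u : S → M := fun j => (e 1 ^ (p - j).toNat) (w j)
  have hu : ∀ j, u j ∈ wt p := by
    intro j
    have h3 := h.raise_mem (hw j j.2).1 (p - j).toNat
    have h4 : (j : ℤ) + ((p - j).toNat : ℤ) = p := by
      have := hp j j.2
      omega
    rwa [h4] at h3
  have hμ : Function.Injective μ := by
    intro j j' hjj
    by_contra hne
    have hne' : (j : ℤ) ≠ j' := fun h => hne (Subtype.ext h)
    have h3 := h2 j j.2 j' j'.2 hne'
    simp only [μ] at hjj
    have h4 : ((j : ℤ) - (j' : ℤ) : ℂ) * (1 - ((lam + (j : ℤ)) + (lam + (j' : ℤ)))) = 0 := by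
      linear_combination hjj
    rcases mul_eq_zero.1 h4 with h5 | h5
    · exact hne' (by exact_mod_cast sub_eq_zero.1 h5)
    · exact h3 (sub_eq_zero.1 h5).symm
  have heig : ∀ j, Module.End.HasEigenvector (e 1 * e (-1) - e 0 * e 0 + e 0) (μ j) (u j) := by
    intro j
    obtain ⟨g1, g2, g3⟩ := hw j j.2
    have g0 := h.zero_wt j _ g1
    refine ⟨Module.End.mem_eigenspace_iff.2 ?_, ?_⟩
    · have hc := (h.witt.casimir_comm.pow_right (p - j).toNat).eq
      have hc2 := LinearMap.congr_fun hc (w j)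
      rw [Module.End.mul_apply, Module.End.mul_apply] at hc2
      simp only [u]
      rw [hc2]
      simp only [LinearMap.add_apply, LinearMap.sub_apply, Module.End.mul_apply, g3, g0, map_zero,
        map_smul, μ]
      simp only [map_add, map_sub, map_smul, map_zero]
      module
    · refine h.witt.raise_ne_zero g0 g3 g2 _ fun t ht => h1 j j.2 t ?_
      omega
  have hli := Module.End.eigenvectors_linearIndependent' _ μ hμ u heig
  have hli2 : LinearIndependent ℂ (fun j => (⟨u j, hu j⟩ : wt p)) :=
    LinearIndependent.of_comp (wt p).subtype hli
  have := h.fin p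
  have h5 := hli2.fintype_card_le_finrank
  rw [Fintype.card_coe] at h5
  exact h5.trans (h.rank p)

theorem IsWittBdd.card_ker_le (h : IsWittBdd C lam e wt) (S : Finset ℤ)
    (hS : ∀ j ∈ S, ∃ w ∈ wt j, w ≠ 0 ∧ e (-1) w = 0) : S.card ≤ 2 * C := by
  have hexp : ∀ T : Finset ℤ, ∃ p, ∀ j ∈ T, j ≤ p := fun T => T.bddAbove
  have hsplit := Finset.card_filter_add_card_filter_not (s := S) (fun j => lam.re + j ≤ 1 / 2)
  have hA : (S.filter fun j : ℤ => lam.re + j ≤ 1 / 2).card ≤ C := by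
    by_cases hne : (S.filter fun j : ℤ => lam.re + j ≤ 1 / 2).Nonempty
    · obtain ⟨p, hp⟩ : ∃ p, p = (S.filter fun j : ℤ => lam.re + j ≤ 1 / 2).max' hne := ⟨_, rfl⟩
      have hpS := Finset.max'_mem _ hne
      rw [← hp, Finset.mem_filter] at hpS
      refine h.card_le_of_ker _ (fun j hj => hS j (Finset.mem_filter.1 hj).1) p
        (fun j hj => hp ▸ Finset.le_max' _ j hj) ?_ ?_
      · intro j hj t ht h0
        have h1 := congrArg Complex.re h0
        simp at h1
        have h2 : (j : ℝ) + t + 1 ≤ p := by exact_mod_cast (by omega : j + (t:ℤ) + 1 ≤ p)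
        have h3 : (0 : ℝ) ≤ t := t.cast_nonneg
        linarith [hpS.2]
      · intro j hj j' hj' hne h0
        have h1 := congrArg Complex.re h0
        simp at h1
        have h2 := (Finset.mem_filter.1 hj).2
        have h3 := (Finset.mem_filter.1 hj').2
        apply hne
        have : (j : ℝ) = j' := by linarith
        exact_mod_cast this
    · rw [Finset.not_nonempty_iff_eq_empty.1 hne]; simp
  have hB : (S.filter fun j : ℤ => ¬ lam.re + j ≤ 1 / 2).card ≤ C := by
    obtain ⟨p, hp⟩ := hexp (S.filter fun j : ℤ => ¬ lam.re + j ≤ 1 / 2)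
    refine h.card_le_of_ker _ (fun j hj => hS j (Finset.mem_filter.1 hj).1) p hp ?_ ?_
    · intro j hj t ht h0
      have h1 := congrArg Complex.re h0
      simp at h1
      have h2 := (Finset.mem_filter.1 hj).2
      have h3 : (0 : ℝ) ≤ t := t.cast_nonneg
      linarith
    · intro j hj j' hj' hne h0
      have h1 := congrArg Complex.re h0
      simp at h1
      have h2 := (Finset.mem_filter.1 hj).2
      have h3 := (Finset.mem_filter.1 hj').2
      linarith
  omega

/-- The degrees in which `e (-1)` has a kernel. -/
def kerSet (e : ℤ → Module.End ℂ M) (wt : ℤ → Submodule ℂ M) : Set ℤ :=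
  {j | ∃ w ∈ wt j, w ≠ 0 ∧ e (-1) w = 0}

theorem IsWittBdd.exists_finset_kerSet (h : IsWittBdd C lam e wt) :
    ∃ S : Finset ℤ, (S : Set ℤ) = kerSet e wt ∧ S.card ≤ 2 * C := by
  have hfin : (kerSet e wt).Finite := by
    by_contra hinf
    obtain ⟨t, ht, hc⟩ := Set.Infinite.exists_subset_card_eq hinf (2 * C + 1)
    have := h.card_ker_le t fun j hj => ht hj
    omega
  refine ⟨hfin.toFinset, hfin.coe_toFinset, h.card_ker_le _ fun j hj => ?_⟩
  exact hfin.mem_toFinset.1 hj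

/-- Far to the left, `e (-1)` is surjective. -/
theorem IsWittBdd.exists_surjective_below (h : IsWittBdd C lam e wt) :
    ∃ j₀, ∀ j ≤ j₀, ∀ v ∈ wt (j - 1), ∃ u ∈ wt j, e (-1) u = v := by
  obtain ⟨S, hS, -⟩ := h.exists_finset_kerSet
  obtain ⟨b, hb⟩ := S.bddBelow
  have hinj : ∀ j < b, j ∉ kerSet e wt := by
    intro j hj hj'
    rw [← hS] at hj'
    exact absurd (hb hj') (not_le.2 hj)
  let φ : ∀ j, wt j →ₗ[ℂ] wt (j - 1) := fun j =>
    (e (-1)).restrict (p := wt j) (q := wt (j - 1)) (fun v hv => h.map_wt (-1) j v hv)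
  have hφ : ∀ j < b, Function.Injective (φ j) := by
    intro j hj
    rw [← LinearMap.ker_eq_bot, Submodule.eq_bot_iff]
    intro w hw
    by_contra hne
    refine hinj j hj ⟨w, w.2, fun h => hne (Subtype.ext h), ?_⟩
    exact congrArg Subtype.val (LinearMap.mem_ker.1 hw)
  have hfin := h.fin
  have hmono : ∀ j < b, Module.finrank ℂ (wt j) ≤ Module.finrank ℂ (wt (j - 1)) := fun j hj =>
    LinearMap.finrank_le_finrank_of_injective (hφ j hj)
  have hne : ((fun j => Module.finrank ℂ (wt j)) '' Set.Iio b).Nonempty :=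
    ⟨_, b - 1, by simp, rfl⟩
  have hbd : BddAbove ((fun j => Module.finrank ℂ (wt j)) '' Set.Iio b) :=
    ⟨C, by rintro _ ⟨j, -, rfl⟩; exact h.rank j⟩
  obtain ⟨j₀, hj₀, hmax⟩ := Nat.sSup_mem hne hbd
  have hle : ∀ j < b, Module.finrank ℂ (wt j) ≤ Module.finrank ℂ (wt j₀) := by
    intro j hj
    have h1 : Module.finrank ℂ (wt j) ≤ sSup ((fun j => Module.finrank ℂ (wt j)) '' Set.Iio b) :=
      le_csSup hbd ⟨j, hj, rfl⟩
    rw [← hmax] at h1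
    exact h1
  have heq : ∀ j ≤ j₀, Module.finrank ℂ (wt j) = Module.finrank ℂ (wt j₀) := by
    intro j hj
    induction j, hj using Int.leInductionDown with
    | base => rfl
    | pred j hj ih =>
      have hjb : j < b := lt_of_le_of_lt hj hj₀
      refine le_antisymm (hle _ (by omega)) ?_
      rw [← ih]
      exact hmono j hjb
  refine ⟨j₀, fun j hj v hv => ?_⟩
  have hjb : j < b := lt_of_le_of_lt hj hj₀
  have hsur := (LinearMap.injective_iff_surjective_of_finrank_eq_finrank
    ((heq j hj).trans (heq (j - 1) (by omega)).symm)).1 (hφ j hjb)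
  obtain ⟨u, hu⟩ := hsur ⟨v, hv⟩
  exact ⟨u, u.2, congrArg Subtype.val hu⟩

/-- A large family of graded operators commuting with `e (-1)` contains a nontrivial relation. -/
theorem IsWittBdd.exists_eq_zero_of_comm (h : IsWittBdd C lam e wt) {V : Type*} [AddCommGroup V]
    [Module ℂ V] [FiniteDimensional ℂ V] (hV : (2 * C + 1) * C ^ 2 < Module.finrank ℂ V) (s : ℤ)
    (X : V →ₗ[ℂ] Module.End ℂ M) (hcomm : ∀ c, e (-1) * X c = X c * e (-1))
    (hdeg : ∀ c j, ∀ v ∈ wt j, X c v ∈ wt (j + s)) : ∃ c ≠ 0, X c = 0 := by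
  classical
  obtain ⟨S, hS, hcard⟩ := h.exists_finset_kerSet
  obtain ⟨j₀, hj₀⟩ := h.exists_surjective_below
  have hfin := h.fin
  let J : Finset ℤ := insert j₀ (S.image fun j => j - s)
  have hJ : J.card ≤ 2 * C + 1 :=
    (Finset.card_insert_le _ _).trans (Nat.succ_le_succ (Finset.card_image_le.trans hcard))
  let Φ : V →ₗ[ℂ] (∀ j : J, wt j →ₗ[ℂ] wt (j + s)) :=
    { toFun := fun c j => (X c).restrict (hdeg c j)
      map_add' := by
        intro c c'
        ext j v
        simp
      map_smul' := by
        intro r c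
        ext j v
        simp }
  have hrank : Module.finrank ℂ (∀ j : J, wt j →ₗ[ℂ] wt (j + s)) ≤ (2 * C + 1) * C ^ 2 := by
    rw [Module.finrank_pi_fintype]
    refine (Finset.sum_le_card_nsmul _ _ (C ^ 2) fun j _ => ?_).trans ?_
    · rw [Module.finrank_linearMap, pow_two]
      exact Nat.mul_le_mul (h.rank _) (h.rank _)
    · rw [smul_eq_mul, Finset.card_univ, Fintype.card_coe]
      exact Nat.mul_le_mul_right _ hJ
  have hker := LinearMap.ker_ne_bot_of_finrank_lt (f := Φ) (hrank.trans_lt hV)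
  obtain ⟨c, hc, hc0⟩ := (Submodule.ne_bot_iff _).1 hker
  refine ⟨c, hc0, end_eq_zero_of_wt h.iSup_wt ?_⟩
  have hzero : ∀ j ∈ J, ∀ v ∈ wt j, X c v = 0 := by
    intro j hj v hv
    have h1 := LinearMap.congr_fun (congrFun (LinearMap.mem_ker.1 hc) ⟨j, hj⟩) ⟨v, hv⟩
    exact congrArg Subtype.val h1
  have hcv : ∀ v, e (-1) (X c v) = X c (e (-1) v) := fun v => LinearMap.congr_fun (hcomm c) v
  intro j
  rcases le_total j j₀ with hj | hj
  · induction j, hj using Int.leInductionDown with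
    | base => exact hzero j₀ (Finset.mem_insert_self _ _)
    | pred j hj ih =>
      intro v hv
      obtain ⟨u, hu, rfl⟩ := hj₀ j hj v hv
      rw [← hcv, ih u hu, map_zero]
  · induction j, hj using Int.leInduction with
    | base => exact hzero j₀ (Finset.mem_insert_self _ _)
    | succ j hj ih =>
      intro v hv
      by_cases hb : j + 1 + s ∈ kerSet e wt
      · refine hzero (j + 1) (Finset.mem_insert_of_mem (Finset.mem_image.2 ⟨j + 1 + s, ?_, ?_⟩)) v hv
        · rw [← hS] at hb
          exact hb
        · ring
      · by_contra hne
        refine hb ⟨X c v, hdeg c _ v hv, hne, ?_⟩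
        rw [hcv]
        refine ih _ ?_
        have := h.map_wt (-1) _ _ hv
        simpa using this

end Counting

section Invariants

open MvPolynomial

/-- The sum of the squared differences of three variables. -/
def sqDiff : MvPolynomial (Fin 3) ℂ := (X 0 - X 1) ^ 2 + (X 0 - X 2) ^ 2 + (X 1 - X 2) ^ 2

/-- Linear combinations of the monomials of degree `6 * K` in the two basic symmetric
translation invariant polynomials. -/
def invPoly (K : ℕ) : (Fin (K + 1) → ℂ) →ₗ[ℂ] MvPolynomial (Fin 3) ℂ :=
  ∑ i : Fin (K + 1), (LinearMap.proj i).smulRight (sqDiff ^ (3 * (K - i)) * (vdm ^ 2) ^ (i : ℕ))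

theorem invPoly_apply (K : ℕ) (c : Fin (K + 1) → ℂ) :
    invPoly K c = ∑ i : Fin (K + 1), c i • (sqDiff ^ (3 * (K - i)) * (vdm ^ 2) ^ (i : ℕ)) := by
  simp [invPoly]

theorem rename_swap01_sqDiff : rename (Equiv.swap (0 : Fin 3) 1) sqDiff = sqDiff := by
  have h0 : Equiv.swap (0 : Fin 3) 1 2 = 2 := by decide
  simp only [sqDiff, map_add, map_pow, map_sub, rename_X, Equiv.swap_apply_left,
    Equiv.swap_apply_right, h0]
  ring

theorem rename_swap12_sqDiff : rename (Equiv.swap (1 : Fin 3) 2) sqDiff = sqDiff := by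
  have h0 : Equiv.swap (1 : Fin 3) 2 0 = 0 := by decide
  simp only [sqDiff, map_add, map_pow, map_sub, rename_X, Equiv.swap_apply_left,
    Equiv.swap_apply_right, h0]
  ring

theorem rename_swap01_vdm : rename (Equiv.swap (0 : Fin 3) 1) vdm = -vdm := by
  have h0 : Equiv.swap (0 : Fin 3) 1 2 = 2 := by decide
  simp only [vdm, map_mul, map_sub, rename_X, Equiv.swap_apply_left,
    Equiv.swap_apply_right, h0]
  ring

theorem rename_swap12_vdm : rename (Equiv.swap (1 : Fin 3) 2) vdm = -vdm := by
  have h0 : Equiv.swap (1 : Fin 3) 2 0 = 0 := by decide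
  simp only [vdm, map_mul, map_sub, rename_X, Equiv.swap_apply_left,
    Equiv.swap_apply_right, h0]
  ring

theorem rename_swap01_invPoly (K : ℕ) (c : Fin (K + 1) → ℂ) :
    rename (Equiv.swap (0 : Fin 3) 1) (invPoly K c) = invPoly K c := by
  simp only [invPoly_apply, map_sum, map_smul, map_mul, map_pow, rename_swap01_sqDiff,
    rename_swap01_vdm, neg_sq]

theorem rename_swap12_invPoly (K : ℕ) (c : Fin (K + 1) → ℂ) :
    rename (Equiv.swap (1 : Fin 3) 2) (invPoly K c) = invPoly K c := by
  simp only [invPoly_apply, map_sum, map_smul, map_mul, map_pow, rename_swap12_sqDiff,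
    rename_swap12_vdm, neg_sq]

theorem isHomogeneous_X_sub_X (i j : Fin 3) :
    (X i - X j : MvPolynomial (Fin 3) ℂ).IsHomogeneous 1 :=
  (isHomogeneous_X _ _).sub (isHomogeneous_X _ _)

theorem isHomogeneous_invPoly (K : ℕ) (c : Fin (K + 1) → ℂ) :
    (invPoly K c).IsHomogeneous (6 * K) := by
  rw [invPoly_apply]
  refine IsHomogeneous.sum _ _ _ fun i _ => ?_
  rw [smul_eq_C_mul]
  have h1 : sqDiff.IsHomogeneous 2 :=
    (((isHomogeneous_X_sub_X 0 1).pow 2).add ((isHomogeneous_X_sub_X 0 2).pow 2)).add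
      ((isHomogeneous_X_sub_X 1 2).pow 2)
  have h2 : vdm.IsHomogeneous 3 :=
    ((isHomogeneous_X_sub_X 0 1).mul (isHomogeneous_X_sub_X 0 2)).mul (isHomogeneous_X_sub_X 1 2)
  have h3 := (isHomogeneous_C (Fin 3) (c i)).mul
    ((h1.pow (3 * (K - i))).mul ((h2.pow 2).pow (i : ℕ)))
  convert h3 using 1
  omega

/-- The infinitesimal simultaneous translation of all variables. -/
def totalDeriv : Derivation ℂ (MvPolynomial (Fin 3) ℂ) (MvPolynomial (Fin 3) ℂ) :=
  pderiv 0 + pderiv 1 + pderiv 2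

theorem totalDeriv_X_sub_X (i j : Fin 3) : totalDeriv (X i - X j) = 0 := by
  have h : ∀ i : Fin 3, totalDeriv (X i) = 1 := by
    intro i
    fin_cases i <;> simp [totalDeriv, pderiv_X]
  rw [map_sub, h, h, sub_self]

theorem totalDeriv_invPoly (K : ℕ) (c : Fin (K + 1) → ℂ) : totalDeriv (invPoly K c) = 0 := by
  have h1 : totalDeriv sqDiff = 0 := by
    simp only [sqDiff, map_add, Derivation.leibniz_pow, totalDeriv_X_sub_X, smul_zero, add_zero]
  have h2 : totalDeriv vdm = 0 := by
    simp only [vdm, Derivation.leibniz, totalDeriv_X_sub_X, smul_zero, add_zero]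
  rw [invPoly_apply, map_sum]
  refine Finset.sum_eq_zero fun i _ => ?_
  rw [Derivation.map_smul, Derivation.leibniz, Derivation.leibniz_pow, Derivation.leibniz_pow,
    Derivation.leibniz_pow, h1, h2]
  simp

theorem invPoly_succ (K : ℕ) (c : Fin (K + 2) → ℂ) :
    invPoly (K + 1) c = c 0 • sqDiff ^ (3 * (K + 1)) +
      vdm ^ 2 * invPoly K (fun i => c i.succ) := by
  rw [invPoly_apply, Fin.sum_univ_succ, invPoly_apply, Finset.mul_sum]
  refine congrArg₂ (· + ·) ?_ (Finset.sum_congr rfl fun i _ => ?_)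
  · rw [Fin.val_zero, Nat.sub_zero, pow_zero, mul_one]
  · rw [mul_smul_comm, Fin.val_succ, Nat.add_sub_add_right, pow_succ (vdm ^ 2)]
    refine congrArg (c i.succ • ·) ?_
    ring

theorem vdm_ne_zero : vdm ≠ 0 := by
  have h : ∀ i j : Fin 3, i ≠ j → (X i - X j : MvPolynomial (Fin 3) ℂ) ≠ 0 := fun i j hij =>
    sub_ne_zero.2 fun h => hij (X_injective h)
  exact mul_ne_zero (mul_ne_zero (h 0 1 (by decide)) (h 0 2 (by decide))) (h 1 2 (by decide))

theorem eq_zero_of_invPoly_eq_zero (K : ℕ) (c : Fin (K + 1) → ℂ) (h : invPoly K c = 0) :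
    c = 0 := by
  have hs : eval (![0, 0, 1] : Fin 3 → ℂ) sqDiff ≠ 0 := by
    simp [sqDiff]
  have hv : eval (![0, 0, 1] : Fin 3 → ℂ) vdm = 0 := by simp [vdm]
  induction K with
  | zero =>
    ext i
    fin_cases i
    simpa [invPoly_apply] using h
  | succ K ih =>
    rw [invPoly_succ] at h
    have h0 : c 0 = 0 := by
      have h1 := congrArg (eval (![0, 0, 1] : Fin 3 → ℂ)) h
      rw [map_add, map_mul, map_pow, hv, smul_eval, map_pow, map_zero] at h1
      have h2 : c 0 * eval (![0, 0, 1] : Fin 3 → ℂ) sqDiff ^ (3 * (K + 1)) = 0 := by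
        simpa using h1
      exact (mul_eq_zero.1 h2).resolve_right (pow_ne_zero _ hs)
    rw [h0, zero_smul, zero_add] at h
    have h3 := ih _ ((mul_eq_zero.1 h).resolve_left (pow_ne_zero _ vdm_ne_zero))
    ext i
    refine Fin.cases h0 (fun i => congrFun h3 i) i

variable {M : Type*} [AddCommGroup M] [Module ℂ M] {C : ℕ} {lam : ℂ} {e : ℤ → Module.End ℂ M}
  {wt : ℤ → Submodule ℂ M}

theorem IsWitt.shiftAct_invPoly_comm (he : IsWitt e) (K : ℕ) (c : Fin (K + 1) → ℂ) :
    e (-1) * shiftAct (invPoly K c) (word3 e) (fun _ => -1) =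
      shiftAct (invPoly K c) (word3 e) (fun _ => -1) * e (-1) := by
  rw [← sub_eq_zero, he.word3_cov.shiftAct]
  have h := totalDeriv_invPoly K c
  have h1 : ∀ i : Fin 3, (((fun _ => -1 : Fin 3 → ℤ) i : ℂ) - (-1 : ℤ)) •
      shiftAct (invPoly K c) (word3 e) ((fun _ => -1) + Pi.single i (-1)) +
      shiftAct (X i * pderiv i (invPoly K c)) (word3 e) ((fun _ => -1) + Pi.single i (-1)) =
      shiftAct (pderiv i (invPoly K c)) (word3 e) (fun _ => -1) := by
    intro i
    rw [shiftAct_mul, shiftAct_X, add_assoc, ← Pi.single_add]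
    simp
  rw [Finset.sum_congr rfl fun i _ => h1 i, Fin.sum_univ_three, ← Pi.add_apply, ← Pi.add_apply,
    ← LinearMap.add_apply, ← LinearMap.add_apply, ← map_add, ← map_add]
  have h2 : pderiv 0 (invPoly K c) + pderiv 1 (invPoly K c) + pderiv 2 (invPoly K c) = 0 := h
  rw [h2]
  simp

/-- A cuspidal Witt algebra module satisfies a nontrivial symmetric cubic relation. -/
theorem IsWittBdd.exists_symmetric_relation (h : IsWittBdd C lam e wt) :
    ∃ g : MvPolynomial (Fin 3) ℂ, g ≠ 0 ∧ g.totalDegree ≤ 6 * ((2 * C + 1) * C ^ 2) ∧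
      rename (Equiv.swap (0 : Fin 3) 1) g = g ∧ rename (Equiv.swap (1 : Fin 3) 2) g = g ∧
      shiftAct g (word3 e) (fun _ => -1) = 0 := by
  obtain ⟨c, hc, hX⟩ := h.exists_eq_zero_of_comm
    (V := Fin ((2 * C + 1) * C ^ 2 + 1) → ℂ) (by simp)
    (-3 + ((6 * ((2 * C + 1) * C ^ 2) : ℕ) : ℤ))
    ((LinearMap.proj (fun _ => -1)).comp
      ((LinearMap.applyₗ (word3 e)).comp
        ((shiftAct (E := Module.End ℂ M)).toLinearMap.comp (invPoly ((2 * C + 1) * C ^ 2)))))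
    (fun c => h.witt.shiftAct_invPoly_comm _ c)
    (fun c j v hv => by
      have h1 := isGraded_shiftAct h.word3_graded (isHomogeneous_invPoly _ c)
        (fun _ => -1) j v hv
      have h2 : j + (-3 + ((6 * ((2 * C + 1) * C ^ 2) : ℕ) : ℤ)) =
          j + ∑ i : Fin 3, -1 + (0 + ((6 * ((2 * C + 1) * C ^ 2) : ℕ) : ℤ)) := by
        rw [Fin.sum_univ_three]
        ring
      rw [h2]
      exact h1)
  exact ⟨invPoly _ c, fun h0 => hc (eq_zero_of_invPoly_eq_zero _ c h0),
    (isHomogeneous_invPoly _ c).totalDegree_le, rename_swap01_invPoly _ c,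
    rename_swap12_invPoly _ c, hX⟩

end Invariants

section Multiplication

open MvPolynomial

theorem shiftAct_mem {σ : Type} {E : Type*} [AddCommGroup E] [Module ℂ E] (S : Submodule ℂ E)
    {G : (σ → ℤ) → E} (hG : ∀ a, G a ∈ S) (p : MvPolynomial σ ℂ) (a : σ → ℤ) :
    shiftAct p G a ∈ S := by
  induction p using MvPolynomial.induction_on' with
  | monomial s c => rw [shiftAct_monomial]; exact S.smul_mem _ (hG _)
  | add p q hp hq => rw [shiftAct_add]; exact S.add_mem hp hq

theorem shiftAct_sub_pow_eq_sum {σ : Type} {E : Type*} [AddCommGroup E] [Module ℂ E]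
    {p q : MvPolynomial σ ℂ} {u v : σ → ℤ}
    (hp : ∀ (G : (σ → ℤ) → E) a, shiftAct p G a = G (a + u))
    (hq : ∀ (G : (σ → ℤ) → E) a, shiftAct q G a = G (a + v)) (n : ℕ) (G : (σ → ℤ) → E)
    (a : σ → ℤ) :
    shiftAct ((p - q) ^ n) G a =
      ∑ j ∈ Finset.range (n + 1), (((-1 : ℤ) ^ (j + n) * (n.choose j : ℤ) : ℤ) : ℂ) •
        G (a + (n • v + j • (u - v))) := by
  have hpow : ∀ {p : MvPolynomial σ ℂ} {u : σ → ℤ},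
      (∀ (G : (σ → ℤ) → E) a, shiftAct p G a = G (a + u)) →
      ∀ (n : ℕ) (G : (σ → ℤ) → E) a, shiftAct (p ^ n) G a = G (a + n • u) := by
    intro p u hp n
    induction n with
    | zero => intro G a; simp
    | succ n ih =>
      intro G a
      rw [pow_succ, shiftAct_mul, ih, hp, succ_nsmul, add_assoc]
  rw [sub_pow, map_sum, LinearMap.sum_apply, Finset.sum_apply]
  refine Finset.sum_congr rfl fun j hj => ?_
  have h1 : ((-1) ^ (j + n) * p ^ j * q ^ (n - j) * (n.choose j : MvPolynomial σ ℂ)) =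
      (((-1 : ℤ) ^ (j + n) * (n.choose j : ℤ) : ℤ) : ℂ) • (p ^ j * q ^ (n - j)) := by
    rw [smul_eq_C_mul]
    push_cast
    simp only [map_mul, map_pow, map_neg, map_one, map_natCast]
    ring
  rw [h1, map_smul, LinearMap.smul_apply, Pi.smul_apply, shiftAct_mul, hpow hp, hpow hq]
  congr 2
  have h2 : j ≤ n := Nat.lt_succ_iff.1 (Finset.mem_range.1 hj)
  rw [smul_sub, add_assoc]
  congr 1
  obtain ⟨d, rfl⟩ := Nat.exists_eq_add_of_le h2
  rw [Nat.add_sub_cancel_left, add_smul]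
  abel

theorem sum_choose_prod_seven (x y : Fin 6 → ℤ) :
    ∑ j ∈ Finset.range 8, (-1 : ℤ) ^ (j + 7) * ((7 : ℕ).choose j : ℤ) * ∏ s, (x s + j * y s) =
      0 := by
  simp only [Fin.prod_univ_six, Finset.sum_range_succ, Finset.sum_range_zero]
  norm_num [Nat.choose]
  ring

theorem sum_choose_prod_six (x y : Fin 6 → ℤ) :
    ∑ j ∈ Finset.range 7, (-1 : ℤ) ^ (j + 6) * ((6 : ℕ).choose j : ℤ) * ∏ s, (x s + j * y s) =
      720 * ∏ s, y s := by
  simp only [Fin.prod_univ_six, Finset.sum_range_succ, Finset.sum_range_zero]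
  norm_num [Nat.choose]
  ring

section Field

variable {E : Type*} [AddCommGroup E] [Module ℂ E]

/-- The operator describing the commutator with `e k` on functions satisfying `IsCov`. -/
def covOp (k : ℤ) : Module.End ℂ ((Fin 3 → ℤ) → E) :=
  ∑ i : Fin 3,
    { toFun := fun G a => ((a i : ℂ) - k) • G (a + Pi.single i k)
      map_add' := fun G H => by ext a; simp
      map_smul' := fun c G => by ext a; simp [smul_comm c] }

theorem covOp_apply (k : ℤ) (G : (Fin 3 → ℤ) → E) (a : Fin 3 → ℤ) :
    covOp k G a = ∑ i, ((a i : ℂ) - k) • G (a + Pi.single i k) := by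
  simp [covOp]

/-- The scalar factor coming from the letter `s` in a product of the operators `covOp`. -/
def covFac {d : ℕ} (i : Fin d → Fin 3) (a : Fin 3 → ℤ) (z : Fin d → ℤ) (s : Fin d) : ℤ :=
  a (i s) + ∑ r, (if r < s ∧ i r = i s then z r else 0) - z s

/-- The argument produced by a product of the operators `covOp`. -/
def covArg {d : ℕ} (i : Fin d → Fin 3) (a : Fin 3 → ℤ) (z : Fin d → ℤ) : Fin 3 → ℤ :=
  a + ∑ r, Pi.single (i r) (z r)

theorem covFac_add {d : ℕ} (i : Fin d → Fin 3) (a : Fin 3 → ℤ) (z w : Fin d → ℤ) (s : Fin d) :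
    covFac i a (z + w) s = covFac i a z s + covFac i 0 w s := by
  have : ∀ r, (if r < s ∧ i r = i s then (z + w) r else 0) =
      (if r < s ∧ i r = i s then z r else 0) + (if r < s ∧ i r = i s then w r else 0) := by
    intro r; split_ifs <;> simp
  rw [covFac, Finset.sum_congr rfl fun r _ => this r, Finset.sum_add_distrib, covFac, covFac,
    Pi.add_apply, Pi.zero_apply]
  ring

theorem covFac_zero_nsmul {d : ℕ} (i : Fin d → Fin 3) (j : ℕ) (w : Fin d → ℤ) (s : Fin d) :
    covFac i 0 (j • w) s = j * covFac i 0 w s := by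
  simp only [covFac, Pi.smul_apply, Pi.zero_apply, zero_add, mul_sub, Finset.mul_sum, mul_ite,
    mul_zero, nsmul_eq_mul]

theorem covArg_add {d : ℕ} (i : Fin d → Fin 3) (a : Fin 3 → ℤ) (z w : Fin d → ℤ) :
    covArg i a (z + w) = covArg i a z + covArg i 0 w := by
  simp only [covArg, Pi.add_apply, Pi.single_add, Finset.sum_add_distrib]
  abel

theorem covArg_zero_nsmul {d : ℕ} (i : Fin d → Fin 3) (j : ℕ) (w : Fin d → ℤ) :
    covArg i 0 (j • w) = j • covArg i 0 w := by
  simp only [covArg, zero_add, Finset.smul_sum, Pi.smul_apply]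
  refine Finset.sum_congr rfl fun r _ => ?_
  rw [← Pi.single_smul']

theorem covOp_prod_apply {d : ℕ} (z : Fin d → ℤ) (G : (Fin 3 → ℤ) → E) (a : Fin 3 → ℤ) :
    (List.ofFn fun s => covOp (z s)).prod G a =
      ∑ i : Fin d → Fin 3, ((∏ s, covFac i a z s : ℤ) : ℂ) • G (covArg i a z) := by
  induction d generalizing a with
  | zero => simp [covArg]
  | succ d ih =>
    rw [List.ofFn_succ, List.prod_cons, Module.End.mul_apply, covOp_apply,
      ← (Fin.consEquiv fun _ => Fin 3).sum_comp, Fintype.sum_prod_type]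
    refine Finset.sum_congr rfl fun i₀ _ => ?_
    rw [ih, Finset.smul_sum]
    refine Finset.sum_congr rfl fun i _ => ?_
    rw [smul_smul]
    congr 1
    · have h0 : covFac (Fin.consEquiv (fun _ => Fin 3) (i₀, i)) a z 0 = a i₀ - z 0 := by
        simp [covFac, Fin.consEquiv]
      have h1 : ∀ s : Fin d, covFac (Fin.consEquiv (fun _ => Fin 3) (i₀, i)) a z s.succ =
          covFac i (a + Pi.single i₀ (z 0)) (fun s => z s.succ) s := by
        intro s
        simp [covFac, Fin.consEquiv, Fin.sum_univ_succ, Pi.single_apply, eq_comm, add_assoc]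
      rw [Fin.prod_univ_succ, h0, Finset.prod_congr rfl fun s _ => h1 s]
      push_cast
      rfl
    · congr 1
      simp [covArg, Fin.consEquiv, Fin.sum_univ_succ, add_assoc]

theorem covTerm_eq {i : Fin 6 → Fin 3} {w : Fin 6 → ℤ} (hw : covArg i 0 w = 0)
    (a : Fin 3 → ℤ) (z : Fin 6 → ℤ) (j : ℕ) (G : (Fin 3 → ℤ) → E) :
    ((∏ s, covFac i a (z + j • w) s : ℤ) : ℂ) • G (covArg i a (z + j • w)) =
      ((∏ s, (covFac i a z s + j * covFac i 0 w s) : ℤ) : ℂ) • G (covArg i a z) := by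
  rw [covArg_add, covArg_zero_nsmul, hw, smul_zero, add_zero]
  simp only [covFac_add, covFac_zero_nsmul]

theorem shiftAct_seven_covTerm {i : Fin 6 → Fin 3} {s t : Fin 6} (h : i s = i t)
    (a : Fin 3 → ℤ) (G : (Fin 3 → ℤ) → E) :
    (X s - X t) ^ 7 ∈ shiftAnn fun z =>
      ((∏ s, covFac i a z s : ℤ) : ℂ) • G (covArg i a z) := by
  rw [mem_shiftAnn]
  ext1 z
  rw [shiftAct_sub_pow_eq_sum (fun G a => shiftAct_X s G a) (fun G a => shiftAct_X t G a)]
  have hw : covArg i 0 (Pi.single s 1 - Pi.single t 1 : Fin 6 → ℤ) = 0 := by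
    have h1 : ∀ s : Fin 6, covArg i 0 (Pi.single s 1) = Pi.single (i s) 1 := by
      intro s
      rw [covArg, zero_add, Finset.sum_eq_single s]
      · simp
      · intro r _ hr; simp [hr]
      · simp
    have h2 := covArg_add i 0 (Pi.single s 1 - Pi.single t 1 : Fin 6 → ℤ) (Pi.single t 1)
    rw [sub_add_cancel, h1, h1, h] at h2
    simpa using h2
  simp only [← add_assoc, covTerm_eq hw, smul_smul, ← Finset.sum_smul]
  have h3 := sum_choose_prod_seven (covFac i a (z + 7 • Pi.single t 1))
    (covFac i 0 (Pi.single s 1 - Pi.single t 1 : Fin 6 → ℤ))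
  rw [← Int.cast_inj (α := ℂ), Int.cast_sum, Int.cast_zero] at h3
  simp only [Int.cast_mul] at h3 ⊢
  rw [h3, zero_smul, Pi.zero_apply]

theorem shiftAct_XXX {d : ℕ} (s t r : Fin d) (G : (Fin d → ℤ) → E) (a : Fin d → ℤ) :
    shiftAct (X s * X t * X r) G a =
      G (a + (Pi.single s 1 + Pi.single t 1 + Pi.single r 1)) := by
  rw [shiftAct_mul, shiftAct_mul, shiftAct_X, shiftAct_X, shiftAct_X]
  simp only [add_assoc]

/-- The two blocks of three letters consist of distinct indices. -/
def BlockInj (i : Fin 6 → Fin 3) : Prop :=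
  (i 0 ≠ i 1 ∧ i 0 ≠ i 2 ∧ i 1 ≠ i 2) ∧ (i 3 ≠ i 4 ∧ i 3 ≠ i 5 ∧ i 4 ≠ i 5)

theorem shiftAct_six_covTerm {i : Fin 6 → Fin 3} (h : BlockInj i)
    (a : Fin 3 → ℤ) (G : (Fin 3 → ℤ) → E) :
    shiftAct ((X 0 * X 1 * X 2 - X 3 * X 4 * X 5) ^ 6) (fun z =>
      ((∏ s, covFac i a z s : ℤ) : ℂ) • G (covArg i a z)) =
      fun z => (-5760 : ℂ) • G (covArg i (a + fun _ => 6) z) := by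
  obtain ⟨⟨h01, h02, h12⟩, h34, h35, h45⟩ := h
  have hone : ∀ x y z t : Fin 3, x ≠ y → x ≠ z → y ≠ z →
      (if x = t then (1 : ℤ) else 0) + (if y = t then 1 else 0) + (if z = t then 1 else 0) = 1 := by
    decide
  obtain ⟨u, hu⟩ : ∃ u : Fin 6 → ℤ, u = Pi.single 0 1 + Pi.single 1 1 + Pi.single 2 1 := ⟨_, rfl⟩
  obtain ⟨v, hv⟩ : ∃ v : Fin 6 → ℤ, v = Pi.single 3 1 + Pi.single 4 1 + Pi.single 5 1 := ⟨_, rfl⟩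
  have hu' : u = ![1, 1, 1, 0, 0, 0] := by rw [hu]; decide
  have hv' : v = ![0, 0, 0, 1, 1, 1] := by rw [hv]; decide
  have hAu : covArg i 0 u = fun _ => 1 := by
    ext t
    rw [← hone (i 0) (i 1) (i 2) t h01 h02 h12, hu']
    simp [covArg, Fin.sum_univ_six, Pi.single_apply, eq_comm]
  have hAv : covArg i 0 v = fun _ => 1 := by
    ext t
    rw [← hone (i 3) (i 4) (i 5) t h34 h35 h45, hv']
    simp [covArg, Fin.sum_univ_six, Pi.single_apply, eq_comm]
  have hw : covArg i 0 (u - v) = 0 := by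
    have h2 := covArg_add i 0 (u - v) v
    rw [sub_add_cancel, hAu, hAv] at h2
    simpa using h2
  have hprod : ∏ s, covFac i 0 (u - v) s = -8 := by
    have e3 := hone (i 0) (i 1) (i 2) (i 3) h01 h02 h12
    have e4 := hone (i 0) (i 1) (i 2) (i 4) h01 h02 h12
    have e5 := hone (i 0) (i 1) (i 2) (i 5) h01 h02 h12
    have f0 : covFac i 0 (u - v) 0 = -1 := by
      simp [covFac, hu', hv']
    have f1 : covFac i 0 (u - v) 1 = -1 := by
      simp [covFac, Fin.sum_univ_six, hu', hv', h01]
    have f2 : covFac i 0 (u - v) 2 = -1 := by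
      simp [covFac, Fin.sum_univ_six, hu', hv', h02, h12]
    have f3 : covFac i 0 (u - v) 3 = 2 := by
      simp [covFac, Fin.sum_univ_six, hu', hv']
      linarith
    have f4 : covFac i 0 (u - v) 4 = 2 := by
      simp [covFac, Fin.sum_univ_six, hu', hv', h34]
      linarith
    have f5 : covFac i 0 (u - v) 5 = 2 := by
      simp [covFac, Fin.sum_univ_six, hu', hv', h35, h45]
      linarith
    rw [Fin.prod_univ_six, f0, f1, f2, f3, f4, f5]
    norm_num
  ext1 z
  rw [shiftAct_sub_pow_eq_sum (fun G a => shiftAct_XXX 0 1 2 G a)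
    (fun G a => shiftAct_XXX 3 4 5 G a), ← hu, ← hv]
  simp only [← add_assoc, covTerm_eq hw, smul_smul, ← Finset.sum_smul]
  have h3 := sum_choose_prod_six (covFac i a (z + 6 • v)) (covFac i 0 (u - v))
  rw [hprod, ← Int.cast_inj (α := ℂ), Int.cast_sum] at h3
  simp only [Int.cast_mul] at h3 ⊢
  rw [h3]
  congr 1
  · norm_num
  · congr 1
    rw [covArg_add, covArg_zero_nsmul, hAv]
    ext t
    simp [covArg]
    ring

end Field

end Multiplication

section Symmetrization

open MvPolynomial

variable {M : Type*} [AddCommGroup M] [Module ℂ M]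

theorem IsCov.exists_linear_of_mem_adjoin {e : ℤ → Module.End ℂ M}
    {F : (Fin 3 → ℤ) → Module.End ℂ M} (hF : IsCov e F)
    {Φ : Module.End ℂ ((Fin 3 → ℤ) → Module.End ℂ M)}
    (hΦ : Φ ∈ Algebra.adjoin ℂ (Set.range (covOp (E := Module.End ℂ M)))) :
    (∀ (L : Module.End ℂ M →ₗ[ℂ] Module.End ℂ M) G, Φ (fun a => L (G a)) = fun a => L (Φ G a)) ∧
      ∃ L : Module.End ℂ M →ₗ[ℂ] Module.End ℂ M, Φ F = fun a => L (F a) := by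
  induction hΦ using Algebra.adjoin_induction with
  | mem x hx =>
    obtain ⟨k, rfl⟩ := hx
    refine ⟨fun L G => ?_, LinearMap.mulLeft ℂ (e k) - LinearMap.mulRight ℂ (e k), ?_⟩
    · ext1 a
      simp only [covOp_apply, map_sum, map_smul]
    · ext1 a
      rw [covOp_apply, ← hF k a]
      rfl
  | algebraMap r =>
    refine ⟨fun L G => ?_, r • LinearMap.id, ?_⟩
    · ext1 a
      simp [Module.algebraMap_end_apply]
    · ext1 a
      simp [Module.algebraMap_end_apply]
  | add x y _ _ hx hy =>
    obtain ⟨hx, Lx, hLx⟩ := hx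
    obtain ⟨hy, Ly, hLy⟩ := hy
    refine ⟨fun L G => ?_, Lx + Ly, ?_⟩
    · ext1 a
      simp only [LinearMap.add_apply, hx, hy, Pi.add_apply, map_add]
    · ext1 a
      simp only [LinearMap.add_apply, hLx, hLy, Pi.add_apply]
  | mul x y _ _ hx hy =>
    obtain ⟨hx, Lx, hLx⟩ := hx
    obtain ⟨hy, Ly, hLy⟩ := hy
    refine ⟨fun L G => ?_, Ly ∘ₗ Lx, ?_⟩
    · simp only [Module.End.mul_apply, hx, hy]
    · simp only [Module.End.mul_apply, hLy, hx, hLx, LinearMap.comp_apply]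

/-- The difference operator separating the components of a product of six `covOp`. -/
def sepPoly : MvPolynomial (Fin 6) ℂ :=
  (((X 0 - X 1) * (X 0 - X 2) * (X 1 - X 2)) * ((X 3 - X 4) * (X 3 - X 5) * (X 4 - X 5))) ^ 8

theorem rename_sepPoly {i : Fin 6 → Fin 3} (h : BlockInj i) : rename i sepPoly = vdm ^ 16 := by
  have key : ∀ x y z : Fin 3, x ≠ y → x ≠ z → y ≠ z →
      ((X x - X y) * (X x - X z) * (X y - X z) : MvPolynomial (Fin 3) ℂ) ^ 2 = vdm ^ 2 := by
    intro x y z h1 h2 h3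
    fin_cases x <;> fin_cases y <;> fin_cases z <;>
      simp only [ne_eq, not_true_eq_false] at h1 h2 h3 <;>
      simp only [vdm, Fin.zero_eta, Fin.mk_one, Fin.reduceFinMk] <;> ring
  obtain ⟨⟨h01, h02, h12⟩, h34, h35, h45⟩ := h
  have k1 := key _ _ _ h01 h02 h12
  have k2 := key _ _ _ h34 h35 h45
  calc rename i sepPoly = (((X (i 0) - X (i 1)) * (X (i 0) - X (i 2)) * (X (i 1) - X (i 2))) ^ 2 *
        ((X (i 3) - X (i 4)) * (X (i 3) - X (i 5)) * (X (i 4) - X (i 5))) ^ 2) ^ 4 := by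
        simp only [sepPoly, map_mul, map_pow, map_sub, rename_X]
        rw [← mul_pow, ← pow_mul]
    _ = vdm ^ 16 := by
        rw [k1, k2, ← pow_add, ← pow_mul]

theorem covArg_add_single {d : ℕ} (i : Fin d → Fin 3) (a : Fin 3 → ℤ) (z : Fin d → ℤ) (s : Fin d) :
    covArg i a (z + Pi.single s 1) = covArg i a z + Pi.single (i s) 1 := by
  rw [covArg_add]
  congr 1
  rw [covArg, zero_add, Finset.sum_eq_single s]
  · simp
  · intro r _ hr; simp [hr]
  · simp

open Classical in
theorem shiftAct_sepPoly_covTerm {E : Type*} [AddCommGroup E] [Module ℂ E] (i : Fin 6 → Fin 3)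
    (a : Fin 3 → ℤ) (z : Fin 6 → ℤ) (G : (Fin 3 → ℤ) → E) :
    shiftAct (sepPoly * (X 0 * X 1 * X 2 - X 3 * X 4 * X 5) ^ 6)
      (fun z => ((∏ s, covFac i a z s : ℤ) : ℂ) • G (covArg i a z)) z =
      if BlockInj i then (-5760 : ℂ) • shiftAct (vdm ^ 16) G (covArg i (a + fun _ => 6) z)
      else 0 := by
  split_ifs with h
  · rw [shiftAct_mul, shiftAct_six_covTerm h]
    have h1 : (fun z => (-5760 : ℂ) • G (covArg i (a + fun _ => 6) z)) =
        (-5760 : ℂ) • fun z => G (covArg i (a + fun _ => 6) z) := rfl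
    rw [h1, map_smul, shiftAct_comp i (covArg i (a + fun _ => 6)) (covArg_add_single i _),
      rename_sepPoly h]
    rfl
  · have hz : ∀ s t : Fin 6, i s = i t → (X s - X t : MvPolynomial (Fin 6) ℂ) ^ 8 ∣ sepPoly →
        shiftAct (sepPoly * (X 0 * X 1 * X 2 - X 3 * X 4 * X 5) ^ 6)
          (fun z => ((∏ s, covFac i a z s : ℤ) : ℂ) • G (covArg i a z)) z = 0 := by
      intro s t hst hd
      have := mem_shiftAnn_of_dvd (((pow_dvd_pow _ (by norm_num : 7 ≤ 8)).trans hd).mul_right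
        ((X 0 * X 1 * X 2 - X 3 * X 4 * X 5) ^ 6)) (shiftAct_seven_covTerm hst a G)
      rw [mem_shiftAnn.1 this]
      rfl
    have hd : ∀ {p q : MvPolynomial (Fin 6) ℂ}, p ∣ q → p ^ 8 ∣ q ^ 8 := fun h => pow_dvd_pow_of_dvd h 8
    unfold BlockInj at h
    by_cases h01 : i 0 = i 1
    · exact hz _ _ h01 (hd ⟨_, by rw [mul_assoc, mul_assoc]⟩)
    by_cases h02 : i 0 = i 2
    · exact hz _ _ h02 (hd ⟨(X 0 - X 1) * (X 1 - X 2) *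
        ((X 3 - X 4) * (X 3 - X 5) * (X 4 - X 5)), by ring⟩)
    by_cases h12 : i 1 = i 2
    · exact hz _ _ h12 (hd ⟨(X 0 - X 1) * (X 0 - X 2) *
        ((X 3 - X 4) * (X 3 - X 5) * (X 4 - X 5)), by ring⟩)
    by_cases h34 : i 3 = i 4
    · exact hz _ _ h34 (hd ⟨(X 0 - X 1) * (X 0 - X 2) * (X 1 - X 2) *
        ((X 3 - X 5) * (X 4 - X 5)), by ring⟩)
    by_cases h35 : i 3 = i 5
    · exact hz _ _ h35 (hd ⟨(X 0 - X 1) * (X 0 - X 2) * (X 1 - X 2) *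
        ((X 3 - X 4) * (X 4 - X 5)), by ring⟩)
    by_cases h45 : i 4 = i 5
    · exact hz _ _ h45 (hd ⟨(X 0 - X 1) * (X 0 - X 2) * (X 1 - X 2) *
        ((X 3 - X 4) * (X 3 - X 5)), by ring⟩)
    exact absurd ⟨⟨h01, h02, h12⟩, h34, h35, h45⟩ h

variable {e : ℤ → Module.End ℂ M}

/-- Symmetric relations hold at every point after multiplication by a power of `vdm`. -/
theorem IsWitt.vdm_pow_mul_mem (he : IsWitt e) {g : MvPolynomial (Fin 3) ℂ}
    (h01 : rename (Equiv.swap (0 : Fin 3) 1) g = g) (h12 : rename (Equiv.swap (1 : Fin 3) 2) g = g)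
    (hg : shiftAct g (word3 e) (fun _ => -1) = 0) : vdm ^ 16 * g ∈ shiftAnn (word3 e) := by
  classical
  obtain ⟨K, hK⟩ : ∃ K, K = shiftAct (vdm ^ 16 * g) (word3 e) := ⟨_, rfl⟩
  have hK01 : ∀ a, K (a ∘ Equiv.swap 0 1) = K a := by
    intro a
    obtain ⟨R, hR⟩ : ∃ R, R = (X 0 - X 2) ^ 2 * (X 1 - X 2) ^ 2 * vdm ^ 14 * g := ⟨_, rfl⟩
    have hp : vdm ^ 16 * g = (X 0 - X 1) ^ 2 * R := by
      rw [hR, show (16 : ℕ) = 2 + 14 from rfl, pow_add, show vdm ^ 2 = (X 0 - X 1) ^ 2 *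
        ((X 0 - X 2) ^ 2 * (X 1 - X 2) ^ 2) by rw [vdm]; ring]
      ring
    have hs : rename (Equiv.swap (0 : Fin 3) 1) R = R := by
      have h0 : Equiv.swap (0 : Fin 3) 1 2 = 2 := by decide
      rw [hR]
      simp only [map_mul, map_pow, map_sub, rename_X, rename_swap01_vdm, h01, h0,
        Equiv.swap_apply_left, Equiv.swap_apply_right]
      rw [Even.neg_pow (by decide)]
      ring
    have h := shiftAct_swap_mem 0 1 he.word3_swap01 R a
    rw [hs, ← hp, ← hK] at h
    exact h.symm
  have hK12 : ∀ a, K (a ∘ Equiv.swap 1 2) = K a := by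
    intro a
    obtain ⟨R, hR⟩ : ∃ R, R = (X 0 - X 1) ^ 2 * (X 0 - X 2) ^ 2 * vdm ^ 14 * g := ⟨_, rfl⟩
    have hp : vdm ^ 16 * g = (X 1 - X 2) ^ 2 * R := by
      rw [hR, show (16 : ℕ) = 2 + 14 from rfl, pow_add, show vdm ^ 2 = (X 1 - X 2) ^ 2 *
        ((X 0 - X 1) ^ 2 * (X 0 - X 2) ^ 2) by rw [vdm]; ring]
      ring
    have hs : rename (Equiv.swap (1 : Fin 3) 2) R = R := by
      have h0 : Equiv.swap (1 : Fin 3) 2 0 = 0 := by decide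
      rw [hR]
      simp only [map_mul, map_pow, map_sub, rename_X, rename_swap12_vdm, h12, h0,
        Equiv.swap_apply_left, Equiv.swap_apply_right]
      rw [Even.neg_pow (by decide)]
      ring
    have h := shiftAct_swap_mem 1 2 he.word3_swap12 R a
    rw [hs, ← hp, ← hK] at h
    exact h.symm
  have s01 : ∀ x y z : ℤ, K ![y, x, z] = K ![x, y, z] := by
    intro x y z
    rw [← hK01 ![x, y, z]]
    congr 1
    ext t; fin_cases t <;> rfl
  have s12 : ∀ x y z : ℤ, K ![x, z, y] = K ![x, y, z] := by
    intro x y z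
    rw [← hK12 ![x, y, z]]
    congr 1
    ext t; fin_cases t <;> rfl
  rw [mem_shiftAnn, ← hK]
  ext1 a
  obtain ⟨z, hz⟩ : ∃ z : Fin 6 → ℤ, z = ![0, 0, 0, a 0 - 5, a 1 - 5, a 2 - 5] := ⟨_, rfl⟩
  obtain ⟨Φ, hΦ⟩ : ∃ Φ, Φ = shiftAct (sepPoly * (X 0 * X 1 * X 2 - X 3 * X 4 * X 5) ^ 6)
    (fun z : Fin 6 → ℤ => (List.ofFn fun s => covOp (E := Module.End ℂ M) (z s)).prod) z :=
    ⟨_, rfl⟩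
  have hmem : Φ ∈ Algebra.adjoin ℂ (Set.range (covOp (E := Module.End ℂ M))) := by
    rw [hΦ]
    refine shiftAct_mem (E := Module.End ℂ ((Fin 3 → ℤ) → Module.End ℂ M))
      (Subalgebra.toSubmodule (Algebra.adjoin ℂ (Set.range covOp))) (fun z => ?_) _ _
    refine Subalgebra.list_prod_mem _ fun x hx => ?_
    obtain ⟨s, rfl⟩ := (List.mem_ofFn' _ _).1 hx
    exact Algebra.subset_adjoin ⟨_, rfl⟩
  have hval : ∀ c, Φ (word3 e) c = ∑ i : Fin 6 → Fin 3, if BlockInj i then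
      (-5760 : ℂ) • shiftAct (vdm ^ 16) (word3 e) (c + covArg i (fun _ => 6) z) else 0 := by
    intro c
    have h1 := shiftAct_linear ((LinearMap.proj c : ((Fin 3 → ℤ) → Module.End ℂ M) →ₗ[ℂ] _) ∘ₗ
      LinearMap.applyₗ (word3 e)) (sepPoly * (X 0 * X 1 * X 2 - X 3 * X 4 * X 5) ^ 6)
      (fun z : Fin 6 → ℤ => (List.ofFn fun s => covOp (E := Module.End ℂ M) (z s)).prod) z
    rw [← hΦ] at h1
    refine Eq.trans (Eq.symm h1) ?_
    have h2 : (fun z : Fin 6 → ℤ => ((LinearMap.proj c :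
        ((Fin 3 → ℤ) → Module.End ℂ M) →ₗ[ℂ] _) ∘ₗ LinearMap.applyₗ (word3 e))
        (List.ofFn fun s => covOp (E := Module.End ℂ M) (z s)).prod) =
        ∑ i : Fin 6 → Fin 3, fun z =>
          ((∏ s, covFac i c z s : ℤ) : ℂ) • word3 e (covArg i c z) := by
      ext1 z
      rw [Finset.sum_apply]
      exact covOp_prod_apply z (word3 e) c
    rw [h2, map_sum, Finset.sum_apply]
    refine Finset.sum_congr rfl fun i _ => ?_
    rw [shiftAct_sepPoly_covTerm]
    simp only [covArg, add_assoc]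
  obtain ⟨-, L, hL⟩ := he.word3_cov.exists_linear_of_mem_adjoin hmem
  have h0 : shiftAct g (Φ (word3 e)) (fun _ => -1) = 0 := by
    rw [hL, shiftAct_linear, hg, map_zero]
  have hfun : Φ (word3 e) = ∑ i : Fin 6 → Fin 3, if BlockInj i then
      (-5760 : ℂ) • (fun c => shiftAct (vdm ^ 16) (word3 e) (c + covArg i (fun _ => 6) z))
      else 0 := by
    ext1 c
    rw [hval, Finset.sum_apply]
    refine Finset.sum_congr rfl fun i _ => ?_
    split_ifs <;> rfl
  have hterm : ∀ i : Fin 6 → Fin 3, shiftAct g (if BlockInj i then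
      (-5760 : ℂ) • (fun c => shiftAct (vdm ^ 16) (word3 e) (c + covArg i (fun _ => 6) z))
      else 0) (fun _ => -1) = (if BlockInj i then (-5760 : ℂ) else 0) • K a := by
    intro i
    split_ifs with h
    · rw [map_smul, Pi.smul_apply, shiftAct_translate, ← shiftAct_mul, mul_comm g, ← hK]
      congr 1
      obtain ⟨-, h34, h35, h45⟩ := h
      have hc : (fun _ => -1) + covArg i (fun _ => 6) z = (fun _ => 5) +
          (Pi.single (i 3) (a 0 - 5) + Pi.single (i 4) (a 1 - 5) + Pi.single (i 5) (a 2 - 5)) := by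
        rw [covArg, hz, Fin.sum_univ_six]
        ext t
        simp
        ring
      rw [hc]
      have ha : a = ![a 0, a 1, a 2] := by ext t; fin_cases t <;> rfl
      rw [ha]
      generalize i 3 = x, i 4 = y, i 5 = w at h34 h35 h45
      have hs : ∀ x y w : Fin 3, x ≠ y → x ≠ w → y ≠ w → ∀ p q r : ℤ,
          K ((fun _ => 5) + (Pi.single x (p - 5) + Pi.single y (q - 5) + Pi.single w (r - 5))) =
          K ![p, q, r] := by
        intro x y w h1 h2 h3 p q r
        have hx : ∀ x y w : Fin 3, x ≠ y → x ≠ w → y ≠ w → (x = 0 ∧ y = 1 ∧ w = 2) ∨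
            (x = 0 ∧ y = 2 ∧ w = 1) ∨ (x = 1 ∧ y = 0 ∧ w = 2) ∨ (x = 1 ∧ y = 2 ∧ w = 0) ∨
            (x = 2 ∧ y = 0 ∧ w = 1) ∨ (x = 2 ∧ y = 1 ∧ w = 0) := by decide
        rcases hx x y w h1 h2 h3 with ⟨rfl, rfl, rfl⟩ | ⟨rfl, rfl, rfl⟩ | ⟨rfl, rfl, rfl⟩ |
          ⟨rfl, rfl, rfl⟩ | ⟨rfl, rfl, rfl⟩ | ⟨rfl, rfl, rfl⟩
        · refine (congrArg K (show _ = ![p, q, r] by ext t; fin_cases t <;> simp)).trans ?_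
          rfl
        · refine (congrArg K (show _ = ![p, r, q] by ext t; fin_cases t <;> simp)).trans ?_
          exact s12 _ _ _
        · refine (congrArg K (show _ = ![q, p, r] by ext t; fin_cases t <;> simp)).trans ?_
          exact s01 _ _ _
        · refine (congrArg K (show _ = ![r, p, q] by ext t; fin_cases t <;> simp)).trans ?_
          exact (s01 _ _ _).trans (s12 _ _ _)
        · refine (congrArg K (show _ = ![q, r, p] by ext t; fin_cases t <;> simp)).trans ?_
          exact (s12 _ _ _).trans (s01 _ _ _)
        · refine (congrArg K (show _ = ![r, q, p] by ext t; fin_cases t <;> simp)).trans ?_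
          exact (s01 _ _ _).trans ((s12 _ _ _).trans (s01 _ _ _))
      exact hs _ _ _ h34 h35 h45 _ _ _
    · simp
  rw [hfun, map_sum, Finset.sum_apply, Finset.sum_congr rfl fun i _ => hterm i,
    ← Finset.sum_smul, ← Finset.sum_filter, Finset.sum_const] at h0
  refine (smul_eq_zero.1 h0).resolve_left ?_
  rw [nsmul_eq_mul]
  refine mul_ne_zero (Nat.cast_ne_zero.2 (Finset.card_ne_zero.2
    ⟨![0, 1, 2, 0, 1, 2], Finset.mem_filter.2 ⟨Finset.mem_univ _, ?_⟩⟩)) (by norm_num)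
  refine ⟨⟨?_, ?_, ?_⟩, ?_, ?_, ?_⟩ <;> decide

/-- In a cuspidal module, differences of an order depending only on the bound of the weight
multiplicities annihilate the products of two Witt generators. -/
theorem IsWittBdd.exists_word2_mem (C : ℕ) : ∃ N : ℕ, 3 ≤ N ∧
    ∀ {M : Type} [AddCommGroup M] [Module ℂ M] {lam : ℂ} {e : ℤ → Module.End ℂ M}
      {wt : ℤ → Submodule ℂ M}, IsWittBdd C lam e wt → (X 0 - X 1) ^ N ∈ shiftAnn (word2 e) := by
  obtain ⟨d, hd⟩ : ∃ d, d = 16 + 6 * ((2 * C + 1) * C ^ 2) := ⟨_, rfl⟩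
  refine ⟨4 * (2 * d + 2 * (2 * d * C ^ 2) + 2), by omega, fun {M} _ _ {lam e wt} h => ?_⟩
  obtain ⟨g, hg0, hdeg, h01, h12, hg⟩ := h.exists_symmetric_relation
  have h3 := h.witt.word3_cov.vdm_pow_mem hg0 hdeg (h.witt.vdm_pow_mul_mem h01 h12 hg)
  rw [← hd] at h3
  have h4 := h.pair_mem h3
  rw [add_right_comm] at h4
  exact h.witt.word2_mem h4

end Symmetrization

section Mixed

open MvPolynomial

variable {M : Type*} [AddCommGroup M] [Module ℂ M] {e x : ℤ → Module.End ℂ M} {γ ε : ℂ}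

/-- The product of an element of a tensor density module and a Witt generator. -/
def mixed (x e : ℤ → Module.End ℂ M) : (Fin 2 → ℤ) → Module.End ℂ M := fun a => x (a 0) * e (a 1)

theorem mixed_mem (hx : ∀ k u : ℤ, e k * x u - x u * e k = (γ + u - ε * k) • x (k + u))
    (hε : 1 + ε ≠ 0) {N : ℕ} (hN : 3 ≤ N) (h : (X 0 - X 1) ^ N ∈ shiftAnn (word2 e)) :
    (X 0 - X 1) ^ (N + 2) ∈ shiftAnn (mixed x e) := by
  obtain ⟨φ, hφ⟩ : ∃ φ : (Fin 3 → ℤ) → Module.End ℂ M, φ = fun z => x (z 1 + z 2) * e (z 0) :=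
    ⟨_, rfl⟩
  obtain ⟨F₁, hF₁⟩ : ∃ F₁ : (Fin 3 → ℤ) → Module.End ℂ M,
      F₁ = fun z => (γ + z 2 - ε * z 1) • φ z := ⟨_, rfl⟩
  obtain ⟨F₂, hF₂⟩ : ∃ F₂ : (Fin 3 → ℤ) → Module.End ℂ M,
      F₂ = fun z => (γ + z 2 - ε * z 0) • (x (z 0 + z 2) * e (z 1)) := ⟨_, rfl⟩
  obtain ⟨F₃, hF₃⟩ : ∃ F₃ : (Fin 3 → ℤ) → Module.End ℂ M,
      F₃ = fun z => ((γ + z 2 - ε * z 1) * (γ + z 1 + z 2 - ε * z 0)) • x (z 0 + z 1 + z 2) :=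
    ⟨_, rfl⟩
  have hsum : ∀ z, (F₁ + F₂ + F₃) z = e (z 0) * e (z 1) * x (z 2) - x (z 2) * (e (z 0) * e (z 1)) := by
    intro z
    have h1 := hx (z 1) (z 2)
    have h2 := hx (z 0) (z 2)
    have h3 := hx (z 0) (z 1 + z 2)
    have h4 : e (z 0) * e (z 1) * x (z 2) - x (z 2) * (e (z 0) * e (z 1)) =
        e (z 0) * (e (z 1) * x (z 2) - x (z 2) * e (z 1)) +
          (e (z 0) * x (z 2) - x (z 2) * e (z 0)) * e (z 1) := by noncomm_ring
    rw [h4, h1, h2, mul_smul_comm, smul_mul_assoc, sub_eq_iff_eq_add.1 h3, smul_add, smul_smul]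
    simp only [hF₁, hF₂, hF₃, hφ, Pi.add_apply]
    push_cast
    rw [add_assoc (z 0), add_assoc γ]
    abel
  have hann : (X 0 - X 1) ^ N ∈ shiftAnn (F₁ + F₂ + F₃) := by
    rw [mem_shiftAnn]
    ext1 z
    have h1 := shiftAct_comp (![0, 1] : Fin 2 → Fin 3) (fun b : Fin 2 → ℤ => ![b 0, b 1, z 2])
      (by
        intro b i
        ext j
        fin_cases i <;> fin_cases j <;> simp) ((X 0 - X 1) ^ N) (F₁ + F₂ + F₃)
    have h2 : (fun b : Fin 2 → ℤ => (F₁ + F₂ + F₃) ![b 0, b 1, z 2]) = fun b =>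
        (LinearMap.mulRight ℂ (x (z 2)) - LinearMap.mulLeft ℂ (x (z 2))) (word2 e b) := by
      ext1 b
      rw [hsum]
      rfl
    have h3 := congrFun h1 ![z 0, z 1]
    rw [h2, shiftAct_linear, mem_shiftAnn.1 h] at h3
    have h4 : (![z 0, z 1, z 2] : Fin 3 → ℤ) = z := by ext i; fin_cases i <;> rfl
    simp only [map_pow, map_sub, rename_X, Matrix.cons_val_zero, Matrix.cons_val_one, h4,
      Pi.zero_apply, map_zero] at h3
    rw [map_pow, map_sub]
    exact h3.symm
  have h2 : (X 0 - X 2) ^ 2 ∈ shiftAnn F₂ := by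
    rw [mem_shiftAnn]
    ext1 z
    have hv : ∀ j : ℕ, F₂ (z + (2 • Pi.single 2 1 + j • (Pi.single 0 1 - Pi.single 2 1))) =
        (γ + (z 2 + 2 - j) - ε * (z 0 + j)) • (x (z 0 + z 2 + 2) * e (z 1)) := by
      intro j
      have hz : z + (2 • Pi.single 2 1 + j • (Pi.single 0 1 - Pi.single 2 1)) =
          ![z 0 + j, z 1, z 2 + 2 - j] := by
        ext i
        fin_cases i <;> simp
        ring
      rw [hz, hF₂]
      simp only [Matrix.cons_val]
      push_cast
      rw [show z 0 + j + (z 2 + 2 - j) = z 0 + z 2 + 2 by ring]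
    rw [shiftAct_sub_pow_eq_sum (fun G a => shiftAct_X 0 G a) (fun G a => shiftAct_X 2 G a)]
    simp only [hv, smul_smul, ← Finset.sum_smul]
    rw [Pi.zero_apply]
    convert zero_smul ℂ _ using 2
    simp [Finset.sum_range_succ, Nat.choose]
    ring
  have h3 : (X 0 - X 1) ^ 3 ∈ shiftAnn F₃ := by
    rw [mem_shiftAnn]
    ext1 z
    have hv : ∀ j : ℕ, F₃ (z + (3 • Pi.single 1 1 + j • (Pi.single 0 1 - Pi.single 1 1))) =
        ((γ + z 2 - ε * (z 1 + 3 - j)) * (γ + (z 1 + 3 - j) + z 2 - ε * (z 0 + j))) •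
          x (z 0 + z 1 + z 2 + 3) := by
      intro j
      have hz : z + (3 • Pi.single 1 1 + j • (Pi.single 0 1 - Pi.single 1 1)) =
          ![z 0 + j, z 1 + 3 - j, z 2] := by
        ext i
        fin_cases i <;> simp
        ring
      rw [hz, hF₃]
      simp only [Matrix.cons_val]
      push_cast
      rw [show z 0 + j + (z 1 + 3 - j) + z 2 = z 0 + z 1 + z 2 + 3 by ring]
    rw [shiftAct_sub_pow_eq_sum (fun G a => shiftAct_X 0 G a) (fun G a => shiftAct_X 1 G a)]
    simp only [hv, smul_smul, ← Finset.sum_smul]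
    rw [Pi.zero_apply]
    convert zero_smul ℂ _ using 2
    simp [Finset.sum_range_succ, Nat.choose]
    ring
  have h1 : (X 0 - X 1) ^ N * (X 0 - X 2) ^ 2 ∈ shiftAnn F₁ := by
    have k := mem_shiftAnn_of_dvd (Dvd.intro ((X 0 - X 2) ^ 2) rfl) hann
    have k2 := mem_shiftAnn_of_dvd (Dvd.intro_left ((X 0 - X 1) ^ N) rfl) h2
    have k3 := mem_shiftAnn_of_dvd ((pow_dvd_pow _ hN).mul_right ((X 0 - X 2) ^ 2)) h3
    rw [mem_shiftAnn] at k k2 k3 ⊢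
    rw [map_add, map_add, k2, k3, add_zero, add_zero] at k
    exact k
  have hcoef : ∀ (p : MvPolynomial (Fin 3) ℂ) z, shiftAct p F₁ z =
      (γ + z 2 - ε * z 1) • shiftAct p φ z +
        shiftAct (X 2 * pderiv 2 p - C ε * (X 1 * pderiv 1 p)) φ z := by
    intro p z
    have h4 : F₁ = γ • φ + (fun z : Fin 3 → ℤ => (z 2 : ℂ) • φ z) -
        ε • fun z : Fin 3 → ℤ => (z 1 : ℂ) • φ z := by
      rw [hF₁]
      ext1 z
      simp only [Pi.add_apply, Pi.sub_apply, Pi.smul_apply, sub_smul, add_smul, mul_smul]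
    rw [h4, map_sub, map_add, map_smul, map_smul, Pi.sub_apply, Pi.add_apply, Pi.smul_apply,
      Pi.smul_apply, shiftAct_coeff, shiftAct_coeff, shiftAct_sub, shiftAct_mul (C ε),
      shiftAct_C, Pi.sub_apply, Pi.smul_apply]
    module
  have hcomp : ∀ (p : MvPolynomial (Fin 3) ℂ) z, shiftAct p φ z =
      shiftAct (rename (![1, 0, 0] : Fin 3 → Fin 2) p) (mixed x e) ![z 1 + z 2, z 0] := by
    intro p z
    have h4 := shiftAct_comp (![1, 0, 0] : Fin 3 → Fin 2)
      (fun z : Fin 3 → ℤ => ![z 1 + z 2, z 0]) (by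
        intro b i
        ext j
        fin_cases i <;> fin_cases j <;> simp <;> ring) p (mixed x e)
    rw [← congrFun h4 z, hφ]
    rfl
  rw [mem_shiftAnn]
  ext1 w
  have hw : w = ![w 0, w 1] := by ext i; fin_cases i <;> rfl
  have k1 := congrFun (mem_shiftAnn.1 h1) ![w 1, 0, w 0]
  have k2 := congrFun (mem_shiftAnn.1 h1) ![w 1, -1, w 0 + 1]
  rw [hcoef, hcomp, hcomp] at k1 k2
  simp only [Matrix.cons_val] at k1 k2
  rw [show -1 + (w 0 + 1) = w 0 by ring] at k2
  rw [zero_add] at k1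
  rw [← hw] at k1 k2
  have k3 := k2.trans k1.symm
  rw [add_left_inj] at k3
  simp only [map_mul, map_pow, map_sub, rename_X, Matrix.cons_val] at k3
  rw [← sub_eq_zero, ← sub_smul, ← pow_add] at k3
  push_cast at k3
  have k4 := (smul_eq_zero.1 k3).resolve_left (by
    intro h5
    apply hε
    linear_combination h5)
  have k5 : (X 0 - X 1 : MvPolynomial (Fin 2) ℂ) ^ (N + 2) =
      C ((-1) ^ (N + 2)) * (X 1 - X 0) ^ (N + 2) := by
    rw [map_pow, ← mul_pow]
    congr 1
    simp
  rw [k5, shiftAct_mul, shiftAct_C, Pi.smul_apply, map_pow, map_sub, k4, smul_zero]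
  rfl

end Mixed

section Final

open MvPolynomial

variable {m n : ℕ} {b : Bool}

theorem gdeg_false : gdeg (fun _ : Fin n => false) = 0 := by simp [gdeg]

theorem mulSgn_false_left (r : GExp n) : mulSgn (fun _ => false) r = 1 := by
  simp [mulSgn, invCount]

theorem xorE_false_left (r : GExp n) : xorE (fun _ => false) r = r := by
  ext a
  simp [xorE]

theorem derC_false (α : Fin n) : derC α (fun _ : Fin n => false) = 0 := by simp [derC]

/-- The basis element `t_i^k d_i`, spanning a Witt algebra as `k` varies. -/
def wittB (m n : ℕ) (b : Bool) (i : Fin m) (k : ℤ) : WBasis m n b :=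
  ⟨onlyI i k, fun _ => false, .di i⟩

/-- `1` if the direction is `d_i`, and `0` otherwise. -/
def dirC (i : Fin m) : Dir m n b → ℂ
  | .di j => if j = i then 1 else 0
  | .pa _ => 0
  | .d0 => 0

theorem brB_wittB (i : Fin m) (k : ℤ) (p : LExp m) (r : GExp n) (D : Dir m n b) :
    brB (wittB m n b i k) ⟨p, r, D⟩ = ((p i : ℂ) - dirC i D * k) • sng ⟨onlyI i k + p, r, D⟩ := by
  cases D with
  | di j =>
    by_cases h : j = i
    · subst h
      simp [wittB, brB, mulSgn_false_left, xorE_false_left, dirC, onlyI, sub_smul]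
    · simp [wittB, brB, mulSgn_false_left, xorE_false_left, dirC, onlyI, h]
  | pa α => simp [wittB, brB, mulSgn_false_left, xorE_false_left, dirC, derC_false]
  | d0 => simp [wittB, brB, mulSgn_false_left, xorE_false_left, dirC]

theorem WRep.g_comm (ρ : WRep m n b) (i : Fin m) (k : ℤ) (p : LExp m) (r : GExp n)
    (D : Dir m n b) :
    (ρ.g (wittB m n b i k) : Module.End ℂ ρ.M) * ρ.g ⟨p, r, D⟩ -
      ρ.g ⟨p, r, D⟩ * ρ.g (wittB m n b i k) =
      ((p i : ℂ) - dirC i D * k) • ρ.g ⟨onlyI i k + p, r, D⟩ := by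
  have h := ρ.super (wittB m n b i k) ⟨p, r, D⟩
  rw [brB_wittB, map_smul] at h
  have hp : par (wittB m n b i k) = 0 := by simp [wittB, par, gdeg_false]
  rw [hp, zero_mul, pow_zero, one_smul] at h
  exact h.symm

/-- The weight `lam` shifted by `j` times the weight of `t_i`. -/
def shiftWt (i : Fin m) (lam : HIdx m b → ℂ) (j : ℤ) : HIdx m b → ℂ :=
  fun h => lam h + if h = .inl i then (j : ℂ) else 0

theorem onlyI_add_onlyI (i : Fin m) (k l : ℤ) :
    (onlyI i k + onlyI i l : LExp m) = onlyI i (k + l) := by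
  ext x
  simp only [Pi.add_apply, onlyI]
  split_ifs <;> simp

theorem onlyI_add_addI (p : LExp m) (i : Fin m) (k u : ℤ) :
    (onlyI i k + addI p i u : LExp m) = addI p i (k + u) := by
  ext x
  simp only [Pi.add_apply, onlyI, addI]
  split_ifs <;> ring

theorem mem_ker_sub_smul_of_comm {M : Type*} [AddCommGroup M] [Module ℂ M]
    {E T : Module.End ℂ M} {c a a' : ℂ} (h : E * T - T * E = -c • E) (ha : a' = a + c) {v : M}
    (hv : v ∈ LinearMap.ker (T - a • (LinearMap.id : M →ₗ[ℂ] M))) :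
    E v ∈ LinearMap.ker (T - a' • (LinearMap.id : M →ₗ[ℂ] M)) := by
  have h1 := LinearMap.congr_fun h v
  simp only [LinearMap.mem_ker, LinearMap.sub_apply, LinearMap.smul_apply, LinearMap.id_apply,
    Module.End.mul_apply, sub_eq_zero] at h1 hv ⊢
  rw [hv, map_smul] at h1
  rw [ha, add_smul, ← sub_eq_zero]
  rw [← sub_eq_zero] at h1
  rw [← neg_eq_zero, ← h1]
  module

theorem WRep.map_wtFullG (ρ : WRep m n b) (i : Fin m) (lam : HIdx m b → ℂ) (mu : Fin n → ℂ)
    (k j : ℤ) {v : ρ.M} (hv : v ∈ wtFullG ρ.g (shiftWt i lam j) mu) :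
    ρ.g (wittB m n b i k) v ∈ wtFullG ρ.g (shiftWt i lam (j + k)) mu := by
  simp only [wtFullG, wtG, Submodule.mem_inf, Submodule.mem_iInf] at hv ⊢
  refine ⟨fun h => ?_, fun a => ?_⟩
  · refine mem_ker_sub_smul_of_comm (c := if h = .inl i then (k : ℂ) else 0) ?_ ?_ (hv.1 h)
    · match b, h with
      | b, .inl l =>
        have h1 : hB m n b (.inl l) = ⟨0, fun _ => false, .di l⟩ := by cases b <;> rfl
        rw [h1, ρ.g_comm]
        by_cases hl : l = i
        · subst hl
          simp [dirC, wittB]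
        · simp [dirC, hl]
      | true, .inr l =>
        have h1 : hB m n true (.inr l) = ⟨0, fun _ => false, .d0⟩ := rfl
        rw [h1, ρ.g_comm]
        simp [dirC]
      | false, .inr l => exact l.elim0
    · simp only [shiftWt]
      split_ifs <;> push_cast <;> ring
  · refine mem_ker_sub_smul_of_comm (c := 0) ?_ (by ring) (hv.2 a)
    rw [hppB, ρ.g_comm]
    simp [dirC]

theorem WRep.g_wittB_zero (ρ : WRep m n b) (i : Fin m) (lam : HIdx m b → ℂ) (mu : Fin n → ℂ)
    (j : ℤ) {v : ρ.M} (hv : v ∈ wtFullG ρ.g (shiftWt i lam j) mu) :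
    ρ.g (wittB m n b i 0) v = (lam (.inl i) + j) • v := by
  simp only [wtFullG, wtG, Submodule.mem_inf, Submodule.mem_iInf] at hv
  have h := hv.1 (.inl i)
  have h1 : hB m n b (.inl i) = wittB m n b i 0 := by
    have h2 : (onlyI i 0 : LExp m) = 0 := by
      ext x
      simp [onlyI]
    rw [wittB, h2]
    cases b <;> rfl
  rw [h1] at h
  simpa [sub_eq_zero, shiftWt] using h

theorem isWitt_wittB (ρ : WRep m n b) (i : Fin m) (k l : ℤ) :
    (ρ.g (wittB m n b i k) : Module.End ℂ ρ.M) * ρ.g (wittB m n b i l) -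
      ρ.g (wittB m n b i l) * ρ.g (wittB m n b i k) =
      ((l : ℂ) - k) • ρ.g (wittB m n b i (k + l)) := by
  have h := ρ.g_comm i k (onlyI i l) (fun _ => false) (.di i)
  rw [onlyI_add_onlyI] at h
  simpa [dirC, onlyI, wittB] using h

/-- The span of the weight spaces along the `t_i`-string through `lam`. -/
def stringSub (ρ : WRep m n b) (i : Fin m) (lam : HIdx m b → ℂ) (mu : Fin n → ℂ) :
    Submodule ℂ ρ.M := ⨆ j : ℤ, wtFullG ρ.g (shiftWt i lam j) mu

theorem map_stringSub (ρ : WRep m n b) (i : Fin m) (lam : HIdx m b → ℂ) (mu : Fin n → ℂ) (k : ℤ) :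
    ∀ v ∈ stringSub ρ i lam mu, ρ.g (wittB m n b i k) v ∈ stringSub ρ i lam mu := by
  have h : stringSub ρ i lam mu ≤ (stringSub ρ i lam mu).comap (ρ.g (wittB m n b i k)) := by
    refine iSup_le fun j v hv => ?_
    exact Submodule.mem_iSup_of_mem (j + k) (ρ.map_wtFullG i lam mu k j hv)
  exact h

/-- The Witt generators acting on a string. -/
def stringAct (ρ : WRep m n b) (i : Fin m) (lam : HIdx m b → ℂ) (mu : Fin n → ℂ) (k : ℤ) :
    Module.End ℂ (stringSub ρ i lam mu) :=
  (ρ.g (wittB m n b i k)).restrict (map_stringSub ρ i lam mu k)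

theorem isWittBdd_stringAct (ρ : WRep m n b) {C : ℕ}
    (hfin : ∀ lam mu, FiniteDimensional ℂ (wtFullG ρ.g lam mu))
    (hC : ∀ lam mu, Module.finrank ℂ (wtFullG ρ.g lam mu) ≤ C)
    (i : Fin m) (lam : HIdx m b → ℂ) (mu : Fin n → ℂ) :
    IsWittBdd C (lam (.inl i)) (stringAct ρ i lam mu)
      (fun j => (wtFullG ρ.g (shiftWt i lam j) mu).comap (stringSub ρ i lam mu).subtype) := by
  have hle : ∀ j, wtFullG ρ.g (shiftWt i lam j) mu ≤ stringSub ρ i lam mu :=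
    fun j => le_iSup (fun j : ℤ => wtFullG ρ.g (shiftWt i lam j) mu) j
  refine ⟨fun k l => ?_, fun k j v hv => ?_, fun j v hv => ?_, fun j => ?_, fun j => ?_, ?_⟩
  · ext v
    exact LinearMap.congr_fun (isWitt_wittB ρ i k l) v.1
  · exact ρ.map_wtFullG i lam mu k j hv
  · ext
    exact ρ.g_wittB_zero i lam mu j hv
  · have := hfin (shiftWt i lam j) mu
    exact Module.Finite.equiv (Submodule.comapSubtypeEquivOfLe (hle j)).symm
  · rw [(Submodule.comapSubtypeEquivOfLe (hle j)).finrank_eq]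
    exact hC _ _
  · apply Submodule.map_injective_of_injective (stringSub ρ i lam mu).injective_subtype
    rw [Submodule.map_iSup, Submodule.map_top, Submodule.range_subtype]
    refine iSup_congr fun j => ?_
    rw [Submodule.map_comap_subtype, inf_eq_right.2 (hle j)]

theorem word2_wittB_mem (ρ : WRep m n b) (hcusp : IsCuspidalG ρ.g) :
    ∃ N, 3 ≤ N ∧ ∀ i : Fin m, (X 0 - X 1) ^ N ∈
      shiftAnn (word2 fun k => (ρ.g (wittB m n b i k) : Module.End ℂ ρ.M)) := by
  obtain ⟨⟨htop, hfin⟩, C, hC⟩ := hcusp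
  obtain ⟨N, hN, h⟩ := IsWittBdd.exists_word2_mem C
  refine ⟨N, hN, fun i => ?_⟩
  rw [mem_shiftAnn]
  ext1 a
  have hker : (⊤ : Submodule ℂ ρ.M) ≤ LinearMap.ker (shiftAct ((X 0 - X 1) ^ N)
      (word2 fun k => (ρ.g (wittB m n b i k) : Module.End ℂ ρ.M)) a) := by
    rw [← htop]
    refine iSup_le fun lam => iSup_le fun mu v hv => ?_
    have hz : shiftWt i lam 0 = lam := by
      ext h
      simp [shiftWt]
    have hv' : v ∈ stringSub ρ i lam mu :=
      Submodule.mem_iSup_of_mem 0 (by rwa [hz])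
    have h1 := h (isWittBdd_stringAct ρ hfin hC i lam mu)
    rw [mem_shiftAnn] at h1
    have h2 := congrArg Subtype.val (LinearMap.congr_fun (congrFun h1 a) ⟨v, hv'⟩)
    have key : ∀ {M' : Type} [AddCommGroup M'] [Module ℂ M'] (G : (Fin 2 → ℤ) → M'),
        shiftAct ((X 0 - X 1) ^ N) G a = ∑ j ∈ Finset.range (N + 1),
          (((-1 : ℤ) ^ (j + N) * (N.choose j : ℤ) : ℤ) : ℂ) •
            G (a + (N • Pi.single 1 1 + j • (Pi.single 0 1 - Pi.single 1 1))) := fun G =>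
      shiftAct_sub_pow_eq_sum (fun G a => shiftAct_X 0 G a) (fun G a => shiftAct_X 1 G a) N G a
    rw [key] at h2
    rw [LinearMap.mem_ker, key]
    simp only [LinearMap.sum_apply, LinearMap.smul_apply] at h2 ⊢
    rw [AddSubmonoidClass.coe_finsetSum] at h2
    exact h2
  exact LinearMap.ext fun v => hker trivial

theorem cuspidal_annihilator_aux (ρ : WRep m n b) (hcusp : IsCuspidalG ρ.g) :
    ∃ N : ℕ, ∀ (p q : LExp m) (r : GExp n) (i : Fin m) (D : Dir m n b),
      (∑ a ∈ Finset.range (N + 1), ((-1 : ℂ) ^ a * (N.choose a : ℂ)) •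
        (ρ.g ⟨addI p i (a : ℤ), r, D⟩ ∘ₗ
          ρ.g ⟨onlyI i (q i - (a : ℤ)), fun _ => false, .di i⟩)) = 0 := by
  obtain ⟨N, hN, h⟩ := word2_wittB_mem ρ hcusp
  refine ⟨N + 2, fun p q r i D => ?_⟩
  have hx : ∀ k u : ℤ, (ρ.g (wittB m n b i k) : Module.End ℂ ρ.M) * ρ.g ⟨addI p i u, r, D⟩ -
      ρ.g ⟨addI p i u, r, D⟩ * ρ.g (wittB m n b i k) =
      ((p i : ℂ) + u - dirC i D * k) • ρ.g ⟨addI p i (k + u), r, D⟩ := by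
    intro k u
    rw [ρ.g_comm, onlyI_add_addI]
    simp [addI]
  have hε : 1 + dirC i D ≠ 0 := by
    cases D with
    | di j =>
      simp only [dirC]
      split_ifs <;> norm_num
    | pa α => simp [dirC]
    | d0 => simp [dirC]
  have h1 := mixed_mem (x := fun u => ρ.g ⟨addI p i u, r, D⟩)
    (e := fun k => ρ.g (wittB m n b i k)) hx hε hN (h i)
  have h2 := congrFun (mem_shiftAnn.1 h1) ![0, q i - (N + 2 : ℕ)]
  rw [shiftAct_sub_pow_eq_sum (fun G a => shiftAct_X 0 G a) (fun G a => shiftAct_X 1 G a)] at h2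
  have h3 := congrArg (fun T => (-1 : ℂ) ^ (N + 2) • T) h2
  simp only [Finset.smul_sum, Pi.zero_apply, smul_zero] at h3
  rw [← h3]
  refine Finset.sum_congr rfl fun a _ => ?_
  have hz : (![0, q i - (N + 2 : ℕ)] + ((N + 2) • Pi.single 1 1 +
      a • (Pi.single 0 1 - Pi.single 1 1)) : Fin 2 → ℤ) = ![(a : ℤ), q i - a] := by
    ext l
    fin_cases l
    · simp
    · simp
      ring
  rw [hz, smul_smul]
  congr 1
  push_cast
  rw [pow_add (-1 : ℂ) a, ← mul_assoc, mul_left_comm, ← mul_pow]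
  simp

end Final

end

/-- For any cuspidal module `M` over `V = W(m,n)` (`b = false`)
or `V = W(m,n) ⋉ A d_0` (`b = true`), there exists `N ∈ ℕ` such that for all
`p, q ∈ ℤ^m`, `r ∈ {0,1}^n`, `i, j = 1,…,m`, `α = 1,…,n`, the following
elements of `U(V)` annihilate `M`:
`Σ_{a=0}^N (−1)^a C(N,a) (t^p t_i^a ξ^r d_j)(t_i^{q−a} d_i)`,
`Σ_{a=0}^N (−1)^a C(N,a) (t^p t_i^a ξ^r ∂_α)(t_i^{q−a} d_i)`, and
`Σ_{a=0}^N (−1)^a C(N,a) (t^p t_i^a ξ^r d_0)(t_i^{q−a} d_i)`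
(the products being compositions of the action operators). -/
theorem cuspidal_annihilator (m n : ℕ) (b : Bool) (ρ : WRep m n b)
    (hcusp : IsCuspidalG ρ.g) :
    ∃ N : ℕ,
      ∀ (p q : LExp m) (r : GExp n) (i j : Fin m) (α : Fin n),
        (∑ a ∈ Finset.range (N + 1),
          ((-1 : ℂ) ^ a * (N.choose a : ℂ)) •
            (ρ.g ⟨addI p i (a : ℤ), r, .di j⟩ ∘ₗ
              ρ.g ⟨onlyI i (q i - (a : ℤ)), fun _ => false, .di i⟩)) = 0 ∧
        (∑ a ∈ Finset.range (N + 1),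
          ((-1 : ℂ) ^ a * (N.choose a : ℂ)) •
            (ρ.g ⟨addI p i (a : ℤ), r, .pa α⟩ ∘ₗ
              ρ.g ⟨onlyI i (q i - (a : ℤ)), fun _ => false, .di i⟩)) = 0 ∧
        (∀ h : b = true,
          (∑ a ∈ Finset.range (N + 1),
            ((-1 : ℂ) ^ a * (N.choose a : ℂ)) •
              (ρ.g ⟨addI p i (a : ℤ), r, (h ▸ Dir.d0 : Dir m n b)⟩ ∘ₗ
                ρ.g ⟨onlyI i (q i - (a : ℤ)), fun _ => false, .di i⟩)) = 0) := by
  obtain ⟨N, hN⟩ := cuspidal_annihilator_aux ρ hcusp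
  exact ⟨N, fun p q r i j α =>
    ⟨hN p q r i (.di j), hN p q r i (.pa α), fun h => hN p q r i (h ▸ Dir.d0)⟩⟩

end WSuper
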